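/- Non-real magic angles in every rotational representation for the Bistritzer–MacDonald potential: For the chiral model with the Bistritzer–MacDonald potential U_BM, for every j ∈ {0,1,2} there exists a magic parameter α_j ∈ ℂ∖ℝ with Ker_j(α_j) ≠ {0}. Consequently there exists a magic parameter α ∈ ℂ∖ℝ which is non-simple, i.e. dim_ℂ Ker(α,k) ≥ 2 for every k ∈ ℂ. -/

import Mathlib

noncomputable section

open Complex MeasureTheory

namespace TBG

/-- `ω = exp(2πi/3)`. -/
def ω : ℂ := Complex.exp (2 * Real.pi * Complex.I / 3)

/-- The moiré lattice `Λ = ℤω + ℤ ⊂ ℂ`. -/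
def Λ : Set ℂ := {z : ℂ | ∃ m n : ℤ, z = m * ω + n}

/-- The dual lattice `Λ* = (4πi/√3)·Λ`. -/
def Λdual : Set ℂ := {p : ℂ | ∃ m n : ℤ, p = 4 * Real.pi * Complex.I / Real.sqrt 3 * (m * ω + n)}

/-- The high symmetry point `K = 4π/3`. -/
def K : ℂ := 4 * Real.pi / 3

/-- `⟨z,w⟩ = Re (z · conj w)`. -/
def pair (z w : ℂ) : ℝ := (z * (starRingEnd ℂ) w).re

/-- `2 D_z̄ f = (1/i)(∂_x f + i ∂_y f)`. -/
def Dbar (f : ℂ → ℂ) (z : ℂ) : ℂ :=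
  1 / Complex.I * (fderiv ℝ f z 1 + Complex.I * fderiv ℝ f z Complex.I)

/-- A tunnelling potential: smooth, with the translational and rotational symmetries. -/
def IsTunnelling (U : ℂ → ℂ) : Prop :=
  ContDiff ℝ (⊤ : ℕ∞) U ∧
    (∀ γ ∈ Λ, ∀ z : ℂ, U (z + γ) = Complex.exp (Complex.I * (pair γ K : ℂ)) * U z) ∧
    ∀ z : ℂ, U (ω * z) = ω * U z

/-- Membership in `ker_{L²₀}(D(α)+k)` for the chiral model with tunnelling
potentials `U₊ = Up`, `U₋ = Um`: smooth solutions of `(D(α)+k)u = 0` with the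
Floquet boundary conditions. -/
def InKer (Up Um : ℂ → ℂ) (α k : ℂ) (u : ℂ → ℂ × ℂ) : Prop :=
  ContDiff ℝ (⊤ : ℕ∞) u ∧
    (∀ z : ℂ, Dbar (fun w => (u w).1) z + k * (u z).1 + α * Up z * (u z).2 = 0) ∧
    (∀ z : ℂ, Dbar (fun w => (u w).2) z + k * (u z).2 + α * Um z * (u z).1 = 0) ∧
    (∀ γ ∈ Λ, ∀ z : ℂ, (u (z + γ)).1 = Complex.exp (-Complex.I * (pair γ K : ℂ)) * (u z).1) ∧
    (∀ γ ∈ Λ, ∀ z : ℂ, (u (z + γ)).2 = Complex.exp (Complex.I * (pair γ K : ℂ)) * (u z).2)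

/-- `Ker(α,k)` as a set of functions. -/
def kerSet (Up Um : ℂ → ℂ) (α k : ℂ) : Set (ℂ → ℂ × ℂ) := {u | InKer Up Um α k u}

/-- `dim_ℂ Ker(α,k)` (the set `Ker(α,k)` is a linear subspace, so the finrank of its span
is its dimension). -/
def kerDim (Up Um : ℂ → ℂ) (α k : ℂ) : ℕ :=
  Module.finrank ℂ ↥(Submodule.span ℂ (kerSet Up Um α k))

/-- `Ker_p(α) = {u ∈ Ker(α,0) : u(ωz) = ω^(−p)·u(z)}`. -/
def kerPSet (Up Um : ℂ → ℂ) (α : ℂ) (p : ℕ) : Set (ℂ → ℂ × ℂ) :=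
  {u | u ∈ kerSet Up Um α 0 ∧ ∀ z : ℂ, u (ω * z) = (ω ^ (-(p : ℤ))) • u z}

/-- `dim_ℂ Ker_p(α)`. -/
def kerPDim (Up Um : ℂ → ℂ) (α : ℂ) (p : ℕ) : ℕ :=
  Module.finrank ℂ ↥(Submodule.span ℂ (kerPSet Up Um α p))

/-- `α` is magic: the flat band condition `Ker(α,k) ≠ {0}` for every `k`. -/
def IsMagic (Up Um : ℂ → ℂ) (α : ℂ) : Prop :=
  ∀ k : ℂ, ∃ u ∈ kerSet Up Um α k, u ≠ 0


/-- The (rescaled) Bistritzer–MacDonald potential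
`U_BM(z) = −(4π/3)·i·Σ_{ℓ=0}^{2} ω^ℓ·exp((4π/3)·i·⟨z,ω^ℓ⟩)`. -/
def UBM (z : ℂ) : ℂ :=
  -(4 * Real.pi / 3) * Complex.I *
    ∑ l ∈ Finset.range 3, ω ^ l * Complex.exp (4 * Real.pi / 3 * Complex.I * (pair z (ω ^ l) : ℂ))

/-! ### Cube roots of unity -/

lemma omega_primitive : IsPrimitiveRoot ω 3 := by
  have := Complex.isPrimitiveRoot_exp 3 (by norm_num)
  simpa [ω] using this

lemma omega_pow_three : ω ^ 3 = 1 := omega_primitive.pow_eq_one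

lemma omega_ne_zero : ω ≠ 0 := omega_primitive.ne_zero (by norm_num)

lemma omega_sq : ω ^ 2 = -1 - ω := by
  have h := omega_primitive.geom_sum_eq_zero (by norm_num)
  simp [Finset.sum_range_succ] at h
  linear_combination h

lemma omega_re : ω.re = -1 / 2 := by
  have h : (2 * Real.pi * Complex.I / 3 : ℂ) = ((Real.pi - Real.pi / 3 : ℝ) : ℂ) * Complex.I := by
    push_cast; ring
  rw [ω, h, Complex.exp_ofReal_mul_I_re, Real.cos_pi_sub, Real.cos_pi_div_three]
  norm_num

lemma omega_im : ω.im = √3 / 2 := by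
  have h : (2 * Real.pi * Complex.I / 3 : ℂ) = ((Real.pi - Real.pi / 3 : ℝ) : ℂ) * Complex.I := by
    push_cast; ring
  rw [ω, h, Complex.exp_ofReal_mul_I_im, Real.sin_pi_sub, Real.sin_pi_div_three]

lemma norm_omega : ‖ω‖ = 1 := omega_primitive.norm'_eq_one (by norm_num)

lemma normSq_int_add_int_mul_omega (x y : ℤ) :
    Complex.normSq (x + y * ω) = ((x ^ 2 - x * y + y ^ 2 : ℤ) : ℝ) := by
  have h3 : √3 * √3 = 3 := Real.mul_self_sqrt (by norm_num)
  simp [Complex.normSq_apply, omega_re, omega_im]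
  linear_combination (y : ℝ) ^ 2 / 4 * h3

/-- `x + yω = 0` only for `x = y = 0`. -/
lemma eq_zero_of_add_mul_omega {x y : ℤ} (h : (x : ℂ) + y * ω = 0) : x = 0 ∧ y = 0 := by
  have h1 := normSq_int_add_int_mul_omega x y
  rw [h] at h1
  have h2 : x ^ 2 - x * y + y ^ 2 = 0 := by
    have : ((x ^ 2 - x * y + y ^ 2 : ℤ) : ℝ) = 0 := by rw [← h1]; simp
    exact_mod_cast this
  constructor <;> nlinarith [sq_nonneg (x - y), sq_nonneg x, sq_nonneg y, sq_nonneg (x + y), sq_nonneg (2 * x - y), sq_nonneg (x - 2 * y)]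

/-! ### The lattice of modes -/

/-- The momenta `-1 + √-3 (p + qω)` of the first component of a Floquet function. -/
def mode (n : ℤ × ℤ) : ℂ := (n.1 - 2 * n.2 - 1 : ℤ) + (2 * n.1 - n.2 : ℤ) * ω

/-- The index of the momentum `ω ^ l - mode n`. -/
def refl (l : ℕ) (n : ℤ × ℤ) : ℤ × ℤ :=
  match l with
  | 0 => (-1 - n.1, -2 - n.2)
  | 1 => (0 - n.1, -1 - n.2)
  | _ => (-1 - n.1, -1 - n.2)

/-- Multiplication of momenta by `ω`. -/
def rot (n : ℤ × ℤ) : ℤ × ℤ := (-n.2 - 1, n.1 - n.2 - 1)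

lemma mode_refl {l : ℕ} (hl : l < 3) (n : ℤ × ℤ) : mode (refl l n) = ω ^ l - mode n := by
  have := omega_sq
  interval_cases l <;> simp [mode, refl] <;> [ring; ring; linear_combination -this]

lemma refl_refl (l : ℕ) (n : ℤ × ℤ) : refl l (refl l n) = n := by
  unfold refl; split <;> ext <;> simp

lemma mode_rot (n : ℤ × ℤ) : mode (rot n) = ω * mode n := by
  have := omega_sq
  simp [mode, rot]
  linear_combination -(2 * (n.1 : ℂ) - n.2) * this

lemma rot_rot_rot (n : ℤ × ℤ) : rot (rot (rot n)) = n := by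
  ext
  · simp [rot]
  · simp [rot]; ring

lemma rot_refl_zero (n : ℤ × ℤ) : rot (refl 0 n) = refl 1 (rot n) := by
  ext <;> simp [rot, refl] <;> ring

lemma rot_refl_one (n : ℤ × ℤ) : rot (refl 1 n) = refl 2 (rot n) := by
  ext <;> simp [rot, refl] <;> ring

lemma rot_refl_two (n : ℤ × ℤ) : rot (refl 2 n) = refl 0 (rot n) := by
  ext <;> simp [rot, refl] <;> ring

lemma refl_sub (l : ℕ) (n t : ℤ × ℤ) : refl l (n - t) = refl l n + t := by
  unfold refl; split <;> ext <;> simp <;> ring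

lemma refl_add (l : ℕ) (n t : ℤ × ℤ) : refl l (n + t) = refl l n - t := by
  unfold refl; split <;> ext <;> simp <;> ring

/-- Reflection as a permutation. -/
def reflEquiv (l : ℕ) : ℤ × ℤ ≃ ℤ × ℤ := ⟨refl l, refl l, refl_refl l, refl_refl l⟩

/-- Rotation as a permutation. -/
def rotEquiv : ℤ × ℤ ≃ ℤ × ℤ :=
  ⟨rot, fun n => rot (rot n), rot_rot_rot, rot_rot_rot⟩

lemma mode_injective : Function.Injective mode := by
  intro m n h
  have h' : ((m.1 - 2 * m.2 - (n.1 - 2 * n.2) : ℤ) : ℂ) +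
      ((2 * m.1 - m.2) - (2 * n.1 - n.2) : ℤ) * ω = 0 := by
    simp only [mode] at h; push_cast at h ⊢; linear_combination h
  obtain ⟨h1, h2⟩ := eq_zero_of_add_mul_omega h'
  ext <;> omega

lemma norm_mode_sq (n : ℤ × ℤ) : ‖mode n‖ ^ 2 = (((n.1 - 2 * n.2 - 1) ^ 2 -
    (n.1 - 2 * n.2 - 1) * (2 * n.1 - n.2) + (2 * n.1 - n.2) ^ 2 : ℤ) : ℝ) := by
  rw [← Complex.normSq_eq_norm_sq, mode, normSq_int_add_int_mul_omega]

lemma one_le_norm_mode (n : ℤ × ℤ) : 1 ≤ ‖mode n‖ := by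
  have h : (1 : ℝ) ≤ ‖mode n‖ ^ 2 := by
    rw [norm_mode_sq]
    have : 0 < (n.1 - 2 * n.2 - 1) ^ 2 -
      (n.1 - 2 * n.2 - 1) * (2 * n.1 - n.2) + (2 * n.1 - n.2) ^ 2 := by
      by_contra hc
      have h2 : (2 * n.1 - n.2) = 0 := by
        nlinarith [sq_nonneg (2 * (n.1 - 2 * n.2 - 1) - (2 * n.1 - n.2)), sq_nonneg (2 * n.1 - n.2)]
      have h1 : (n.1 - 2 * n.2 - 1) = 0 := by
        rw [h2] at hc
        nlinarith [sq_nonneg (n.1 - 2 * n.2 - 1)]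
      omega
    exact_mod_cast this
  nlinarith [norm_nonneg (mode n)]

lemma norm_mode_pos (n : ℤ × ℤ) : 0 < ‖mode n‖ := zero_lt_one.trans_le (one_le_norm_mode n)

lemma mode_ne_zero (n : ℤ × ℤ) : mode n ≠ 0 := norm_pos_iff.1 (norm_mode_pos n)

lemma norm_mode_refl_ge {l : ℕ} (hl : l < 3) (n : ℤ × ℤ) :
    ‖mode n‖ / 2 ≤ ‖mode (refl l n)‖ := by
  have h1 := one_le_norm_mode (refl l n)
  have h2 : mode n = ω ^ l - mode (refl l n) := by rw [mode_refl hl]; ring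
  have h3 : ‖mode n‖ ≤ 1 + ‖mode (refl l n)‖ := by
    calc ‖mode n‖ = ‖ω ^ l - mode (refl l n)‖ := by rw [← h2]
      _ ≤ ‖ω ^ l‖ + ‖mode (refl l n)‖ := norm_sub_le _ _
      _ = _ := by simp [norm_omega]
  linarith

lemma norm_mode_refl_le {l : ℕ} (hl : l < 3) (n : ℤ × ℤ) :
    ‖mode (refl l n)‖ ≤ ‖mode n‖ + 1 := by
  rw [mode_refl hl]
  calc _ ≤ ‖ω ^ l‖ + ‖mode n‖ := norm_sub_le _ _
    _ = _ := by simp [norm_omega, add_comm]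

lemma norm_mode_rot (n : ℤ × ℤ) : ‖mode (rot n)‖ = ‖mode n‖ := by
  rw [mode_rot, norm_mul, norm_omega, one_mul]

/-- Growth of the modes in the sup norm of the index. -/
lemma norm_mode_ge (n : ℤ × ℤ) (k : ℕ) (hk : (k : ℤ) ≤ |n.1| ∨ (k : ℤ) ≤ |n.2|) :
    3 / 2 * (k : ℝ) - 1 ≤ ‖mode n‖ := by
  have h3 : √3 * √3 = 3 := Real.mul_self_sqrt (by norm_num)
  have key : ∀ x y : ℤ, mode (x, y) + 1 = (1 + 2 * ω) * (x + y * ω) := by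
    intro x y
    have := omega_sq
    simp [mode]; linear_combination -(2 * (y : ℂ)) * this
  have hn : (9 / 4 : ℝ) * (k : ℝ) ^ 2 ≤ ‖mode n + 1‖ ^ 2 := by
    have e : mode n + 1 = (n.1 - 2 * n.2 : ℤ) + (2 * n.1 - n.2 : ℤ) * ω := by
      simp [mode]; ring
    rw [e, ← Complex.normSq_eq_norm_sq, normSq_int_add_int_mul_omega]
    have : 9 * (k : ℤ) ^ 2 ≤ 4 * ((n.1 - 2 * n.2) ^ 2 -
      (n.1 - 2 * n.2) * (2 * n.1 - n.2) + (2 * n.1 - n.2) ^ 2) := by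
      have hk0 : (0 : ℤ) ≤ k := by positivity
      rcases hk with hk | hk
      · have : (k : ℤ) ^ 2 ≤ n.1 ^ 2 := sq_le_sq.2 (by rwa [abs_of_nonneg hk0])
        nlinarith [sq_nonneg (n.1 - 2 * n.2)]
      · have : (k : ℤ) ^ 2 ≤ n.2 ^ 2 := sq_le_sq.2 (by rwa [abs_of_nonneg hk0])
        nlinarith [sq_nonneg (n.2 - 2 * n.1)]
    have h' : (9 * (k : ℝ) ^ 2) ≤ 4 * (((n.1 - 2 * n.2) ^ 2 -
      (n.1 - 2 * n.2) * (2 * n.1 - n.2) + (2 * n.1 - n.2) ^ 2 : ℤ) : ℝ) := by exact_mod_cast this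
    linarith
  have h4 : 3 / 2 * (k : ℝ) ≤ ‖mode n + 1‖ := by
    nlinarith [norm_nonneg (mode n + 1), (by positivity : (0 : ℝ) ≤ k)]
  have h5 : ‖mode n + 1‖ ≤ ‖mode n‖ + 1 := (norm_add_le _ _).trans (by simp)
  linarith

lemma norm_index_le (n : ℤ × ℤ) : ‖n‖ ≤ 4 / 3 * ‖mode n‖ := by
  have h1 := one_le_norm_mode n
  obtain ⟨k, hk, hk'⟩ : ∃ k : ℕ, ‖n‖ = k ∧ ((k : ℤ) ≤ |n.1| ∨ (k : ℤ) ≤ |n.2|) := by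
    rcases le_total |n.1| |n.2| with h | h
    · refine ⟨n.2.natAbs, ?_, Or.inr (by simp)⟩
      have h' : |(n.1 : ℝ)| ≤ |(n.2 : ℝ)| := by exact_mod_cast h
      rw [Prod.norm_def, Int.norm_eq_abs, Int.norm_eq_abs, max_eq_right h', Nat.cast_natAbs]
      simp
    · refine ⟨n.1.natAbs, ?_, Or.inl (by simp)⟩
      have h' : |(n.2 : ℝ)| ≤ |(n.1 : ℝ)| := by exact_mod_cast h
      rw [Prod.norm_def, Int.norm_eq_abs, Int.norm_eq_abs, max_eq_left h', Nat.cast_natAbs]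
      simp
  have := norm_mode_ge n k hk'
  rcases Nat.lt_or_ge k 2 with h2 | h2
  · have : (k : ℝ) ≤ 1 := by exact_mod_cast Nat.le_of_lt_succ h2
    linarith
  · have : (2 : ℝ) ≤ k := by exact_mod_cast h2
    linarith

lemma summable_norm_mode_inv_pow {k : ℕ} (hk : 3 ≤ k) :
    Summable fun n : ℤ × ℤ => (‖mode n‖ ^ k)⁻¹ := by
  have h := EisensteinSeries.summable_one_div_norm_rpow (k := 3) (by norm_num)
  have h' : Summable fun n : ℤ × ℤ => ‖n‖ ^ (-(3 : ℝ)) := by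
    have e := (finTwoArrowEquiv ℤ).symm.summable_iff.2 h
    refine e.congr fun n => ?_
    simp [Function.comp, finTwoArrowEquiv, Prod.norm_def, EisensteinSeries.norm_eq_max_natAbs,
      Int.norm_eq_abs]
  have h2 : Summable fun n : ℤ × ℤ => (64 / 27 : ℝ) * ‖n‖ ^ (-(3 : ℝ)) := h'.mul_left _
  refine h2.of_norm_bounded_eventually ?_
  rw [Filter.eventually_cofinite]
  refine (Set.finite_singleton (0 : ℤ × ℤ)).subset fun n hn => ?_
  by_contra hne
  apply hn
  have hn0 : 0 < ‖n‖ := norm_pos_iff.2 hne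
  have h1 := one_le_norm_mode n
  have h3 := norm_index_le n
  rw [norm_inv, norm_pow, norm_norm, Real.rpow_neg hn0.le]
  have : (‖n‖ : ℝ) ^ (3 : ℝ) = ‖n‖ ^ 3 := by exact_mod_cast Real.rpow_natCast ‖n‖ 3
  rw [this]
  calc (‖mode n‖ ^ k)⁻¹ ≤ (‖mode n‖ ^ 3)⁻¹ := by gcongr
    _ ≤ ((3 / 4 * ‖n‖) ^ 3)⁻¹ := by gcongr; linarith
    _ = _ := by rw [mul_pow, mul_inv]; norm_num

/-! ### Schur triangularization -/

open Module in
/-- A numerical form of Schur triangularization: an orthonormal basis whose diagonal entries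
are eigenvalues and compute all the traces of powers. -/
theorem exists_schur_basis (m : ℕ) : ∀ (E : Type) [NormedAddCommGroup E] [InnerProductSpace ℂ E]
    [FiniteDimensional ℂ E] (T : E →ₗ[ℂ] E), finrank ℂ E = m →
    ∃ b : OrthonormalBasis (Fin m) ℂ E,
      (∀ i, Module.End.HasEigenvalue T (inner ℂ (b i) (T (b i)))) ∧
      ∀ k : ℕ, LinearMap.trace ℂ E (T ^ k) = ∑ i, (inner ℂ (b i) (T (b i))) ^ k := by
  induction m with
  | zero =>
    intro E _ _ _ T hE
    let b : OrthonormalBasis (Fin 0) ℂ E := (stdOrthonormalBasis ℂ E).reindex (finCongr hE)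
    refine ⟨b, fun i => i.elim0, fun k => ?_⟩
    rw [LinearMap.trace_eq_sum_inner (T ^ k) b]
    simp
  | succ m ih =>
    intro E _ _ _ T hE
    have : Nontrivial E := Module.nontrivial_of_finrank_pos (R := ℂ) (by omega)
    obtain ⟨μ, hμ⟩ := Module.End.exists_eigenvalue (LinearMap.adjoint T)
    obtain ⟨v₀, hv₀⟩ := hμ.exists_hasEigenvector
    obtain ⟨v, hv, hv1⟩ : ∃ v, LinearMap.adjoint T v = μ • v ∧ ‖v‖ = 1 := by
      have hne : ‖v₀‖ ≠ 0 := norm_ne_zero_iff.2 hv₀.2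
      refine ⟨((‖v₀‖ : ℂ)⁻¹) • v₀, ?_, ?_⟩
      · rw [map_smul, hv₀.apply_eq_smul, smul_comm]
      · rw [norm_smul, norm_inv, Complex.norm_real, norm_norm, inv_mul_cancel₀ hne]
    have hvT : ∀ w, inner ℂ v (T w) = (starRingEnd ℂ) μ * inner ℂ v w := fun w => by
      rw [← LinearMap.adjoint_inner_left, hv, inner_smul_left]
    have hvv : inner ℂ v v = (1 : ℂ) := by rw [inner_self_eq_norm_sq_to_K, hv1]; simp
    have hvTk : ∀ k : ℕ, ∀ w, inner ℂ v ((T ^ k) w) = ((starRingEnd ℂ) μ) ^ k * inner ℂ v w := by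
      intro k
      induction k with
      | zero => simp
      | succ k ihk => intro w; rw [pow_succ', Module.End.mul_apply, hvT, ihk]; ring
    let W : Submodule ℂ E := (ℂ ∙ v)ᗮ
    have memW : ∀ w, w ∈ W ↔ inner ℂ v w = (0 : ℂ) := fun w =>
      Submodule.mem_orthogonal_singleton_iff_inner_right
    have hW : ∀ w ∈ W, T w ∈ W := by
      intro w hw
      rw [memW] at hw ⊢
      rw [hvT, hw, mul_zero]
    have hv0 : v ≠ 0 := by rintro rfl; simp at hv1
    have hfr : finrank ℂ W = m := by
      have : Fact (finrank ℂ E = m + 1) := ⟨hE⟩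
      exact Submodule.finrank_orthogonal_span_singleton hv0
    obtain ⟨c, hc1, hc2⟩ := ih W (T.restrict hW) hfr
    let f : Fin (m + 1) → E := Fin.cons v fun i => (c i : E)
    have hf : Orthonormal ℂ f := by
      rw [orthonormal_iff_ite]
      have hcc := orthonormal_iff_ite.1 c.orthonormal
      intro i j
      refine Fin.cases ?_ (fun i => ?_) i <;> refine Fin.cases ?_ (fun j => ?_) j
      · simp [f, hv1]
      · have : inner ℂ v (c j : E) = (0 : ℂ) := (memW _).1 (c j).2
        simp [f, this, (Fin.succ_ne_zero j).symm]
      · have : inner ℂ (c i : E) v = (0 : ℂ) := by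
          rw [← inner_conj_symm, (memW _).1 (c i).2, map_zero]
        simp [f, this, Fin.succ_ne_zero i]
      · have := hcc i j
        rw [Submodule.coe_inner] at this
        simp [f, this]
    obtain ⟨b, hb⟩ := Orthonormal.exists_orthonormalBasis_extension_of_card_eq (𝕜 := ℂ) (E := E)
      (ι := Fin (m + 1)) (by simpa using hE) (v := f) (s := Set.univ)
      (hf.comp _ Subtype.val_injective)
    have hb' : ∀ i, b i = f i := fun i => hb i trivial
    have b0 : b 0 = v := by rw [hb']; rfl
    have bs : ∀ i : Fin m, b i.succ = (c i : E) := fun i => by rw [hb']; simp [f]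
    have d0 : inner ℂ (b 0) (T (b 0)) = (starRingEnd ℂ) μ := by rw [b0, hvT, hvv, mul_one]
    have ds : ∀ i : Fin m, inner ℂ (b i.succ) (T (b i.succ)) =
        inner ℂ (c i) (T.restrict hW (c i)) := fun i => by
      rw [bs, Submodule.coe_inner]; rfl
    refine ⟨b, fun i => ?_, fun k => ?_⟩
    · refine Fin.cases ?_ (fun i => ?_) i
      · rw [d0, Module.End.hasEigenvalue_iff]
        intro hbot
        have hinj : Function.Injective (T - ((starRingEnd ℂ) μ) • (1 : Module.End ℂ E)) := by
          rw [← LinearMap.ker_eq_bot, ← Module.End.eigenspace_def]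
          exact hbot
        obtain ⟨w, hw⟩ := LinearMap.surjective_of_injective hinj v
        have : inner ℂ v v = (0 : ℂ) := by
          nth_rewrite 2 [← hw]
          rw [LinearMap.sub_apply, inner_sub_right, hvT, LinearMap.smul_apply,
            Module.End.one_apply, inner_smul_right, sub_self]
        rw [hvv] at this
        exact one_ne_zero this
      · rw [ds]
        obtain ⟨w, hw⟩ := (hc1 i).exists_hasEigenvector
        refine Module.End.hasEigenvalue_of_hasEigenvector (x := (w : E)) ?_
        rw [Module.End.hasEigenvector_iff, Module.End.mem_eigenspace_iff]
        refine ⟨?_, fun h => hw.2 (Subtype.ext h)⟩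
        have := congrArg Subtype.val hw.apply_eq_smul
        simpa using this
    · rw [LinearMap.trace_eq_sum_inner (T ^ k) b, Fin.sum_univ_succ, Fin.sum_univ_succ, d0,
        b0, hvTk, hvv, mul_one]
      simp_rw [ds]
      rw [← hc2 k, LinearMap.trace_eq_sum_inner _ c]
      congr 1
      refine Finset.sum_congr rfl fun i _ => ?_
      rw [bs, Submodule.coe_inner]
      congr 1
      rw [Module.End.pow_restrict]
      rfl

/-! ### The Birman–Schwinger operator in momentum space -/

/-- The Birman–Schwinger operator reduced to the first component. -/
def Bop : Module.End ℂ (ℤ × ℤ → ℂ) where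
  toFun a n := (mode n)⁻¹ * ∑ l ∈ Finset.range 3, ω ^ l * a (refl l n)
  map_add' a b := by ext n; simp [mul_add, Finset.sum_add_distrib]
  map_smul' c a := by
    ext n; simp only [Pi.smul_apply, smul_eq_mul, RingHom.id_apply, Finset.mul_sum]
    exact Finset.sum_congr rfl fun l _ => by ring

/-- Composition with the rotation. -/
def rotOp : Module.End ℂ (ℤ × ℤ → ℂ) := LinearMap.funLeft ℂ ℂ rot

/-- The projection onto the sequences with `a ∘ rot = ω ^ (-j) a`. -/
def Pop (j : ℕ) : Module.End ℂ (ℤ × ℤ → ℂ) :=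
  (3⁻¹ : ℂ) • ∑ s ∈ Finset.range 3, (ω ^ j) ^ s • rotOp ^ s

/-- The Birman–Schwinger operator on a rotational representation. -/
def Qop (j : ℕ) : Module.End ℂ (ℤ × ℤ → ℂ) := Bop * Pop j

lemma Bop_apply (a : ℤ × ℤ → ℂ) (n : ℤ × ℤ) :
    Bop a n = (mode n)⁻¹ * ∑ l ∈ Finset.range 3, ω ^ l * a (refl l n) := rfl

lemma rotOp_apply (a : ℤ × ℤ → ℂ) (n : ℤ × ℤ) : rotOp a n = a (rot n) := rfl

lemma rotOp_pow_apply (s : ℕ) (a : ℤ × ℤ → ℂ) (n : ℤ × ℤ) :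
    (rotOp ^ s) a n = a (rot^[s] n) := by
  induction s generalizing a with
  | zero => rfl
  | succ s ih => rw [pow_succ, Module.End.mul_apply, ih, rotOp_apply, Function.iterate_succ_apply']

lemma rotOp_pow_three : rotOp ^ 3 = 1 := by
  ext1 a; ext n
  rw [rotOp_pow_apply]
  simp [rot_rot_rot]

lemma Pop_apply (j : ℕ) (a : ℤ × ℤ → ℂ) (n : ℤ × ℤ) :
    Pop j a n = 3⁻¹ * ∑ s ∈ Finset.range 3, (ω ^ j) ^ s * a (rot^[s] n) := by
  simp [Pop, rotOp_pow_apply, Finset.sum_apply]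

lemma commute_Bop_rotOp : Commute Bop rotOp := by
  refine LinearMap.ext fun a => funext fun n => ?_
  have h3 := omega_pow_three
  have h0 := omega_ne_zero
  have hm := mode_ne_zero n
  simp only [Module.End.mul_apply, Bop_apply, rotOp_apply, Finset.sum_range_succ,
    Finset.sum_range_zero, rot_refl_zero, rot_refl_one, rot_refl_two, mode_rot]
  field_simp
  linear_combination (a (refl 0 (rot n))) * h3

lemma commute_Bop_Pop (j : ℕ) : Commute Bop (Pop j) := by
  unfold Pop
  refine Commute.smul_right (Commute.sum_right _ _ _ fun s _ => ?_) _
  exact Commute.smul_right (commute_Bop_rotOp.pow_right s) _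

lemma rotOp_mul_Pop (j : ℕ) : ω ^ j • (rotOp * Pop j) = Pop j := by
  have h3 : (ω ^ j) ^ 3 = 1 := by rw [← pow_mul, mul_comm, pow_mul, omega_pow_three, one_pow]
  have e : rotOp * rotOp ^ 2 = 1 := by rw [← pow_succ', rotOp_pow_three]
  simp only [Pop, Finset.sum_range_succ, Finset.sum_range_zero, mul_smul_comm, mul_add, e,
    smul_add, smul_smul, pow_zero, mul_one, pow_one, zero_add]
  rw [← sq]
  have : ω ^ j * (3⁻¹ * (ω ^ j) ^ 2) = 3⁻¹ * 1 := by rw [← h3]; ring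
  rw [this, show ω ^ j * 3⁻¹ = 3⁻¹ * ω ^ j by ring,
    show ω ^ j * (3⁻¹ * ω ^ j) = 3⁻¹ * (ω ^ j) ^ 2 by ring]
  simp only [mul_one]
  abel

lemma Pop_mul_Pop (j : ℕ) : Pop j * Pop j = Pop j := by
  have h1 := rotOp_mul_Pop j
  have h2 : ∀ s : ℕ, (ω ^ j) ^ s • (rotOp ^ s * Pop j) = Pop j := by
    intro s
    induction s with
    | zero => simp
    | succ s ih =>
      rw [pow_succ' rotOp, mul_assoc, pow_succ', mul_smul, ← mul_smul_comm, ih, h1]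
  conv_lhs => enter [1]; rw [Pop]
  rw [smul_mul_assoc, Finset.sum_mul]
  simp_rw [smul_mul_assoc, h2]
  rw [Finset.sum_const, Finset.card_range, ← Nat.cast_smul_eq_nsmul ℂ, smul_smul]
  norm_num

lemma Qop_pow (j k : ℕ) : Qop j ^ (k + 1) = Bop ^ (k + 1) * Pop j := by
  rw [Qop, (commute_Bop_Pop j).mul_pow]
  congr 1
  exact IsIdempotentElem.pow_succ_eq k (Pop_mul_Pop j)

lemma norm_omega_pow (s : ℕ) : ‖ω ^ s‖ = 1 := by rw [norm_pow, norm_omega, one_pow]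

lemma norm_mode_iterate_rot (s : ℕ) (n : ℤ × ℤ) : ‖mode (rot^[s] n)‖ = ‖mode n‖ := by
  induction s with
  | zero => rfl
  | succ s ih => rw [Function.iterate_succ_apply', norm_mode_rot, ih]

lemma norm_Pop_le {j k : ℕ} {a : ℤ × ℤ → ℂ} {C : ℝ} (h : ∀ n, ‖a n‖ ≤ C / ‖mode n‖ ^ k)
    (n : ℤ × ℤ) : ‖Pop j a n‖ ≤ C / ‖mode n‖ ^ k := by
  rw [Pop_apply, norm_mul, norm_inv, Complex.norm_ofNat]
  have : ‖∑ s ∈ Finset.range 3, (ω ^ j) ^ s * a (rot^[s] n)‖ ≤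
      ∑ s ∈ Finset.range 3, C / ‖mode n‖ ^ k := by
    refine norm_sum_le_of_le _ fun s _ => ?_
    rw [norm_mul, ← pow_mul, norm_omega_pow, one_mul, ← norm_mode_iterate_rot s]
    exact h _
  rw [Finset.sum_const, Finset.card_range, nsmul_eq_mul] at this
  push_cast at this
  linarith

lemma norm_Bop_le {k : ℕ} {a : ℤ × ℤ → ℂ} {C : ℝ} (hC : 0 ≤ C)
    (h : ∀ n, ‖a n‖ ≤ C / ‖mode n‖ ^ k) (n : ℤ × ℤ) :
    ‖Bop a n‖ ≤ 3 * 2 ^ k * C / ‖mode n‖ ^ (k + 1) := by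
  have hm := norm_mode_pos n
  rw [Bop_apply, norm_mul, norm_inv]
  have : ‖∑ l ∈ Finset.range 3, ω ^ l * a (refl l n)‖ ≤
      ∑ l ∈ Finset.range 3, C / (‖mode n‖ / 2) ^ k := by
    refine norm_sum_le_of_le _ fun l hl => ?_
    rw [norm_mul, norm_omega_pow, one_mul]
    refine (h _).trans ?_
    gcongr
    exact norm_mode_refl_ge (Finset.mem_range.1 hl) n
  rw [Finset.sum_const, Finset.card_range, nsmul_eq_mul] at this
  calc _ ≤ ‖mode n‖⁻¹ * ((3 : ℕ) * (C / (‖mode n‖ / 2) ^ k)) := by gcongr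
    _ = _ := by rw [div_pow]; field_simp; push_cast; ring

lemma norm_Qop_le {j k : ℕ} {a : ℤ × ℤ → ℂ} {C : ℝ} (hC : 0 ≤ C)
    (h : ∀ n, ‖a n‖ ≤ C / ‖mode n‖ ^ k) (n : ℤ × ℤ) :
    ‖Qop j a n‖ ≤ 3 * 2 ^ k * C / ‖mode n‖ ^ (k + 1) :=
  norm_Bop_le hC (norm_Pop_le h) n

/-! ### Truncations -/

/-- Multiplication by the indicator function of a finite set of modes. -/
def cut (F : Finset (ℤ × ℤ)) : Module.End ℂ (ℤ × ℤ → ℂ) where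
  toFun a n := if n ∈ F then a n else 0
  map_add' a b := by ext n; by_cases h : n ∈ F <;> simp [h]
  map_smul' c a := by ext n; by_cases h : n ∈ F <;> simp [h]

lemma cut_apply (F : Finset (ℤ × ℤ)) (a : ℤ × ℤ → ℂ) (n : ℤ × ℤ) :
    cut F a n = if n ∈ F then a n else 0 := rfl

/-- Extension by zero. -/
def extendZero (F : Finset (ℤ × ℤ)) : EuclideanSpace ℂ F →ₗ[ℂ] (ℤ × ℤ → ℂ) where
  toFun a n := if h : n ∈ F then a ⟨n, h⟩ else 0
  map_add' a b := by ext n; by_cases h : n ∈ F <;> simp [h]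
  map_smul' c a := by ext n; by_cases h : n ∈ F <;> simp [h]

lemma extendZero_apply (F : Finset (ℤ × ℤ)) (a : EuclideanSpace ℂ F) (n : ℤ × ℤ) :
    extendZero F a n = if h : n ∈ F then a ⟨n, h⟩ else 0 := rfl

/-- Restriction to a finite set of modes. -/
def restrictTo (F : Finset (ℤ × ℤ)) : (ℤ × ℤ → ℂ) →ₗ[ℂ] EuclideanSpace ℂ F where
  toFun a := WithLp.toLp 2 fun n => a n
  map_add' _ _ := rfl
  map_smul' _ _ := rfl

/-- The compression of `Qop j` to a finite set of modes. -/
def Qtrunc (j : ℕ) (F : Finset (ℤ × ℤ)) : Module.End ℂ (EuclideanSpace ℂ F) :=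
  restrictTo F ∘ₗ Qop j ∘ₗ extendZero F

lemma extendZero_restrictTo (F : Finset (ℤ × ℤ)) (a : ℤ × ℤ → ℂ) :
    extendZero F (restrictTo F a) = cut F a := by
  ext n
  rw [extendZero_apply, cut_apply]
  split <;> rfl

lemma extendZero_Qtrunc (j : ℕ) (F : Finset (ℤ × ℤ)) (v : EuclideanSpace ℂ F) :
    extendZero F (Qtrunc j F v) = cut F (Qop j (extendZero F v)) :=
  extendZero_restrictTo F _

lemma extendZero_Qtrunc_pow (j : ℕ) (F : Finset (ℤ × ℤ)) (k : ℕ) (v : EuclideanSpace ℂ F) :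
    extendZero F ((Qtrunc j F ^ k) v) = ((cut F * Qop j) ^ k) (extendZero F v) := by
  induction k with
  | zero => rfl
  | succ k ih =>
    rw [pow_succ', Module.End.mul_apply, extendZero_Qtrunc, ih, pow_succ' (cut F * Qop j)]
    rfl

lemma extendZero_single (F : Finset (ℤ × ℤ)) (x : F) :
    extendZero F (EuclideanSpace.single x 1) = Pi.single (x : ℤ × ℤ) 1 := by
  ext n
  rw [extendZero_apply]
  by_cases hn : n = x
  · subst hn; simp
  · rw [Pi.single_eq_of_ne hn]
    split
    · next h =>
      rw [PiLp.single_apply, if_neg]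
      rintro rfl
      exact hn rfl
    · rfl

lemma trace_Qtrunc_pow (j : ℕ) (F : Finset (ℤ × ℤ)) (k : ℕ) :
    LinearMap.trace ℂ _ (Qtrunc j F ^ k) =
      ∑' x, if x ∈ F then ((cut F * Qop j) ^ k) (Pi.single x 1) x else 0 := by
  rw [LinearMap.trace_eq_sum_inner _ (EuclideanSpace.basisFun F ℂ),
    tsum_eq_sum (s := F) (fun x hx => if_neg hx), ← Finset.sum_coe_sort F]
  refine Finset.sum_congr rfl fun x _ => ?_
  rw [if_pos x.2, ← extendZero_single, ← extendZero_Qtrunc_pow, extendZero_apply, dif_pos x.2]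
  simp [EuclideanSpace.inner_single_left]

/-- The square boxes exhausting the set of modes. -/
def boxSet (N : ℕ) : Finset (ℤ × ℤ) := Finset.Icc (-(N : ℤ), -(N : ℤ)) ((N : ℤ), (N : ℤ))

lemma mem_boxSet {N : ℕ} {x : ℤ × ℤ} : x ∈ boxSet N ↔ |x.1| ≤ N ∧ |x.2| ≤ N := by
  simp [boxSet, Finset.mem_Icc, Prod.le_def, abs_le]
  tauto

lemma eventually_mem_boxSet (x : ℤ × ℤ) : ∀ᶠ N in Filter.atTop, x ∈ boxSet N := by
  filter_upwards [Filter.eventually_ge_atTop (x.1.natAbs + x.2.natAbs)] with N hN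
  rw [mem_boxSet, Int.abs_eq_natAbs, Int.abs_eq_natAbs]
  omega

lemma Qop_apply (j : ℕ) (a : ℤ × ℤ → ℂ) (n : ℤ × ℤ) :
    Qop j a n = (mode n)⁻¹ * ∑ l ∈ Finset.range 3, ω ^ l *
      (3⁻¹ * ∑ s ∈ Finset.range 3, (ω ^ j) ^ s * a (rot^[s] (refl l n))) := by
  simp_rw [← Pop_apply, ← Bop_apply]
  rfl

lemma eventually_cut_Qop_pow (j k : ℕ) (a : ℤ × ℤ → ℂ) (n : ℤ × ℤ) :
    ∀ᶠ N in Filter.atTop, ((cut (boxSet N) * Qop j) ^ k) a n = (Qop j ^ k) a n := by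
  induction k generalizing n with
  | zero => simp
  | succ k ih =>
    have h : ∀ᶠ N in Filter.atTop, ∀ l ∈ Finset.range 3, ∀ s ∈ Finset.range 3,
        ((cut (boxSet N) * Qop j) ^ k) a (rot^[s] (refl l n)) =
          (Qop j ^ k) a (rot^[s] (refl l n)) := by
      rw [Finset.eventually_all]
      intro l _
      rw [Finset.eventually_all]
      intro s _
      exact ih _
    filter_upwards [h, eventually_mem_boxSet n] with N hN hn
    have e1 : ((cut (boxSet N) * Qop j) ^ (k + 1)) a n =
        Qop j (((cut (boxSet N) * Qop j) ^ k) a) n := by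
      rw [pow_succ', Module.End.mul_apply, Module.End.mul_apply, cut_apply, if_pos hn]
    have e2 : (Qop j ^ (k + 1)) a n = Qop j ((Qop j ^ k) a) n := by
      rw [pow_succ', Module.End.mul_apply]
    rw [e1, e2, Qop_apply, Qop_apply]
    refine congrArg _ (Finset.sum_congr rfl fun l hl => ?_)
    rw [Finset.sum_congr rfl fun s hs => by rw [hN l hl s hs]]

lemma norm_cut_le (F : Finset (ℤ × ℤ)) (a : ℤ × ℤ → ℂ) (n : ℤ × ℤ) : ‖cut F a n‖ ≤ ‖a n‖ := by
  rw [cut_apply]; split <;> simp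

lemma exists_norm_cut_Qop_pow_le (j k : ℕ) : ∃ C : ℝ, 0 ≤ C ∧ ∀ (F : Finset (ℤ × ℤ))
    (a : ℤ × ℤ → ℂ), (∀ n, ‖a n‖ ≤ 1) → ∀ n,
    ‖((cut F * Qop j) ^ k) a n‖ ≤ C / ‖mode n‖ ^ k := by
  induction k with
  | zero => exact ⟨1, zero_le_one, fun F a ha n => by simpa using ha n⟩
  | succ k ih =>
    obtain ⟨C, hC, h⟩ := ih
    refine ⟨3 * 2 ^ k * C, by positivity, fun F a ha n => ?_⟩
    rw [pow_succ', Module.End.mul_apply, Module.End.mul_apply]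
    exact (norm_cut_le _ _ _).trans (norm_Qop_le hC (h F a ha) n)

lemma norm_single_le_one (x n : ℤ × ℤ) : ‖(Pi.single x 1 : ℤ × ℤ → ℂ) n‖ ≤ 1 := by
  by_cases h : n = x
  · subst h; simp
  · simp [Pi.single_eq_of_ne h]

lemma tendsto_trace_Qtrunc (j : ℕ) {k : ℕ} (hk : 3 ≤ k) :
    Filter.Tendsto (fun N => LinearMap.trace ℂ _ (Qtrunc j (boxSet N) ^ k)) Filter.atTop
      (nhds (∑' x, (Qop j ^ k) (Pi.single x 1) x)) := by
  simp_rw [trace_Qtrunc_pow]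
  obtain ⟨C, hC, h⟩ := exists_norm_cut_Qop_pow_le j k
  refine tendsto_tsum_of_dominated_convergence (bound := fun x => C * (‖mode x‖ ^ k)⁻¹)
    ((summable_norm_mode_inv_pow hk).mul_left C) (fun x => ?_) (Filter.Eventually.of_forall
      fun N x => ?_)
  · refine tendsto_const_nhds.congr' ?_
    filter_upwards [eventually_cut_Qop_pow j k (Pi.single x 1) x, eventually_mem_boxSet x]
      with N h1 h2
    rw [if_pos h2, h1]
  · split
    · exact h _ _ (norm_single_le_one x) x
    · rw [norm_zero]
      positivity

/-! ### A Schatten-type bound for the diagonal entries -/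

/-- The constant `∑ ‖mode n‖⁻³`. -/
def modeZeta : ℝ := ∑' n : ℤ × ℤ, (‖mode n‖ ^ 3)⁻¹

lemma iterate_rot_injective (s : ℕ) : Function.Injective (rot^[s]) :=
  rotEquiv.injective.iterate s

lemma sum_norm_extendZero_comp_le (F : Finset (ℤ × ℤ)) (v : EuclideanSpace ℂ F)
    {σ : ℤ × ℤ → ℤ × ℤ} (hσ : Function.Injective σ) :
    ∑ n ∈ F, ‖extendZero F v (σ n)‖ ^ 2 ≤ ‖v‖ ^ 2 := by
  classical
  have hv : ‖v‖ ^ 2 = ∑ n ∈ F, ‖extendZero F v n‖ ^ 2 := by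
    rw [EuclideanSpace.norm_sq_eq, ← Finset.sum_coe_sort F]
    refine Finset.sum_congr rfl fun n _ => ?_
    rw [extendZero_apply, dif_pos n.2]
  rw [hv, ← Finset.sum_image (f := fun n => ‖extendZero F v n‖ ^ 2) hσ.injOn]
  have h0 : ∀ n ∉ F, ‖extendZero F v n‖ ^ 2 = 0 := fun n hn => by
    rw [extendZero_apply, dif_neg hn]; simp
  calc ∑ n ∈ F.image σ, ‖extendZero F v n‖ ^ 2
      = ∑ n ∈ F.image σ with n ∈ F, ‖extendZero F v n‖ ^ 2 := by
        refine (Finset.sum_filter_of_ne fun n _ hn => ?_).symm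
        by_contra h
        exact hn (h0 n h)
    _ ≤ _ := by
        refine Finset.sum_le_sum_of_subset_of_nonneg ?_ fun _ _ _ => by positivity
        intro n hn
        exact (Finset.mem_filter.1 hn).2

lemma norm_inner_Qtrunc_le (j : ℕ) (F : Finset (ℤ × ℤ)) (v : EuclideanSpace ℂ F)
    (hv : ‖v‖ = 1) : ‖inner ℂ v (Qtrunc j F v)‖ ≤
      3 * √(∑ n : F, ‖v n‖ ^ 2 * ((‖mode n‖)⁻¹) ^ 2) := by
  set A := √(∑ n : F, ‖v n‖ ^ 2 * ((‖mode n‖)⁻¹) ^ 2) with hA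
  have key : ∀ l s : ℕ, ∑ n : F, ‖v n‖ * (‖mode n‖)⁻¹ *
      ‖extendZero F v (rot^[s] (refl l n))‖ ≤ A := by
    intro l s
    refine (Real.sum_mul_le_sqrt_mul_sqrt _ _ _).trans ?_
    simp_rw [mul_pow]
    rw [← hA]
    refine mul_le_of_le_one_right (Real.sqrt_nonneg _) ?_
    apply Real.sqrt_le_one.2
    have := sum_norm_extendZero_comp_le F v
      ((iterate_rot_injective s).comp (reflEquiv l).injective)
    rw [hv, one_pow] at this
    rw [Finset.sum_coe_sort F (fun n => ‖extendZero F v (rot^[s] (refl l n))‖ ^ 2)]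
    exact this
  have e : inner ℂ v (Qtrunc j F v) = ∑ n : F, (starRingEnd ℂ) (v n) * Qop j (extendZero F v) n := by
    rw [PiLp.inner_apply]
    refine Finset.sum_congr rfl fun n _ => ?_
    rw [RCLike.inner_apply']
    rfl
  have b : ∀ n : F, ‖(starRingEnd ℂ) (v n) * Qop j (extendZero F v) n‖ ≤
      3⁻¹ * ∑ l ∈ Finset.range 3, ∑ s ∈ Finset.range 3, ‖v n‖ * (‖mode n‖)⁻¹ *
        ‖extendZero F v (rot^[s] (refl l n))‖ := by
    intro n
    rw [norm_mul, RCLike.norm_conj, Qop_apply, norm_mul, norm_inv]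
    simp_rw [← Finset.mul_sum]
    have : ‖∑ l ∈ Finset.range 3, ω ^ l * (3⁻¹ * ∑ s ∈ Finset.range 3,
        (ω ^ j) ^ s * extendZero F v (rot^[s] (refl l n)))‖ ≤
        ∑ l ∈ Finset.range 3, 3⁻¹ * ∑ s ∈ Finset.range 3,
          ‖extendZero F v (rot^[s] (refl l n))‖ := by
      refine norm_sum_le_of_le _ fun l _ => ?_
      rw [norm_mul, norm_omega_pow, one_mul, norm_mul, norm_inv, Complex.norm_ofNat]
      gcongr
      refine norm_sum_le_of_le _ fun s _ => ?_
      rw [norm_mul, ← pow_mul, norm_omega_pow, one_mul]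
    calc _ ≤ ‖v n‖ * ((‖mode n‖)⁻¹ * ∑ l ∈ Finset.range 3, 3⁻¹ * ∑ s ∈ Finset.range 3,
          ‖extendZero F v (rot^[s] (refl l n))‖) := by gcongr
      _ = _ := by rw [← Finset.mul_sum]; ring
  rw [e]
  calc _ ≤ ∑ n : F, 3⁻¹ * ∑ l ∈ Finset.range 3, ∑ s ∈ Finset.range 3, ‖v n‖ * (‖mode n‖)⁻¹ *
        ‖extendZero F v (rot^[s] (refl l n))‖ := norm_sum_le_of_le _ fun n _ => b n
    _ = 3⁻¹ * ∑ l ∈ Finset.range 3, ∑ s ∈ Finset.range 3, ∑ n : F, ‖v n‖ * (‖mode n‖)⁻¹ *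
        ‖extendZero F v (rot^[s] (refl l n))‖ := by
        rw [← Finset.mul_sum, Finset.sum_comm]
        congr 1
        exact Finset.sum_congr rfl fun l _ => Finset.sum_comm
    _ ≤ 3⁻¹ * ∑ l ∈ Finset.range 3, ∑ s ∈ Finset.range 3, A := by
        gcongr with l _ s _
        exact key l s
    _ = _ := by simp

lemma sqrt_pow_three_le {ι : Type*} [Fintype ι] (p x : ι → ℝ) (hp : ∀ i, 0 ≤ p i)
    (hx : ∀ i, 0 ≤ x i) (h1 : ∑ i, p i = 1) :
    √(∑ i, p i * x i ^ 2) ^ 3 ≤ ∑ i, p i * x i ^ 3 := by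
  set S := √(∑ i, p i * x i ^ 2) with hS
  have hS0 : 0 ≤ S := Real.sqrt_nonneg _
  have hS2 : ∑ i, p i * x i ^ 2 = S ^ 2 :=
    (Real.sq_sqrt (Finset.sum_nonneg fun i _ => mul_nonneg (hp i) (sq_nonneg _))).symm
  have h : 0 ≤ ∑ i, p i * ((x i - S) ^ 2 * (2 * x i + S)) :=
    Finset.sum_nonneg fun i _ => mul_nonneg (hp i) (mul_nonneg (sq_nonneg _) (by linarith [hx i]))
  have e : ∑ i, p i * ((x i - S) ^ 2 * (2 * x i + S)) =
      2 * ∑ i, p i * x i ^ 3 - 3 * S * ∑ i, p i * x i ^ 2 + S ^ 3 * ∑ i, p i := by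
    rw [Finset.mul_sum, Finset.mul_sum, Finset.mul_sum, ← Finset.sum_sub_distrib,
      ← Finset.sum_add_distrib]
    exact Finset.sum_congr rfl fun i _ => by ring
  rw [e, h1, hS2] at h
  linarith

lemma sum_norm_diag_pow_three_le (j : ℕ) (F : Finset (ℤ × ℤ)) {m : ℕ}
    (b : OrthonormalBasis (Fin m) ℂ (EuclideanSpace ℂ F)) :
    ∑ i, ‖inner ℂ (b i) (Qtrunc j F (b i))‖ ^ 3 ≤ 27 * modeZeta := by
  have h1 : ∀ i, ‖inner ℂ (b i) (Qtrunc j F (b i))‖ ^ 3 ≤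
      27 * ∑ n : F, ‖b i n‖ ^ 2 * ((‖mode n‖)⁻¹) ^ 3 := by
    intro i
    have hb : ‖b i‖ = 1 := b.orthonormal.1 i
    have h := norm_inner_Qtrunc_le j F (b i) hb
    have h' : ‖inner ℂ (b i) (Qtrunc j F (b i))‖ ^ 3 ≤ _ :=
      pow_le_pow_left₀ (norm_nonneg _) h 3
    refine h'.trans ?_
    rw [mul_pow]
    have hs : ∑ n : F, ‖b i n‖ ^ 2 = 1 := by rw [← EuclideanSpace.norm_sq_eq, hb, one_pow]
    have := sqrt_pow_three_le (fun n : F => ‖b i n‖ ^ 2) (fun n => (‖mode n‖)⁻¹)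
      (fun n => sq_nonneg _) (fun n => inv_nonneg.2 (norm_nonneg _)) hs
    norm_num at this ⊢
    exact this
  have h2 : ∀ n : F, ∑ i, ‖b i n‖ ^ 2 = 1 := by
    intro n
    have := b.sum_sq_norm_inner_left (EuclideanSpace.single n (1 : ℂ))
    simpa [EuclideanSpace.inner_single_left] using this
  calc _ ≤ ∑ i, 27 * ∑ n : F, ‖b i n‖ ^ 2 * ((‖mode n‖)⁻¹) ^ 3 := Finset.sum_le_sum fun i _ => h1 i
    _ = 27 * ∑ n : F, ((‖mode n‖)⁻¹) ^ 3 := by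
      rw [← Finset.mul_sum, Finset.sum_comm]
      congr 1
      refine Finset.sum_congr rfl fun n _ => ?_
      rw [← Finset.sum_mul, h2, one_mul]
    _ ≤ _ := by
      gcongr
      rw [Finset.sum_coe_sort F (fun n => ((‖mode n‖)⁻¹) ^ 3), modeZeta]
      simp_rw [inv_pow]
      exact (summable_norm_mode_inv_pow le_rfl).sum_le_tsum _ fun n _ => by positivity

lemma norm_pow_four_le {d : ℂ} {δ : ℝ} (h : |d.im| ≤ δ) :
    ‖d‖ ^ 4 ≤ (d ^ 4).re + 8 * δ * ‖d‖ ^ 3 := by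
  have h0 : ‖d‖ ^ 2 = d.re ^ 2 + d.im ^ 2 := by
    rw [← Complex.normSq_eq_norm_sq, Complex.normSq_apply]; ring
  have h4 : (d ^ 4).re = d.re ^ 4 - 6 * d.re ^ 2 * d.im ^ 2 + d.im ^ 4 := by
    simp [pow_succ]; ring
  have e : ‖d‖ ^ 4 = (d.re ^ 2 + d.im ^ 2) ^ 2 := by rw [← h0]; ring
  have him : |d.im| ≤ ‖d‖ := Complex.abs_im_le_norm d
  have hre : d.re ^ 2 ≤ ‖d‖ ^ 2 := by rw [h0]; nlinarith [sq_nonneg d.im]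
  have h2 : d.im ^ 2 ≤ δ * ‖d‖ := by
    rw [← sq_abs, sq]; exact mul_le_mul h him (abs_nonneg _) ((abs_nonneg _).trans h)
  have h5 : d.re ^ 2 * d.im ^ 2 ≤ ‖d‖ ^ 2 * (δ * ‖d‖) :=
    mul_le_mul hre h2 (sq_nonneg _) (sq_nonneg _)
  rw [e, h4]
  nlinarith

/-- Small imaginary parts of all the diagonal entries contradict the trace conditions. -/
lemma exists_im_gt {m : ℕ} (d : Fin m → ℂ) {δ Z θ : ℝ} (hδ : 0 ≤ δ)
    (h3 : ∑ i, ‖d i‖ ^ 3 ≤ Z)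
    (h4 : (∑ i, d i ^ 4).re + 8 * δ * Z < θ) (h5 : θ < 0 ∨ θ ^ 5 < ‖∑ i, d i ^ 5‖ ^ 4) :
    ∃ i, δ < |(d i).im| := by
  by_contra! hc
  set S := ∑ i, ‖d i‖ ^ 4 with hS
  have hS0 : 0 ≤ S := Finset.sum_nonneg fun i _ => by positivity
  have hSθ : S < θ := by
    refine lt_of_le_of_lt ?_ h4
    calc S ≤ ∑ i, ((d i ^ 4).re + 8 * δ * ‖d i‖ ^ 3) :=
          Finset.sum_le_sum fun i _ => norm_pow_four_le (hc i)
      _ = (∑ i, d i ^ 4).re + 8 * δ * ∑ i, ‖d i‖ ^ 3 := by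
          rw [Finset.sum_add_distrib, Finset.mul_sum, Complex.re_sum]
      _ ≤ _ := by gcongr
  rcases h5 with h5 | h5
  · linarith
  have hle : ‖∑ i, d i ^ 5‖ ^ 4 ≤ S ^ 5 := by
    set ρ := √(√S) with hρ
    have hρ4 : ρ ^ 4 = S := by
      rw [show ρ ^ 4 = (ρ ^ 2) ^ 2 by ring, Real.sq_sqrt (Real.sqrt_nonneg _), Real.sq_sqrt hS0]
    have hρ0 : 0 ≤ ρ := Real.sqrt_nonneg _
    have hd : ∀ i, ‖d i‖ ≤ ρ := by
      intro i
      refine le_of_pow_le_pow_left₀ (n := 4) (by norm_num) hρ0 ?_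
      rw [hρ4]
      exact Finset.single_le_sum (f := fun i => ‖d i‖ ^ 4) (fun i _ => by positivity)
        (Finset.mem_univ i)
    have : ‖∑ i, d i ^ 5‖ ≤ ρ * S := by
      rw [hS, Finset.mul_sum]
      refine norm_sum_le_of_le _ fun i _ => ?_
      rw [norm_pow, pow_succ']
      gcongr
      exact hd i
    calc _ ≤ (ρ * S) ^ 4 := by gcongr
      _ = _ := by rw [mul_pow, hρ4]; ring
  have : S ^ 5 ≤ θ ^ 5 := by gcongr
  linarith

/-- Eigenvectors of the truncations, normalized in the sup norm. -/
lemma exists_truncated_eigenvector (j : ℕ) {t₄ t₅ : ℂ} {θ : ℝ}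
    (h4 : ∑' x, (Qop j ^ 4) (Pi.single x 1) x = t₄)
    (h5 : ∑' x, (Qop j ^ 5) (Pi.single x 1) x = t₅)
    (hθ : t₄.re < θ) (hθ5 : θ < 0 ∨ θ ^ 5 < ‖t₅‖ ^ 4) :
    ∃ δ > 0, ∀ᶠ N in Filter.atTop, ∃ (d : ℂ) (a : ℤ × ℤ → ℂ), δ < |d.im| ∧ (∀ n, ‖a n‖ ≤ 1) ∧
      (∃ n, ‖a n‖ = 1 ∧ n ∈ boxSet N) ∧ ∀ n ∈ boxSet N, d * a n = Qop j a n := by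
  have hZ : 0 ≤ modeZeta := tsum_nonneg fun n => by positivity
  set δ := (θ - t₄.re) / (2 * (8 * (27 * modeZeta) + 1)) with hδ
  have hδ0 : 0 < δ := div_pos (by linarith) (by positivity)
  have hδZ : 8 * δ * (27 * modeZeta) ≤ (θ - t₄.re) / 2 := by
    rw [hδ]
    have : (θ - t₄.re) / (2 * (8 * (27 * modeZeta) + 1)) * (2 * (8 * (27 * modeZeta) + 1)) =
      θ - t₄.re := div_mul_cancel₀ _ (by positivity)
    rw [← hδ] at this ⊢
    nlinarith
  refine ⟨δ, hδ0, ?_⟩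
  have T4 := tendsto_trace_Qtrunc j (k := 4) (by norm_num)
  have T5 := tendsto_trace_Qtrunc j (k := 5) (by norm_num)
  rw [h4] at T4
  rw [h5] at T5
  have E4 : ∀ᶠ N in Filter.atTop,
      (LinearMap.trace ℂ _ (Qtrunc j (boxSet N) ^ 4)).re < (t₄.re + θ) / 2 :=
    ((Complex.continuous_re.tendsto _).comp T4).eventually_lt_const (by linarith)
  have E5 : ∀ᶠ N in Filter.atTop,
      θ < 0 ∨ θ ^ 5 < ‖LinearMap.trace ℂ _ (Qtrunc j (boxSet N) ^ 5)‖ ^ 4 := by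
    rcases hθ5 with h | h
    · exact Filter.Eventually.of_forall fun _ => Or.inl h
    · filter_upwards [(T5.norm.pow 4).eventually_const_lt h] with N hN using Or.inr hN
  filter_upwards [E4, E5] with N h4N h5N
  obtain ⟨b, hb1, hb2⟩ := exists_schur_basis _ _ (Qtrunc j (boxSet N)) rfl
  rw [hb2] at h4N h5N
  obtain ⟨i, hi⟩ := exists_im_gt _ hδ0.le (sum_norm_diag_pow_three_le j _ b)
    (by linarith) h5N
  obtain ⟨v, hv⟩ := (hb1 i).exists_hasEigenvector
  set d := inner ℂ (b i) (Qtrunc j (boxSet N) (b i)) with hd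
  obtain ⟨n₁, hn₁⟩ : ∃ n : boxSet N, v n ≠ 0 := by
    by_contra! h
    exact hv.2 (by ext n; simpa using h n)
  obtain ⟨n₀, hn₀, hmax⟩ := Finset.exists_max_image (boxSet N)
    (fun n => ‖extendZero (boxSet N) v n‖) ⟨n₁, n₁.2⟩
  set M := ‖extendZero (boxSet N) v n₀‖ with hM
  have hMpos : 0 < M := by
    have := hmax n₁ n₁.2
    refine lt_of_lt_of_le ?_ this
    rw [extendZero_apply, dif_pos n₁.2]
    exact norm_pos_iff.2 hn₁
  have hle : ∀ n, ‖extendZero (boxSet N) v n‖ ≤ M := by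
    intro n
    by_cases h : n ∈ boxSet N
    · exact hmax n h
    · rw [extendZero_apply, dif_neg h, norm_zero]; exact hMpos.le
  refine ⟨d, (M : ℂ)⁻¹ • extendZero (boxSet N) v, hi, fun n => ?_, ⟨n₀, ?_, hn₀⟩, fun n hn => ?_⟩
  · rw [Pi.smul_apply, norm_smul, norm_inv, Complex.norm_real, Real.norm_of_nonneg hMpos.le,
      inv_mul_le_iff₀ hMpos, mul_one]
    exact hle n
  · rw [Pi.smul_apply, norm_smul, norm_inv, Complex.norm_real, Real.norm_of_nonneg hMpos.le, ← hM,
      inv_mul_cancel₀ hMpos.ne']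
  · have := congrFun (extendZero_Qtrunc j (boxSet N) v) n
    rw [hv.apply_eq_smul, map_smul, cut_apply, if_pos hn] at this
    rw [map_smul, Pi.smul_apply, Pi.smul_apply, ← this, Pi.smul_apply, smul_eq_mul, smul_eq_mul,
      smul_eq_mul]
    ring

/-- Existence of a non-real eigenvalue of the Birman–Schwinger operator in the `j`-th rotational
representation, from the traces of its fourth and fifth powers. -/
theorem exists_nonreal_eigenvalue (j : ℕ) {t₄ t₅ : ℂ} {θ : ℝ}
    (h4 : ∑' x, (Qop j ^ 4) (Pi.single x 1) x = t₄)
    (h5 : ∑' x, (Qop j ^ 5) (Pi.single x 1) x = t₅)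
    (hθ : t₄.re < θ) (hθ5 : θ < 0 ∨ θ ^ 5 < ‖t₅‖ ^ 4) :
    ∃ (d : ℂ) (a : ℤ × ℤ → ℂ), d.im ≠ 0 ∧ (∀ n, ‖a n‖ ≤ 1) ∧ a ≠ 0 ∧ d • a = Bop a ∧
      ∀ n, ω ^ j * a (rot n) = a n := by
  obtain ⟨δ, hδ, hN⟩ := exists_truncated_eigenvector j h4 h5 hθ hθ5
  obtain ⟨N₀, hN₀⟩ := Filter.eventually_atTop.1 hN
  choose d a hd ha hmax heq using fun N : ℕ => hN₀ (N₀ + N) (Nat.le_add_right _ _)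
  have hbd : ∀ N n, ‖d N‖ * ‖a N n‖ ≤ 3 / ‖mode n‖ ∨ n ∉ boxSet (N₀ + N) := by
    intro N n
    by_cases h : n ∈ boxSet (N₀ + N)
    · left
      rw [← norm_mul, heq N n h]
      have := norm_Qop_le (j := j) (k := 0) (C := 1) zero_le_one (a := a N)
        (fun n => by simpa using ha N n) n
      simpa using this
    · exact Or.inr h
  -- the maximum is attained on a fixed finite set
  let G : Finset (ℤ × ℤ) := boxSet ⌈4 / 3 * (3 / δ)⌉₊
  have hG : ∀ N, ∃ n ∈ G, ‖a N n‖ = 1 := by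
    intro N
    obtain ⟨n, hn1, hn2⟩ := hmax N
    refine ⟨n, ?_, hn1⟩
    have h := (hbd N n).resolve_right (not_not.2 hn2)
    rw [hn1, mul_one] at h
    have h1 : δ ≤ 3 / ‖mode n‖ := ((hd N).le.trans (Complex.abs_im_le_norm _)).trans h
    have h2 : ‖mode n‖ ≤ 3 / δ := by
      rw [le_div_iff₀ (norm_mode_pos n)] at h1
      rw [le_div_iff₀ hδ]; linarith
    have h3 : ‖n‖ ≤ ⌈4 / 3 * (3 / δ)⌉₊ :=
      (norm_index_le n).trans ((by gcongr : 4 / 3 * ‖mode n‖ ≤ 4 / 3 * (3 / δ)).trans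
        (Nat.le_ceil _))
    rw [Prod.norm_def, max_le_iff, Int.norm_eq_abs, Int.norm_eq_abs] at h3
    rw [mem_boxSet]
    exact_mod_cast h3
  have hd3 : ∀ N, ‖d N‖ ≤ 3 := by
    intro N
    obtain ⟨n, hn1, hn2⟩ := hmax N
    have h := (hbd N n).resolve_right (not_not.2 hn2)
    rw [hn1, mul_one] at h
    exact h.trans (div_le_self (by norm_num) (one_le_norm_mode n))
  -- extract a limit
  have hcomp : IsCompact (Metric.closedBall (0 : ℂ) 3 ×ˢ
      Set.pi Set.univ fun _ : ℤ × ℤ => Metric.closedBall (0 : ℂ) 1) :=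
    (isCompact_closedBall _ _).prod (isCompact_univ_pi fun _ => isCompact_closedBall _ _)
  let U : Ultrafilter ℕ := Filter.hyperfilter ℕ
  have hU : (U : Filter ℕ) ≤ Filter.atTop := Nat.hyperfilter_le_atTop
  obtain ⟨⟨e, c⟩, hec, hlim⟩ := hcomp.ultrafilter_le_nhds (U.map fun N => (d N, a N)) (by
    rw [Ultrafilter.coe_map, Filter.le_principal_iff, Filter.mem_map]
    refine Filter.univ_mem' fun N => ?_
    simp only [Set.mem_preimage, Set.mem_prod, mem_closedBall_zero_iff, Set.mem_pi]
    exact ⟨hd3 N, fun n _ => ha N n⟩)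
  have hT : Filter.Tendsto (fun N => (d N, a N)) U (nhds (e, c)) := hlim
  have hTd : Filter.Tendsto d U (nhds e) := (continuous_fst.tendsto _).comp hT
  have hTa : ∀ n, Filter.Tendsto (fun N => a N n) U (nhds (c n)) := fun n =>
    (((continuous_apply n).comp continuous_snd).tendsto (e, c)).comp hT
  have hc1 : ∀ n, ‖c n‖ ≤ 1 := fun n => by
    have := hec.2 n trivial
    simpa using this
  have him : δ ≤ |e.im| :=
    ge_of_tendsto (((Complex.continuous_im.tendsto e).comp hTd).abs)
      (Filter.Eventually.of_forall fun N => (hd N).le)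
  have hc0 : c ≠ 0 := by
    have hcl : IsClosed {x : ℤ × ℤ → ℂ | ∃ n ∈ G, ‖x n‖ = 1} := by
      have : {x : ℤ × ℤ → ℂ | ∃ n ∈ G, ‖x n‖ = 1} = ⋃ n ∈ G, {x | ‖x n‖ = 1} := by
        ext; simp
      rw [this]
      exact isClosed_biUnion_finset fun n _ =>
        isClosed_eq (continuous_norm.comp (continuous_apply n)) continuous_const
    obtain ⟨n, -, hn⟩ := hcl.mem_of_tendsto ((continuous_snd.tendsto (e, c)).comp hT)
      (Filter.Eventually.of_forall hG)
    rintro rfl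
    simp at hn
  have hQ : e • c = Qop j c := by
    ext n
    have l1 : Filter.Tendsto (fun N => d N * a N n) U (nhds (e * c n)) := hTd.mul (hTa n)
    have l2 : Filter.Tendsto (fun N => Qop j (a N) n) U (nhds (Qop j c n)) := by
      simp_rw [Qop_apply]
      refine Filter.Tendsto.const_mul _ (tendsto_finsetSum _ fun l _ => ?_)
      refine Filter.Tendsto.const_mul _ (Filter.Tendsto.const_mul _
        (tendsto_finsetSum _ fun s _ => ?_))
      exact Filter.Tendsto.const_mul _ (hTa _)
    refine tendsto_nhds_unique (l1.congr' ?_) l2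
    refine hU ?_
    have := (Filter.tendsto_add_atTop_nat N₀).eventually (eventually_mem_boxSet n)
    filter_upwards [this] with N hN'
    rw [add_comm] at hN'
    exact heq N n hN'
  have he0 : e ≠ 0 := by
    rintro rfl
    simp at him
    linarith
  have hP : Pop j c = c := by
    have : e • Pop j c = e • c := by
      rw [← map_smul, hQ, ← Module.End.mul_apply, Qop, (commute_Bop_Pop j).eq, ← mul_assoc,
        Pop_mul_Pop]
    exact smul_right_injective _ he0 this
  refine ⟨e, c, fun h => by rw [h, abs_zero] at him; linarith, hc1, hc0, ?_, fun n => ?_⟩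
  · rw [hQ, Qop, Module.End.mul_apply, hP]
  · have := congrFun (congrArg (fun T : Module.End ℂ (ℤ × ℤ → ℂ) => T c) (rotOp_mul_Pop j)) n
    simpa [Module.End.mul_apply, hP, rotOp_apply] using this

/-! ### Traces of powers: reduction to twisted diagonals -/

/-- The diagonal entries of `Bop ^ k` composed with a rotation. -/
def twistedDiag (k s : ℕ) (x : ℤ × ℤ) : ℂ :=
  (Bop ^ k) (fun n => if rot^[s] n = x then 1 else 0) x

lemma norm_Bop_pow_le (k : ℕ) : ∃ C : ℝ, 0 ≤ C ∧ ∀ a : ℤ × ℤ → ℂ, (∀ n, ‖a n‖ ≤ 1) → ∀ n,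
    ‖(Bop ^ k) a n‖ ≤ C / ‖mode n‖ ^ k := by
  induction k with
  | zero => exact ⟨1, zero_le_one, fun a ha n => by simpa using ha n⟩
  | succ k ih =>
    obtain ⟨C, hC, h⟩ := ih
    refine ⟨3 * 2 ^ k * C, by positivity, fun a ha n => ?_⟩
    rw [pow_succ', Module.End.mul_apply]
    exact norm_Bop_le hC (h a ha) n

lemma summable_of_norm_le_mode {f : ℤ × ℤ → ℂ} {C : ℝ} {k : ℕ} (hk : 3 ≤ k)
    (h : ∀ n, ‖f n‖ ≤ C / ‖mode n‖ ^ k) : Summable f :=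
  .of_norm_bounded ((summable_norm_mode_inv_pow hk).mul_left C) h

lemma summable_twistedDiag {k : ℕ} (hk : 3 ≤ k) (s : ℕ) : Summable (twistedDiag k s) := by
  obtain ⟨C, -, h⟩ := norm_Bop_pow_le k
  exact summable_of_norm_le_mode hk fun x => h _ (fun n => by split <;> simp) x

lemma tsum_Qop_pow_diag (j : ℕ) {k : ℕ} (hk : 3 ≤ k) :
    ∑' x, (Qop j ^ k) (Pi.single x 1) x =
      3⁻¹ * ∑ s ∈ Finset.range 3, (ω ^ j) ^ s * ∑' x, twistedDiag k s x := by
  obtain ⟨k, rfl⟩ : ∃ k', k = k' + 1 := ⟨k - 1, by omega⟩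
  simp_rw [← tsum_mul_left]
  rw [← Summable.tsum_finsetSum fun s _ => (summable_twistedDiag hk s).mul_left _, ← tsum_mul_left]
  refine tsum_congr fun x => ?_
  rw [Qop_pow, Module.End.mul_apply, Pop, LinearMap.smul_apply, map_smul, Pi.smul_apply,
    smul_eq_mul, LinearMap.sum_apply, map_sum, Finset.sum_apply]
  congr 1
  refine Finset.sum_congr rfl fun s _ => ?_
  rw [LinearMap.smul_apply, map_smul, Pi.smul_apply, smul_eq_mul, twistedDiag]
  have : (rotOp ^ s) (Pi.single x 1) = fun n => if rot^[s] n = x then (1 : ℂ) else 0 := by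
    ext n
    rw [rotOp_pow_apply, Pi.single_apply]
  rw [this]

/-! ### The untwisted fourth trace -/

lemma refl_refl_eq_add (a b : ℕ) (n : ℤ × ℤ) : refl a (refl b n) = n + refl a (refl b 0) := by
  unfold refl; split <;> split <;> ext <;> simp <;> ring

lemma closed_walk_iff : ∀ a b l' l : Fin 3, (refl l' (refl l 0) + refl a (refl b 0) = 0 ↔
    (a = l ∧ b = l') ∨ (a = b ∧ l' = l)) := by
  decide +kernel

lemma refl_four_eq_iff {a b l' l : ℕ} (ha : a < 3) (hb : b < 3) (hl' : l' < 3) (hl : l < 3)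
    (x : ℤ × ℤ) : refl a (refl b (refl l' (refl l x))) = x ↔
      (a = l ∧ b = l') ∨ (a = b ∧ l' = l) := by
  have h := closed_walk_iff ⟨a, ha⟩ ⟨b, hb⟩ ⟨l', hl'⟩ ⟨l, hl⟩
  simp only [Fin.mk.injEq] at h
  rw [← h, refl_refl_eq_add a b, refl_refl_eq_add l' l x,
    add_assoc, add_eq_left]

lemma one_sub_mode_cube_eq (n : ℤ × ℤ) :
    1 - mode n ^ 3 = mode (refl 0 n) * mode (refl 1 n) * mode (refl 2 n) := by
  rw [mode_refl (by norm_num), mode_refl (by norm_num), mode_refl (by norm_num)]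
  have h := omega_sq
  have h3 := omega_pow_three
  linear_combination (mode n - mode n ^ 2) * h + (mode n - 1) * h3

lemma Bop_sq_apply (a : ℤ × ℤ → ℂ) (n : ℤ × ℤ) : (Bop ^ 2) a n =
    ∑ l ∈ Finset.range 3, ∑ l' ∈ Finset.range 3,
      ω ^ l * ω ^ l' * (mode n)⁻¹ * (mode (refl l n))⁻¹ * a (refl l' (refl l n)) := by
  rw [sq, Module.End.mul_apply, Bop_apply, Finset.mul_sum]
  refine Finset.sum_congr rfl fun l _ => ?_
  rw [Bop_apply, Finset.mul_sum, Finset.mul_sum, Finset.mul_sum]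
  exact Finset.sum_congr rfl fun l' _ => by ring

lemma sum_omega_div (n : ℤ × ℤ) :
    ∑ l ∈ Finset.range 3, ω ^ l * ω ^ l * (mode (refl l n))⁻¹ =
      3 * mode n * (1 - mode n ^ 3)⁻¹ := by
  have h := omega_sq
  have h3 := omega_pow_three
  have e := one_sub_mode_cube_eq n
  have h0 := mode_ne_zero (refl 0 n)
  have h1 := mode_ne_zero (refl 1 n)
  have h2 := mode_ne_zero (refl 2 n)
  rw [e]
  simp only [Finset.sum_range_succ, Finset.sum_range_zero]
  field_simp
  rw [mode_refl (by norm_num), mode_refl (by norm_num), mode_refl (by norm_num)]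
  ring_nf
  have h4 : ω ^ 4 = ω := by linear_combination ω * h3
  have h5 : ω ^ 5 = ω ^ 2 := by linear_combination ω ^ 2 * h3
  simp only [h3, h4, h5, h]
  ring

lemma sum_omega_div_sq (n : ℤ × ℤ) :
    ∑ l ∈ Finset.range 3, ω ^ l * ((mode (refl l n))⁻¹) ^ 2 =
      9 * mode n ^ 2 * ((1 - mode n ^ 3)⁻¹) ^ 2 := by
  have h := omega_sq
  have h3 := omega_pow_three
  have e := one_sub_mode_cube_eq n
  have h0 := mode_ne_zero (refl 0 n)
  have h1 := mode_ne_zero (refl 1 n)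
  have h2 := mode_ne_zero (refl 2 n)
  rw [e]
  simp only [Finset.sum_range_succ, Finset.sum_range_zero]
  field_simp
  rw [mode_refl (by norm_num), mode_refl (by norm_num), mode_refl (by norm_num)]
  have h4 : ω ^ 4 = ω := by linear_combination ω * h3
  have h5 : ω ^ 5 = ω ^ 2 := by linear_combination ω ^ 2 * h3
  have h6 : ω ^ 6 = 1 := by linear_combination (ω ^ 3 + 1) * h3
  ring_nf
  simp only [h3, h4, h5, h6, h]
  ring

/-- The weight of the closed walks `x, refl l x, refl l' (refl l x), refl l x, x`. -/
def backtrackWeight (l l' : ℕ) (x : ℤ × ℤ) : ℂ :=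
  ω ^ l * ω ^ l' * (mode x)⁻¹ * (mode (refl l x))⁻¹ *
    (ω ^ l' * ω ^ l * (mode (refl l' (refl l x)))⁻¹ * (mode (refl l x))⁻¹)

lemma Bop_sq_single {l l' : ℕ} (hl : l < 3) (hl' : l' < 3) (x : ℤ × ℤ) :
    (Bop ^ 2) (fun n => if n = x then 1 else 0) (refl l' (refl l x)) =
      if l' = l then 3 * (1 - mode x ^ 3)⁻¹ else
        ω ^ l' * ω ^ l * (mode (refl l' (refl l x)))⁻¹ * (mode (refl l x))⁻¹ := by
  rw [Bop_sq_apply]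
  split_ifs with h
  · subst h
    rw [refl_refl]
    have : ∀ b ∈ Finset.range 3, ∑ a ∈ Finset.range 3, ω ^ b * ω ^ a * (mode x)⁻¹ *
        (mode (refl b x))⁻¹ * (if refl a (refl b x) = x then 1 else 0) =
        (mode x)⁻¹ * (ω ^ b * ω ^ b * (mode (refl b x))⁻¹) := by
      intro b hb
      rw [Finset.sum_eq_single_of_mem b hb]
      · rw [refl_refl, if_pos rfl]; ring
      · intro a ha hab
        have := refl_four_eq_iff (Finset.mem_range.1 ha) (Finset.mem_range.1 hb) hl' hl' x
        rw [refl_refl l'] at this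
        rw [if_neg, mul_zero]
        rw [this]
        rintro (⟨rfl, rfl⟩ | ⟨rfl, -⟩) <;> exact hab rfl
    rw [Finset.sum_congr rfl this, ← Finset.mul_sum, sum_omega_div]
    have := mode_ne_zero x
    field_simp
  · rw [Finset.sum_eq_single_of_mem l' (Finset.mem_range.2 hl'),
      Finset.sum_eq_single_of_mem l (Finset.mem_range.2 hl)]
    · rw [refl_refl l', refl_refl l, if_pos rfl, mul_one]
    · intro a ha hal
      rw [if_neg, mul_zero, ]
      rw [refl_four_eq_iff (Finset.mem_range.1 ha) hl' hl' hl x]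
      rintro (⟨rfl, -⟩ | ⟨-, h'⟩)
      · exact hal rfl
      · exact h h'
    · intro b hb hbl
      refine Finset.sum_eq_zero fun a ha => ?_
      rw [if_neg, mul_zero]
      rw [refl_four_eq_iff (Finset.mem_range.1 ha) (Finset.mem_range.1 hb) hl' hl x]
      rintro (⟨-, rfl⟩ | ⟨-, h'⟩)
      · exact hbl rfl
      · exact h h'

lemma twistedDiag_four_zero (x : ℤ × ℤ) : twistedDiag 4 0 x = 9 * ((1 - mode x ^ 3)⁻¹) ^ 2 +
    ∑ l ∈ Finset.range 3, ∑ l' ∈ Finset.range 3, if l' = l then 0 else backtrackWeight l l' x := by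
  have e : twistedDiag 4 0 x =
      (Bop ^ 2) ((Bop ^ 2) (fun n => if n = x then 1 else 0)) x := by
    rw [← Module.End.mul_apply, ← pow_add]; rfl
  rw [e, Bop_sq_apply]
  have : ∀ l ∈ Finset.range 3, ∑ l' ∈ Finset.range 3, ω ^ l * ω ^ l' * (mode x)⁻¹ *
      (mode (refl l x))⁻¹ * (Bop ^ 2) (fun n => if n = x then 1 else 0) (refl l' (refl l x)) =
      (mode x)⁻¹ * (3 * (1 - mode x ^ 3)⁻¹) * (ω ^ l * ω ^ l * (mode (refl l x))⁻¹) +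
      ∑ l' ∈ Finset.range 3, if l' = l then 0 else backtrackWeight l l' x := by
    intro l hl
    rw [← Finset.sum_erase_add _ _ hl, ← Finset.sum_erase_add (Finset.range 3) (fun l' =>
      if l' = l then 0 else backtrackWeight l l' x) hl, if_pos rfl, add_zero, add_comm]
    congr 1
    · rw [Bop_sq_single (Finset.mem_range.1 hl) (Finset.mem_range.1 hl), if_pos rfl]; ring
    · refine Finset.sum_congr rfl fun l' hl' => ?_
      have hne := (Finset.mem_erase.1 hl').1
      rw [Bop_sq_single (Finset.mem_range.1 hl) (Finset.mem_range.1 (Finset.mem_erase.1 hl').2),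
        if_neg hne, if_neg hne, backtrackWeight]
  rw [Finset.sum_congr rfl this, Finset.sum_add_distrib, ← Finset.mul_sum, sum_omega_div]
  congr 1
  have := mode_ne_zero x
  field_simp
  ring

lemma summable_backtrackWeight {l l' : ℕ} (hl : l < 3) (hl' : l' < 3) :
    Summable (backtrackWeight l l') := by
  refine summable_of_norm_le_mode (k := 4) (C := 16) (by norm_num) fun n => ?_
  have h1 := norm_mode_pos n
  have h2 := norm_mode_refl_ge hl n
  have h3 : ‖mode n‖ / 4 ≤ ‖mode (refl l' (refl l n))‖ := by
    have := norm_mode_refl_ge hl' (refl l n); linarith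
  simp only [backtrackWeight, norm_mul, norm_inv, norm_omega_pow, one_mul]
  calc _ ≤ ‖mode n‖⁻¹ * (‖mode n‖ / 2)⁻¹ * ((‖mode n‖ / 4)⁻¹ * (‖mode n‖ / 2)⁻¹) := by gcongr
    _ = _ := by field_simp; norm_num

lemma sum_backtrackWeight_refl (n : ℤ × ℤ) : ∑ l ∈ Finset.range 3, ∑ l' ∈ Finset.range 3,
    (if l' = l then 0 else backtrackWeight l l' (refl l n)) = 0 := by
  have h4 : ω ^ 4 = ω := by linear_combination ω * omega_pow_three
  have h8 : ω ^ 8 = ω ^ 2 := by linear_combination (ω ^ 5 + ω ^ 2) * omega_pow_three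
  have key : (∑ l ∈ Finset.range 3, ω ^ l * ω ^ l * (mode (refl l n))⁻¹) ^ 2 =
      ∑ l ∈ Finset.range 3, ω ^ l * ((mode (refl l n))⁻¹) ^ 2 := by
    rw [sum_omega_div, sum_omega_div_sq]; ring
  simp only [Finset.sum_range_succ, Finset.sum_range_zero, backtrackWeight, refl_refl, if_true,
    Nat.one_ne_zero, Nat.zero_ne_one, if_false, (by decide : ¬ 2 = 0), (by decide : ¬ 2 = 1),
    (by decide : ¬ 0 = 2), (by decide : ¬ 1 = 2)] at key ⊢
  generalize (mode (refl 0 n))⁻¹ = x at key ⊢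
  generalize (mode (refl 1 n))⁻¹ = y at key ⊢
  generalize (mode (refl 2 n))⁻¹ = z at key ⊢
  generalize (mode n)⁻¹ = w at key ⊢
  linear_combination w ^ 2 * key - w ^ 2 * (y ^ 2 * h4 + z ^ 2 * h8)

lemma tsum_sum_eq_zero_of_equiv {f : ℕ → ℤ × ℤ → ℂ} (σ : ℕ → ℤ × ℤ ≃ ℤ × ℤ)
    (hf : ∀ l ∈ Finset.range 3, Summable (f l))
    (h : ∀ n, ∑ l ∈ Finset.range 3, f l (σ l n) = 0) :
    ∑' x, ∑ l ∈ Finset.range 3, f l x = 0 := by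
  have hf' : ∀ l ∈ Finset.range 3, Summable fun n => f l (σ l n) := fun l hl =>
    (σ l).summable_iff.2 (hf l hl)
  have e : ∀ l ∈ Finset.range 3, ∑' n, f l n = ∑' n, f l (σ l n) := fun l _ =>
    ((σ l).tsum_eq _).symm
  rw [Summable.tsum_finsetSum hf, Finset.sum_congr rfl e, ← Summable.tsum_finsetSum hf',
    tsum_congr h, tsum_zero]

lemma summable_sum_backtrackWeight {l : ℕ} (hl : l ∈ Finset.range 3) :
    Summable fun x => ∑ l' ∈ Finset.range 3, (if l' = l then 0 else backtrackWeight l l' x) := by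
  refine summable_sum fun l' hl' => ?_
  split_ifs
  · exact summable_zero
  · exact summable_backtrackWeight (Finset.mem_range.1 hl) (Finset.mem_range.1 hl')

lemma tsum_backtrackWeight : ∑' x, ∑ l ∈ Finset.range 3, ∑ l' ∈ Finset.range 3,
    (if l' = l then 0 else backtrackWeight l l' x) = 0 :=
  tsum_sum_eq_zero_of_equiv reflEquiv (fun _ hl => summable_sum_backtrackWeight hl)
    sum_backtrackWeight_refl

lemma tsum_twistedDiag_four_zero :
    ∑' x, twistedDiag 4 0 x = ∑' x, 9 * ((1 - mode x ^ 3)⁻¹) ^ 2 ∧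
      Summable fun x => 9 * ((1 - mode x ^ 3)⁻¹) ^ 2 := by
  have hs : Summable fun x => ∑ l ∈ Finset.range 3, ∑ l' ∈ Finset.range 3,
      (if l' = l then 0 else backtrackWeight l l' x) := by
    exact summable_sum fun l hl => summable_sum_backtrackWeight hl
  have h := summable_twistedDiag (k := 4) (by norm_num) 0
  have h9 : Summable fun x => 9 * ((1 - mode x ^ 3)⁻¹) ^ 2 :=
    (h.sub hs).congr fun x => by rw [twistedDiag_four_zero]; ring
  refine ⟨?_, h9⟩
  simp_rw [twistedDiag_four_zero]
  rw [h9.tsum_add hs, tsum_backtrackWeight, add_zero]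

/-! ### Exact arithmetic with Eisenstein rationals -/

/-- The complex number `a + bω`. -/
def eisVal (a : ℚ × ℚ) : ℂ := a.1 + a.2 * ω

/-- Multiplication of Eisenstein rationals. -/
def eisMul (a b : ℚ × ℚ) : ℚ × ℚ :=
  (a.1 * b.1 - a.2 * b.2, a.1 * b.2 + a.2 * b.1 - a.2 * b.2)

/-- The norm form of Eisenstein rationals. -/
def eisNorm (a : ℚ × ℚ) : ℚ := a.1 * a.1 - a.1 * a.2 + a.2 * a.2

/-- Inversion of Eisenstein rationals. -/
def eisInv (a : ℚ × ℚ) : ℚ × ℚ := ((a.1 - a.2) / eisNorm a, -a.2 / eisNorm a)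

/-- The mode as an Eisenstein rational. -/
def eisMode (n : ℤ × ℤ) : ℚ × ℚ := ((n.1 - 2 * n.2 - 1 : ℤ), (2 * n.1 - n.2 : ℤ))

lemma eisVal_add (a b : ℚ × ℚ) : eisVal (a + b) = eisVal a + eisVal b := by
  simp [eisVal]; ring

lemma eisVal_mul (a b : ℚ × ℚ) : eisVal (eisMul a b) = eisVal a * eisVal b := by
  simp only [eisVal, eisMul]
  push_cast
  linear_combination -(a.2 * b.2 : ℂ) * omega_sq

lemma eisVal_zero : eisVal 0 = 0 := by simp [eisVal]

lemma eisVal_inv (a : ℚ × ℚ) : eisVal (eisInv a) = (eisVal a)⁻¹ := by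
  by_cases h : eisNorm a = 0
  · have h1 : a = 0 := by
      unfold eisNorm at h
      have h2 : a.2 = 0 := by
        by_contra hne
        have := sq_pos_of_ne_zero hne
        nlinarith [sq_nonneg (2 * a.1 - a.2)]
      have h1 : a.1 = 0 := by rw [h2] at h; simpa using h
      exact Prod.ext h1 h2
    subst h1
    simp [eisVal, eisInv]
  · refine eq_inv_of_mul_eq_one_left ?_
    have h' : (eisNorm a : ℂ) ≠ 0 := by exact_mod_cast h
    simp only [eisVal, eisInv]
    push_cast
    field_simp
    simp only [eisNorm]
    push_cast
    linear_combination -(a.2 ^ 2 : ℂ) * omega_sq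

lemma eisVal_mode (n : ℤ × ℤ) : eisVal (eisMode n) = mode n := by
  simp [eisVal, eisMode, mode]

/-- Multiplication by `ω`. -/
def eisRot (a : ℚ × ℚ) : ℚ × ℚ := (-a.2, a.1 - a.2)

lemma eisVal_rot (a : ℚ × ℚ) : eisVal (eisRot a) = ω * eisVal a := by
  simp only [eisVal, eisRot]
  push_cast
  linear_combination -(a.2 : ℂ) * omega_sq

/-- `a + ω * b`, with a shortcut for vanishing summands. -/
def eisAddRot (a b : ℚ × ℚ) : ℚ × ℚ :=
  if b = 0 then a else if a = 0 then eisRot b else a + eisRot b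

lemma eisVal_addRot (a b : ℚ × ℚ) : eisVal (eisAddRot a b) = eisVal a + ω * eisVal b := by
  unfold eisAddRot
  split_ifs with h1 h2
  · simp [h1, eisVal_zero]
  · simp [h2, eisVal_zero, eisVal_rot]
  · rw [eisVal_add, eisVal_rot]

/-- `Bop ^ k` applied to the indicator function of `p`, computed exactly. -/
def walkSum (p : ℤ × ℤ → Bool) : ℕ → ℤ × ℤ → ℚ × ℚ
  | 0, n => if p n then (1, 0) else 0
  | k + 1, n =>
    let s := eisAddRot (walkSum p k (refl 0 n))
      (eisAddRot (walkSum p k (refl 1 n)) (walkSum p k (refl 2 n)))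
    if s = 0 then 0 else eisMul (eisInv (eisMode n)) s

lemma eisVal_walkSum (p : ℤ × ℤ → Bool) (k : ℕ) (n : ℤ × ℤ) :
    eisVal (walkSum p k n) = (Bop ^ k) (fun n => if p n then 1 else 0) n := by
  induction k generalizing n with
  | zero =>
    simp only [walkSum, pow_zero, Module.End.one_apply]
    split <;> simp [eisVal]
  | succ k ih =>
    have e : eisVal (walkSum p (k + 1) n) = (mode n)⁻¹ * eisVal (eisAddRot (walkSum p k (refl 0 n))
        (eisAddRot (walkSum p k (refl 1 n)) (walkSum p k (refl 2 n)))) := by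
      simp only [walkSum]
      split_ifs with h
      · rw [h, eisVal_zero, mul_zero]
      · rw [eisVal_mul, eisVal_inv, eisVal_mode]
    rw [e, pow_succ', Module.End.mul_apply, Bop_apply]
    simp only [eisVal_addRot, ih, Finset.sum_range_succ,
      Finset.sum_range_zero]
    ring

/-- Sums over the square boxes. -/
def gridSum (f : ℤ × ℤ → ℚ × ℚ) (M : ℕ) : ℚ × ℚ :=
  (List.range (2 * M + 1)).foldr (fun (i : ℕ) s =>
    (List.range (2 * M + 1)).foldr (fun (j : ℕ) s => f ((i : ℤ) - M, (j : ℤ) - M) + s) s) 0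

lemma sum_boxSet {A : Type*} [AddCommMonoid A] (f : ℤ × ℤ → A) (M : ℕ) :
    ∑ x ∈ boxSet M, f x = ∑ i ∈ Finset.range (2 * M + 1), ∑ j ∈ Finset.range (2 * M + 1),
      f ((i : ℤ) - M, (j : ℤ) - M) := by
  rw [← Finset.sum_product']
  symm
  refine Finset.sum_bij (fun x _ => ((x.1 : ℤ) - M, (x.2 : ℤ) - M)) ?_ ?_ ?_ ?_
  · intro x hx
    simp only [Finset.mem_product, Finset.mem_range] at hx
    simp only [mem_boxSet, abs_le]
    omega
  · intro x hx y hy h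
    simp only [Prod.mk.injEq] at h
    ext <;> omega
  · intro y hy
    simp only [mem_boxSet, abs_le] at hy
    refine ⟨((y.1 + M).toNat, (y.2 + M).toNat), ?_, ?_⟩
    · simp only [Finset.mem_product, Finset.mem_range]; omega
    · refine Prod.ext ?_ ?_ <;> dsimp only <;> omega
  · intro x _; rfl

lemma foldr_range_eq_sum {A : Type*} [AddCommMonoid A] (f : ℕ → A) (n : ℕ) (s : A) :
    (List.range n).foldr (fun j s => f j + s) s = ∑ j ∈ Finset.range n, f j + s := by
  induction n generalizing s with
  | zero => simp
  | succ n ih => rw [List.range_succ, List.foldr_append, ih, Finset.sum_range_succ]; simp [add_assoc]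

lemma gridSum_eq_sum (f : ℤ × ℤ → ℚ × ℚ) (M : ℕ) : gridSum f M = ∑ x ∈ boxSet M, f x := by
  rw [sum_boxSet, gridSum]
  simp_rw [foldr_range_eq_sum]
  rw [add_zero]

lemma eisVal_sum {ι : Type*} (F : Finset ι) (f : ι → ℚ × ℚ) :
    eisVal (∑ x ∈ F, f x) = ∑ x ∈ F, eisVal (f x) := by
  classical
  induction F using Finset.induction_on with
  | empty => simp [eisVal_zero]
  | insert a F ha ih => rw [Finset.sum_insert ha, Finset.sum_insert ha, eisVal_add, ih]

lemma Bop_pow_eq_zero {k : ℕ} {a : ℤ × ℤ → ℂ} {n : ℤ × ℤ}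
    (h : ∀ y : ℤ × ℤ, |(4 * y.1 + 1) - (-1) ^ k * (4 * n.1 + 1)| ≤ 2 * k →
      |(4 * y.2 + 3) - (-1) ^ k * (4 * n.2 + 3)| ≤ 2 * k → a y = 0) :
    (Bop ^ k) a n = 0 := by
  induction k generalizing n with
  | zero => exact h n (by simp) (by simp)
  | succ k ih =>
    rw [pow_succ', Module.End.mul_apply, Bop_apply]
    rw [Finset.sum_eq_zero, mul_zero]
    intro l _
    rw [ih, mul_zero]
    intro y h1 h2
    have key : ∀ u v w : ℤ, |w + v| ≤ 2 → |u - (-1) ^ k * w| ≤ 2 * k →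
        |u - (-1) ^ (k + 1) * v| ≤ 2 * (k + 1 : ℕ) := by
      intro u v w hc hu
      have : u - (-1) ^ (k + 1) * v = (u - (-1) ^ k * w) + (-1) ^ k * (w + v) := by ring
      rw [this]
      refine (abs_add_le _ _).trans ?_
      rw [abs_mul, abs_pow, abs_neg, abs_one, one_pow, one_mul]
      push_cast; linarith
    refine h y (key _ _ _ ?_ h1) (key _ _ _ ?_ h2)
    · unfold refl
      split <;> rw [abs_le] <;> constructor <;> linarith
    · unfold refl
      split <;> rw [abs_le] <;> constructor <;> linarith

/-- The twisted traces are finite sums. -/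
lemma tsum_twistedDiag_eq {k s M : ℕ} {v : ℚ × ℚ}
    (hM : ∀ x y : ℤ × ℤ, |(4 * y.1 + 1) - (-1) ^ k * (4 * x.1 + 1)| ≤ 2 * k →
      |(4 * y.2 + 3) - (-1) ^ k * (4 * x.2 + 3)| ≤ 2 * k → rot^[s] y = x → x ∈ boxSet M)
    (hv : gridSum (fun x => walkSum (fun n => rot^[s] n = x) k x) M = v) :
    ∑' x, twistedDiag k s x = eisVal v := by
  have e : ∀ x, twistedDiag k s x = eisVal (walkSum (fun n => rot^[s] n = x) k x) := by
    intro x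
    rw [eisVal_walkSum, twistedDiag]
    simp
  rw [← hv, gridSum_eq_sum, eisVal_sum, tsum_eq_sum (s := boxSet M)]
  · exact Finset.sum_congr rfl fun x _ => e x
  · intro x hx
    refine Bop_pow_eq_zero fun y h1 h2 => ?_
    rw [if_neg]
    intro h
    exact hx (hM x y h1 h2 h)

lemma gridSum_walkSum_four_one :
    gridSum (fun x => walkSum (fun n => rot^[1] n = x) 4 x) 2 = (0, 9) := by
  decide +kernel

lemma gridSum_walkSum_four_two :
    gridSum (fun x => walkSum (fun n => rot^[2] n = x) 4 x) 2 = (-9, -9) := by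
  decide +kernel

lemma gridSum_walkSum_five_zero :
    gridSum (fun x => walkSum (fun n => rot^[0] n = x) 5 x) 2 = (-15, 0) := by
  decide +kernel

lemma gridSum_walkSum_five_one :
    gridSum (fun x => walkSum (fun n => rot^[1] n = x) 5 x) 5 = (0, -7047 / 494) := by
  decide +kernel

lemma gridSum_walkSum_five_two :
    gridSum (fun x => walkSum (fun n => rot^[2] n = x) 5 x) 6 = (7047 / 494, 7047 / 494) := by
  decide +kernel

lemma tsum_twistedDiag_four_one : ∑' x, twistedDiag 4 1 x = 9 * ω := by
  rw [tsum_twistedDiag_eq (M := 2) ?_ gridSum_walkSum_four_one]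
  · simp [eisVal]
  · intro x y h1 h2 h
    subst h
    simp only [mem_boxSet, rot, Function.iterate_one, abs_le] at *
    norm_num at h1 h2 ⊢
    omega

lemma tsum_twistedDiag_four_two : ∑' x, twistedDiag 4 2 x = 9 * ω ^ 2 := by
  rw [tsum_twistedDiag_eq (M := 2) ?_ gridSum_walkSum_four_two]
  · rw [omega_sq]; simp [eisVal]; ring
  · intro x y h1 h2 h
    subst h
    simp only [mem_boxSet, rot, Function.iterate_succ, Function.iterate_zero, Function.comp_apply,
      id_eq, abs_le] at *
    norm_num at h1 h2 ⊢
    omega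

lemma tsum_twistedDiag_five_zero : ∑' x, twistedDiag 5 0 x = -15 := by
  rw [tsum_twistedDiag_eq (M := 2) ?_ gridSum_walkSum_five_zero]
  · simp [eisVal]
  · intro x y h1 h2 h
    subst h
    simp only [mem_boxSet, Function.iterate_zero, id_eq, abs_le] at *
    norm_num at h1 h2 ⊢
    omega

lemma tsum_twistedDiag_five_one : ∑' x, twistedDiag 5 1 x = -(7047 / 494) * ω := by
  rw [tsum_twistedDiag_eq (M := 5) ?_ gridSum_walkSum_five_one]
  · simp [eisVal]; ring
  · intro x y h1 h2 h
    subst h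
    simp only [mem_boxSet, rot, Function.iterate_one, abs_le] at *
    norm_num at h1 h2 ⊢
    omega

lemma tsum_twistedDiag_five_two : ∑' x, twistedDiag 5 2 x = -(7047 / 494) * ω ^ 2 := by
  rw [tsum_twistedDiag_eq (M := 6) ?_ gridSum_walkSum_five_two]
  · rw [omega_sq]; simp [eisVal]; ring
  · intro x y h1 h2 h
    subst h
    simp only [mem_boxSet, rot, Function.iterate_succ, Function.iterate_zero, Function.comp_apply,
      id_eq, abs_le] at *
    norm_num at h1 h2 ⊢
    omega

/-- The summand of the untwisted fourth trace. -/
def traceTerm (x : ℤ × ℤ) : ℂ := 9 * ((1 - mode x ^ 3)⁻¹) ^ 2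

/-- The summand of the untwisted fourth trace as an Eisenstein rational. -/
def eisTraceTerm (x : ℤ × ℤ) : ℚ × ℚ :=
  let m := eisMode x
  let i := eisInv ((1, 0) + eisMul (-1, 0) (eisMul m (eisMul m m)))
  eisMul (9, 0) (eisMul i i)

lemma eisVal_traceTerm (x : ℤ × ℤ) : eisVal (eisTraceTerm x) = traceTerm x := by
  simp only [eisTraceTerm, eisVal_mul, eisVal_inv, eisVal_add, eisVal_mode, traceTerm]
  simp only [eisVal]
  push_cast
  ring_nf

lemma gridSum_eisTraceTerm_le :
    (gridSum eisTraceTerm 3).1 - (gridSum eisTraceTerm 3).2 / 2 ≤ 7256 / 1000 := by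
  decide +kernel

lemma eisVal_re (a : ℚ × ℚ) : (eisVal a).re = a.1 - a.2 / 2 := by
  simp [eisVal, omega_re]; ring

lemma sum_boxSet_three_traceTerm_le : (∑ x ∈ boxSet 3, traceTerm x).re ≤ 7256 / 1000 := by
  have h := gridSum_eisTraceTerm_le
  have e : ∑ x ∈ boxSet 3, traceTerm x = eisVal (gridSum eisTraceTerm 3) := by
    rw [gridSum_eq_sum, eisVal_sum]
    exact Finset.sum_congr rfl fun x _ => (eisVal_traceTerm x).symm
  rw [e, eisVal_re]
  have h' : (((gridSum eisTraceTerm 3).1 - (gridSum eisTraceTerm 3).2 / 2 : ℚ) : ℝ) ≤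
    ((7256 / 1000 : ℚ) : ℝ) := by exact_mod_cast h
  push_cast at h'
  exact h'

lemma norm_traceTerm_le {n : ℕ} (hn : 4 ≤ n) {x : ℤ × ℤ}
    (hx : (n : ℤ) ≤ |x.1| ∨ (n : ℤ) ≤ |x.2|) :
    ‖traceTerm x‖ ≤ 9 / (19 / 10 * (n : ℝ) ^ 3) ^ 2 := by
  have h1 := norm_mode_ge x n hx
  have hn' : (4 : ℝ) ≤ n := by exact_mod_cast hn
  have h2 : 5 / 4 * (n : ℝ) ≤ ‖mode x‖ := by linarith
  have h3 : (5 / 4 * (n : ℝ)) ^ 3 ≤ ‖mode x‖ ^ 3 := pow_le_pow_left₀ (by positivity) h2 3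
  have h4 : (4 : ℝ) ^ 3 ≤ (n : ℝ) ^ 3 := pow_le_pow_left₀ (by positivity) hn' 3
  have h5 : ‖mode x‖ ^ 3 - 1 ≤ ‖1 - mode x ^ 3‖ := by
    have := norm_sub_norm_le (mode x ^ 3) 1
    rw [norm_pow, norm_one] at this
    rwa [norm_sub_rev]
  have h6 : 19 / 10 * (n : ℝ) ^ 3 ≤ ‖1 - mode x ^ 3‖ := by nlinarith
  rw [traceTerm, norm_mul, norm_pow, norm_inv, inv_pow, div_eq_mul_inv]
  norm_num only [Complex.norm_ofNat]
  gcongr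

lemma card_boxSet (N : ℕ) : (boxSet N).card = (2 * N + 1) ^ 2 := by
  rw [Finset.card_eq_sum_ones, sum_boxSet]
  simp
  ring

lemma boxSet_mono : Monotone boxSet := by
  intro M N h x hx
  rw [mem_boxSet] at hx ⊢
  omega

lemma sum_boxSet_traceTerm_le {N : ℕ} (hN : 3 ≤ N) :
    (∑ x ∈ boxSet N, traceTerm x).re ≤ 73 / 10 + 81 / 10000 - 5 / 8 / ((N : ℝ) * (N + 1)) := by
  induction N, hN using Nat.le_induction with
  | base => exact sum_boxSet_three_traceTerm_le.trans (by norm_num)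
  | succ N hN ih =>
    have hsub : boxSet N ⊆ boxSet (N + 1) := boxSet_mono (Nat.le_succ N)
    rw [← Finset.sum_sdiff hsub, add_re]
    have hN' : (3 : ℝ) ≤ N := by exact_mod_cast hN
    have hcard : ((boxSet (N + 1) \ boxSet N).card : ℝ) = 8 * (N + 1) := by
      rw [Finset.card_sdiff_of_subset hsub, Nat.cast_sub (Finset.card_le_card hsub), card_boxSet,
        card_boxSet]
      push_cast; ring
    have hshell : (∑ x ∈ boxSet (N + 1) \ boxSet N, traceTerm x).re ≤
        8 * (N + 1) * (9 / (19 / 10 * ((N + 1 : ℕ) : ℝ) ^ 3) ^ 2) := by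
      refine (re_le_norm _).trans ((norm_sum_le _ _).trans ?_)
      refine (Finset.sum_le_card_nsmul _ _ (9 / (19 / 10 * ((N + 1 : ℕ) : ℝ) ^ 3) ^ 2)
        fun x hx => ?_).trans ?_
      · refine norm_traceTerm_le (by omega) ?_
        rw [Finset.mem_sdiff, mem_boxSet, mem_boxSet] at hx
        omega
      · rw [nsmul_eq_mul, hcard]
    have key : 8 * ((N : ℝ) + 1) * (9 / (19 / 10 * ((N + 1 : ℕ) : ℝ) ^ 3) ^ 2) ≤
        5 / 8 / ((N : ℝ) * (N + 1)) - 5 / 8 / (((N + 1 : ℕ) : ℝ) * ((N + 1 : ℕ) + 1)) := by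
      push_cast
      generalize (N : ℝ) = t at hN'
      have e : 5 / 8 / (t * (t + 1)) - 5 / 8 / ((t + 1) * (t + 1 + 1)) =
          5 / 4 / (t * (t + 1) * (t + 2)) := by field_simp; ring
      rw [e]
      have e2 : 8 * (t + 1) * (9 / (19 / 10 * (t + 1) ^ 3) ^ 2) = 7200 / 361 / (t + 1) ^ 5 := by
        field_simp; norm_num
      rw [e2, div_le_div_iff₀ (by positivity) (by positivity)]
      have h1 : (16 : ℝ) ≤ (t + 1) ^ 2 := by nlinarith
      have h2 : t * (t + 1) * (t + 2) ≤ (t + 1) ^ 3 := by nlinarith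
      have h3 : 0 ≤ (t + 1) ^ 3 := by positivity
      calc 7200 / 361 * (t * (t + 1) * (t + 2)) ≤ 20 * (t + 1) ^ 3 := by
            nlinarith [show 0 ≤ t * (t + 1) * (t + 2) by positivity]
        _ ≤ 5 / 4 * (t + 1) ^ 5 := by nlinarith [mul_le_mul_of_nonneg_left h1 h3]
    linarith

lemma tsum_twistedDiag_four_zero_re_le : (∑' x, twistedDiag 4 0 x).re ≤ 7309 / 1000 := by
  obtain ⟨e, hs⟩ := tsum_twistedDiag_four_zero
  rw [e]
  have ht : Filter.Tendsto boxSet Filter.atTop Filter.atTop :=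
    Filter.tendsto_atTop_finset_of_monotone boxSet_mono fun x =>
      ((eventually_mem_boxSet x).exists)
  have := (Complex.continuous_re.tendsto _).comp (hs.hasSum.comp ht)
  refine le_of_tendsto this ?_
  filter_upwards [Filter.eventually_ge_atTop 3] with N hN
  refine (sum_boxSet_traceTerm_le hN).trans ?_
  have : 0 ≤ 5 / 8 / ((N : ℝ) * (N + 1)) := by positivity
  linarith

/-- Every rotational sector contains a non-real eigenvalue. -/
lemma exists_nonreal_eigenvalue_sector {j : ℕ} (hj : j < 3) :
    ∃ (d : ℂ) (a : ℤ × ℤ → ℂ), d.im ≠ 0 ∧ (∀ n, ‖a n‖ ≤ 1) ∧ a ≠ 0 ∧ d • a = Bop a ∧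
      ∀ n, ω ^ j * a (rot n) = a n := by
  have h0 := tsum_twistedDiag_four_zero_re_le
  have e4 := tsum_Qop_pow_diag j (k := 4) (by norm_num)
  have e5 := tsum_Qop_pow_diag j (k := 5) (by norm_num)
  simp only [Finset.sum_range_succ, Finset.sum_range_zero, zero_add, pow_zero, one_mul,
    tsum_twistedDiag_four_one, tsum_twistedDiag_four_two, tsum_twistedDiag_five_zero,
    tsum_twistedDiag_five_one, tsum_twistedDiag_five_two, pow_one] at e4 e5
  have w3 := omega_pow_three
  have w2 := omega_sq
  interval_cases j
  · refine exists_nonreal_eigenvalue 0 e4 rfl (θ := -1 / 10) ?_ (Or.inl (by norm_num))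
    have : (3 : ℂ)⁻¹ * (∑' x, twistedDiag 4 0 x + ω ^ 0 * (9 * ω) + (ω ^ 0) ^ 2 * (9 * ω ^ 2)) =
        ((1 / 3 : ℝ) : ℂ) * (∑' x, twistedDiag 4 0 x) - (3 : ℝ) := by
      push_cast
      linear_combination 3 * w2
    rw [this, sub_re, re_ofReal_mul, ofReal_re]
    linarith
  · refine exists_nonreal_eigenvalue 1 e4 rfl (θ := -1 / 10) ?_ (Or.inl (by norm_num))
    have : (3 : ℂ)⁻¹ * (∑' x, twistedDiag 4 0 x + ω ^ 1 * (9 * ω) + (ω ^ 1) ^ 2 * (9 * ω ^ 2)) =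
        ((1 / 3 : ℝ) : ℂ) * (∑' x, twistedDiag 4 0 x) - (3 : ℝ) := by
      push_cast
      linear_combination 3 * w2 + 3 * ω * w3
    rw [this, sub_re, re_ofReal_mul, ofReal_re]
    linarith
  · refine exists_nonreal_eigenvalue 2 e4 e5 (θ := 849 / 100) ?_ (Or.inr ?_)
    · have : (3 : ℂ)⁻¹ * (∑' x, twistedDiag 4 0 x + ω ^ 2 * (9 * ω) +
          (ω ^ 2) ^ 2 * (9 * ω ^ 2)) =
          ((1 / 3 : ℝ) : ℂ) * (∑' x, twistedDiag 4 0 x) + (6 : ℝ) := by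
        push_cast
        linear_combination (6 + 3 * ω ^ 3) * w3
      rw [this, add_re, re_ofReal_mul, ofReal_re]
      linarith
    · have : (3 : ℂ)⁻¹ * (-15 + ω ^ 2 * (-(7047 / 494) * ω) +
          (ω ^ 2) ^ 2 * (-(7047 / 494) * ω ^ 2)) = ((-3584 / 247 : ℝ) : ℂ) := by
        push_cast
        linear_combination (-(7047 / 494) / 3) * (2 + ω ^ 3) * w3
      rw [this, norm_real, Real.norm_eq_abs]
      norm_num [abs_of_neg]

/-! ### Fourier series -/

/-- Bounded sequences satisfying the reflection inequality decay superexponentially. -/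
lemma exists_exp_decay {s : ℤ × ℤ → ℝ} {B D c : ℝ} (hs : ∀ n, 0 ≤ s n) (hB : ∀ n, s n ≤ B)
    (hc : 0 ≤ c)
    (h : ∀ n, (‖mode n‖ - D) * s n ≤ c * ∑ l ∈ Finset.range 3, s (refl l n)) (R : ℕ) :
    ∃ C, ∀ n, s n ≤ C * Real.exp (-(R * ‖mode n‖)) := by
  have hB0 : 0 ≤ B := (hs 0).trans (hB 0)
  set q : ℝ := 3 * c * Real.exp R + 1 with hq
  have hq0 : 0 < q := by positivity
  have claim : ∀ (k : ℕ) (n : ℤ × ℤ), D + q + k ≤ ‖mode n‖ → s n ≤ B * Real.exp (-(R * k)) := by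
    intro k
    induction k with
    | zero => intro n _; simpa using hB n
    | succ k ih =>
      intro n hn
      push_cast at hn
      have h1 : ∀ l ∈ Finset.range 3, s (refl l n) ≤ B * Real.exp (-(R * k)) := by
        intro l hl
        refine ih _ ?_
        have := norm_mode_refl_le (Finset.mem_range.mp hl) (refl l n)
        rw [refl_refl] at this
        linarith
      have h2 := Finset.sum_le_card_nsmul _ _ _ h1
      rw [Finset.card_range, nsmul_eq_mul] at h2
      have h3 : q * s n ≤ (‖mode n‖ - D) * s n :=
        mul_le_mul_of_nonneg_right (by linarith [(Nat.cast_nonneg k : (0 : ℝ) ≤ k)]) (hs n)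
      have h4 := (h3.trans (h n)).trans (mul_le_mul_of_nonneg_left h2 hc)
      have e : Real.exp (-(R * k : ℝ)) = Real.exp R * Real.exp (-(R * (k + 1 : ℕ) : ℝ)) := by
        rw [← Real.exp_add]; push_cast; ring_nf
      refine le_of_mul_le_mul_left (h4.trans ?_) hq0
      rw [e, hq]
      have : 0 ≤ B * Real.exp (-(R * (k + 1 : ℕ) : ℝ)) := by positivity
      push_cast at this ⊢
      linarith
  refine ⟨B * Real.exp (R * (|D + q| + 1)), fun n => ?_⟩
  rw [mul_assoc, ← Real.exp_add]
  rcases lt_or_ge ‖mode n‖ (D + q) with hlt | hge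
  · refine (hB n).trans (le_mul_of_one_le_right hB0 (Real.one_le_exp ?_))
    have : ‖mode n‖ ≤ |D + q| := hlt.le.trans (le_abs_self _)
    nlinarith [(Nat.cast_nonneg R : (0 : ℝ) ≤ R)]
  · have h1 := Nat.floor_le (sub_nonneg.mpr hge)
    have h2 := Nat.lt_floor_add_one (‖mode n‖ - (D + q))
    refine (claim ⌊‖mode n‖ - (D + q)⌋₊ n (by linarith)).trans ?_
    refine mul_le_mul_of_nonneg_left (Real.exp_le_exp.mpr ?_) hB0
    have h3 : ‖mode n‖ ≤ |D + q| + 1 + (⌊‖mode n‖ - (D + q)⌋₊ : ℝ) := by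
      linarith [le_abs_self (D + q)]
    have := mul_le_mul_of_nonneg_left h3 (Nat.cast_nonneg R : (0 : ℝ) ≤ R)
    linarith

/-- The pairing `⟨·, p⟩` as a real-linear functional. -/
def pairL (p : ℂ) : ℂ →L[ℝ] ℝ :=
  Complex.reCLM.comp ((ContinuousLinearMap.mul ℝ ℂ).flip ((starRingEnd ℂ) p))

lemma pairL_apply (p z : ℂ) : pairL p z = pair z p := by simp [pairL, pair, mul_comm]

lemma pair_eq (z p : ℂ) : pair z p = z.re * p.re + z.im * p.im := by
  simp [pair]

lemma norm_pairL_le (p : ℂ) : ‖pairL p‖ ≤ ‖p‖ := by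
  refine ContinuousLinearMap.opNorm_le_bound _ (norm_nonneg _) fun z => ?_
  rw [pairL_apply, pair, Real.norm_eq_abs]
  refine (abs_re_le_norm _).trans ?_
  rw [norm_mul, RCLike.norm_conj, mul_comm]

/-- The plane wave with momentum `4π/3 · p`. -/
def wave (p z : ℂ) : ℂ := Complex.exp (4 * Real.pi / 3 * Complex.I * (pair z p : ℂ))

lemma wave_add (p q z : ℂ) : wave (p + q) z = wave p z * wave q z := by
  simp only [wave, ← Complex.exp_add, pair_eq, add_re, add_im]
  congr 1; push_cast; ring

lemma wave_add_right (p z w : ℂ) : wave p (z + w) = wave p z * wave p w := by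
  simp only [wave, ← Complex.exp_add, pair_eq, add_re, add_im]
  congr 1; push_cast; ring

lemma wave_neg_right (p z : ℂ) : wave p (-z) = wave (-p) z := by
  simp only [wave, pair_eq, neg_re, neg_im]
  congr 1; push_cast; ring

lemma wave_zero (z : ℂ) : wave 0 z = 1 := by simp [wave, pair_eq]

lemma wave_eq_ofReal_mul_I (p z : ℂ) :
    wave p z = Complex.exp (((4 * Real.pi / 3 * pair z p : ℝ) : ℂ) * Complex.I) := by
  rw [wave]; congr 1; push_cast; ring

lemma norm_wave (p z : ℂ) : ‖wave p z‖ = 1 := by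
  rw [wave_eq_ofReal_mul_I, norm_exp_ofReal_mul_I]

lemma iteratedDeriv_exp_mul_I (k : ℕ) :
    iteratedDeriv k (fun t : ℝ => Complex.exp (t * I)) = fun t : ℝ => I ^ k * Complex.exp (t * I) := by
  induction k with
  | zero => simp
  | succ k ih =>
    rw [iteratedDeriv_succ, ih]
    funext t
    have : HasDerivAt (fun t : ℝ => I ^ k * Complex.exp (t * I))
        (I ^ k * (Complex.exp (t * I) * ((1 : ℂ) * I))) t :=
      ((((hasDerivAt_id t).ofReal_comp).mul_const I).cexp).const_mul _
    rw [this.deriv]; ring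

lemma contDiff_exp_mul_I : ContDiff ℝ (⊤ : ℕ∞) (fun t : ℝ => Complex.exp (t * I)) :=
  (Complex.ofRealCLM.contDiff.mul contDiff_const).cexp

lemma wave_eq_comp (p : ℂ) :
    wave p = (fun t : ℝ => Complex.exp (t * I)) ∘ ((4 * Real.pi / 3 : ℝ) • pairL p) := by
  funext z
  rw [wave_eq_ofReal_mul_I]
  simp [pairL_apply]

lemma contDiff_wave (p : ℂ) : ContDiff ℝ (⊤ : ℕ∞) (wave p) := by
  rw [wave_eq_comp]
  exact contDiff_exp_mul_I.comp (ContinuousLinearMap.contDiff _)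

lemma norm_iteratedFDeriv_wave_le (p : ℂ) (k : ℕ) (z : ℂ) :
    ‖iteratedFDeriv ℝ k (wave p) z‖ ≤ (4 * Real.pi / 3 * ‖p‖) ^ k := by
  rw [wave_eq_comp, ContinuousLinearMap.iteratedFDeriv_comp_right _ contDiff_exp_mul_I _
    (by exact_mod_cast le_top)]
  refine (ContinuousMultilinearMap.norm_compContinuousLinearMap_le _ _).trans ?_
  rw [norm_iteratedFDeriv_eq_norm_iteratedDeriv, iteratedDeriv_exp_mul_I]
  simp only [norm_mul, norm_pow, norm_I, one_pow, norm_exp_ofReal_mul_I, one_mul,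
    Finset.prod_const, Finset.card_univ, Fintype.card_fin]
  refine pow_le_pow_left₀ (norm_nonneg _) ?_ k
  rw [norm_smul, Real.norm_eq_abs, abs_of_pos (by positivity)]
  exact mul_le_mul_of_nonneg_left (norm_pairL_le p) (by positivity)

lemma fderiv_wave (p z v : ℂ) :
    fderiv ℝ (wave p) z v = 4 * Real.pi / 3 * I * (pair v p : ℂ) * wave p z := by
  have h : HasFDerivAt (fun z => ((4 * Real.pi / 3 * I : ℂ)) * (pair z p : ℂ))
      ((4 * Real.pi / 3 * I : ℂ) • (Complex.ofRealCLM.comp (pairL p))) z := by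
    have := ((Complex.ofRealCLM.comp (pairL p)).hasFDerivAt (x := z)).const_mul
      (4 * Real.pi / 3 * I : ℂ)
    refine this.congr_of_eventuallyEq (Filter.Eventually.of_forall fun w => ?_)
    simp [pairL_apply]
  have h2 := h.cexp
  have h3 : HasFDerivAt (wave p) _ z := h2
  rw [h3.fderiv]
  simp [pairL_apply, wave]
  ring

lemma Dbar_wave (p z : ℂ) : Dbar (wave p) z = 4 * Real.pi / 3 * p * wave p z := by
  rw [Dbar, fderiv_wave, fderiv_wave]
  simp only [pair_eq, one_re, one_im, I_re, I_im]
  have hp : p = p.re + p.im * I := (re_add_im p).symm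
  have hI : (1 : ℂ) / I = -I := by simp
  rw [hI]
  push_cast
  generalize wave p z = w
  conv_rhs => rw [hp]
  have := I_sq
  linear_combination (-(4 * Real.pi / 3) * p.re * w -
    (4 * Real.pi / 3) * p.im * w * I) * this

/-- Superexponential decay of Fourier coefficients. -/
def RapidDecay (a : ℤ × ℤ → ℂ) : Prop :=
  ∀ R : ℕ, ∃ C, ∀ n, ‖a n‖ ≤ C * Real.exp (-(R * ‖mode n‖))

lemma RapidDecay.summable_exp {a : ℤ × ℤ → ℂ} (ha : RapidDecay a) (R : ℕ) :
    Summable fun n => ‖a n‖ * Real.exp (R * ‖mode n‖) := by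
  obtain ⟨C, hC⟩ := ha (R + 1)
  refine Summable.of_nonneg_of_le (fun n => by positivity) (fun n => ?_)
    ((summable_norm_mode_inv_pow le_rfl).mul_left (C * 6))
  have hm := norm_mode_pos n
  have h1 := Real.pow_div_factorial_le_exp ‖mode n‖ hm.le 3
  have hC0 : 0 ≤ C := by
    have := (norm_nonneg _).trans (hC 0)
    exact nonneg_of_mul_nonneg_left this (Real.exp_pos _)
  calc ‖a n‖ * Real.exp (R * ‖mode n‖)
      ≤ C * Real.exp (-((R + 1 : ℕ) * ‖mode n‖)) * Real.exp (R * ‖mode n‖) :=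
        mul_le_mul_of_nonneg_right (hC n) (Real.exp_pos _).le
    _ = C * (Real.exp ‖mode n‖)⁻¹ := by
        rw [mul_assoc, ← Real.exp_add, ← Real.exp_neg]; push_cast; ring_nf
    _ ≤ C * (6 * (‖mode n‖ ^ 3)⁻¹) := by
        refine mul_le_mul_of_nonneg_left ?_ hC0
        rw [← div_eq_mul_inv, inv_le_comm₀ (Real.exp_pos _) (by positivity), inv_div]
        simpa [Nat.factorial] using h1
    _ = _ := by ring

lemma RapidDecay.summable_pow {a : ℤ × ℤ → ℂ} (ha : RapidDecay a) (k : ℕ) :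
    Summable fun n => ‖a n‖ * ‖mode n‖ ^ k := by
  refine Summable.of_nonneg_of_le (fun n => by positivity) (fun n => ?_)
    ((ha.summable_exp 1).mul_left (k.factorial : ℝ))
  have h1 := Real.pow_div_factorial_le_exp ‖mode n‖ (norm_nonneg _) k
  rw [div_le_iff₀ (by positivity)] at h1
  calc ‖a n‖ * ‖mode n‖ ^ k ≤ ‖a n‖ * (Real.exp ‖mode n‖ * k.factorial) :=
        mul_le_mul_of_nonneg_left h1 (norm_nonneg _)
    _ = _ := by push_cast; ring_nf

lemma RapidDecay.summable {a : ℤ × ℤ → ℂ} (ha : RapidDecay a) : Summable fun n => ‖a n‖ := by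
  simpa using ha.summable_pow 0

/-- The Fourier series with momenta `p` and coefficients `a`. -/
def waveSum (p a : ℤ × ℤ → ℂ) (z : ℂ) : ℂ := ∑' n, a n * wave (p n) z

lemma summable_mul_wave {p a : ℤ × ℤ → ℂ} (ha : Summable fun n => ‖a n‖) (z : ℂ) :
    Summable fun n => a n * wave (p n) z := by
  refine Summable.of_norm ?_
  simpa [norm_mul, norm_wave] using ha

lemma contDiff_waveSum {p a : ℤ × ℤ → ℂ} (hp : ∀ n, ‖p n‖ = ‖mode n‖) (ha : RapidDecay a) :
    ContDiff ℝ (⊤ : ℕ∞) (waveSum p a) := by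
  refine contDiff_tsum (v := fun k n => (4 * Real.pi / 3) ^ k * (‖a n‖ * ‖mode n‖ ^ k)) (fun n => ?_)
    (fun k _ => (ha.summable_pow k).mul_left _) (fun k n z _ => ?_)
  · exact contDiff_const.mul (contDiff_wave _)
  · have e : iteratedFDeriv ℝ k (fun z => a n * wave (p n) z) z =
        a n • iteratedFDeriv ℝ k (wave (p n)) z :=
      iteratedFDeriv_const_smul_apply (a := a n) (f := wave (p n))
        ((contDiff_wave (p n)).contDiffAt.of_le (by exact_mod_cast le_top))
    rw [e, norm_smul]
    calc _ ≤ ‖a n‖ * (4 * Real.pi / 3 * ‖p n‖) ^ k :=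
          mul_le_mul_of_nonneg_left (norm_iteratedFDeriv_wave_le _ _ _) (norm_nonneg _)
      _ = _ := by rw [hp, mul_pow]; ring

lemma Dbar_waveSum {p a : ℤ × ℤ → ℂ} (hp : ∀ n, ‖p n‖ = ‖mode n‖) (ha : RapidDecay a) (z : ℂ) :
    Dbar (waveSum p a) z = 4 * Real.pi / 3 * ∑' n, p n * a n * wave (p n) z := by
  have hd : ∀ n, Differentiable ℝ (fun z => a n * wave (p n) z) := fun n =>
    (contDiff_const.mul (contDiff_wave (p n))).differentiable (by simp)
  have hf : ∀ n z v, fderiv ℝ (fun z => a n * wave (p n) z) z v =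
      a n * fderiv ℝ (wave (p n)) z v := by
    intro n z v
    rw [fderiv_const_mul ((contDiff_wave (p n)).differentiable (by simp) z)]
    simp
  have hfn : ∀ n z, ‖fderiv ℝ (fun z => a n * wave (p n) z) z‖ ≤
      4 * Real.pi / 3 * (‖a n‖ * ‖mode n‖ ^ 1) := by
    intro n z
    refine ContinuousLinearMap.opNorm_le_bound _ (by positivity) fun v => ?_
    rw [hf, fderiv_wave, norm_mul, norm_mul, norm_mul, norm_mul, norm_wave, norm_I, norm_real,
      Real.norm_eq_abs]
    have h1 : |pair v (p n)| ≤ ‖mode n‖ * ‖v‖ := by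
      rw [← hp, ← pairL_apply, ← Real.norm_eq_abs]
      exact (ContinuousLinearMap.le_opNorm _ _).trans
        (mul_le_mul_of_nonneg_right (norm_pairL_le _) (norm_nonneg _))
    have h2 : ‖(4 * Real.pi / 3 : ℂ)‖ = 4 * Real.pi / 3 := by
      rw [show (4 * Real.pi / 3 : ℂ) = ((4 * Real.pi / 3 : ℝ) : ℂ) by push_cast; ring, norm_real,
        Real.norm_eq_abs, abs_of_pos (by positivity)]
    rw [h2]
    calc _ = 4 * Real.pi / 3 * ‖a n‖ * |pair v (p n)| := by ring
      _ ≤ 4 * Real.pi / 3 * ‖a n‖ * (‖mode n‖ * ‖v‖) :=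
          mul_le_mul_of_nonneg_left h1 (by positivity)
      _ = _ := by ring
  have hu := (ha.summable_pow 1).mul_left (4 * Real.pi / 3)
  have h := hasFDerivAt_tsum hu (fun n z => (hd n z).hasFDerivAt) hfn
    (summable_mul_wave (p := p) ha.summable 0) z
  have hs : Summable fun n => fderiv ℝ (fun z => a n * wave (p n) z) z :=
    Summable.of_norm_bounded hu fun n => hfn n z
  have h' : HasFDerivAt (waveSum p a) _ z := h
  have hv : ∀ v, fderiv ℝ (waveSum p a) z v = ∑' n, a n * fderiv ℝ (wave (p n)) z v := by
    intro v
    rw [h'.fderiv]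
    have := (ContinuousLinearMap.apply ℝ ℂ v).map_tsum hs
    simp only [ContinuousLinearMap.apply_apply, hf] at this
    exact this
  have hsv : ∀ v, Summable fun n => a n * fderiv ℝ (wave (p n)) z v := by
    intro v
    have := (ContinuousLinearMap.apply ℝ ℂ v).summable hs
    simpa only [ContinuousLinearMap.apply_apply, hf, Function.comp_def] using this
  rw [Dbar, hv, hv, ← tsum_mul_left, ← (hsv 1).tsum_add ((hsv I).mul_left I), ← tsum_mul_left,
    ← tsum_mul_left]
  refine tsum_congr fun n => ?_
  have := Dbar_wave (p n) z
  rw [Dbar] at this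
  linear_combination a n * this

/-! ### Uniqueness of Fourier coefficients -/

/-- The character `x ↦ exp(2πinx)`. -/
def expZ (n : ℤ) (x : ℝ) : ℂ := Complex.exp (2 * Real.pi * I * n * x)

lemma norm_expZ (n : ℤ) (x : ℝ) : ‖expZ n x‖ = 1 := by
  rw [expZ, show (2 * Real.pi * I * n * x : ℂ) = ((2 * Real.pi * n * x : ℝ) : ℂ) * I by
    push_cast; ring, norm_exp_ofReal_mul_I]

lemma continuous_expZ (n : ℤ) : Continuous (expZ n) := by unfold expZ; fun_prop

lemma expZ_add (m n : ℤ) (x : ℝ) : expZ (m + n) x = expZ m x * expZ n x := by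
  rw [expZ, expZ, expZ, ← Complex.exp_add]; congr 1; push_cast; ring

lemma expZ_one (n : ℤ) : expZ n 1 = 1 := by
  rw [expZ, ← Complex.exp_int_mul_two_pi_mul_I n]; congr 1; push_cast; ring

lemma integral_expZ (n : ℤ) : ∫ x in (0 : ℝ)..1, expZ n x = if n = 0 then 1 else 0 := by
  split_ifs with h
  · simp [h, expZ]
  · have hc : (2 * Real.pi * I * n : ℂ) ≠ 0 := by
      simp [Real.pi_ne_zero, h]
    have := integral_exp_mul_complex (a := 0) (b := 1) hc
    simp only [expZ]
    rw [this]
    have h1 := expZ_one n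
    simp only [expZ] at h1
    rw [h1]; simp

/-- Absolutely convergent Fourier series determine their coefficients. -/
lemma eq_zero_of_tsum_expZ_eq_zero {c : ℤ → ℂ} (hc : Summable fun n => ‖c n‖)
    (h : ∀ x : ℝ, ∑' n, c n * expZ n x = 0) : c = 0 := by
  funext m
  have hs := intervalIntegral.hasSum_integral_of_dominated_convergence (a := 0) (b := 1)
    (μ := volume) (F := fun (n : ℤ) x => c n * expZ (n - m) x) (f := fun _ => 0)
    (bound := fun n _ => ‖c n‖)
    (fun n => (continuous_const.mul (continuous_expZ _)).aestronglyMeasurable)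
    (fun n => Filter.Eventually.of_forall fun x _ => by rw [norm_mul, norm_expZ, mul_one])
    (Filter.Eventually.of_forall fun x _ => hc) (by simp)
    (Filter.Eventually.of_forall fun x _ => ?_)
  · simp only [intervalIntegral.integral_const_mul, integral_expZ, intervalIntegral.integral_zero]
      at hs
    have h2 := hasSum_single (f := fun n => c n * if n - m = 0 then (1 : ℂ) else 0) m
      (fun n hn => by simp [sub_ne_zero.mpr hn])
    have := hs.unique h2
    simpa using this.symm
  · have hsum : Summable fun n => c n * expZ n x :=
      Summable.of_norm (by simpa [norm_mul, norm_expZ] using hc)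
    have h3 := hsum.hasSum.mul_right (expZ (-m) x)
    rw [h x, zero_mul] at h3
    simpa only [sub_eq_add_neg, expZ_add, mul_assoc] using h3

/-- A continuous periodic function with vanishing Fourier coefficients vanishes. -/
lemma eq_zero_of_integral_expZ_eq_zero {f : ℝ → ℂ} (hf : Continuous f)
    (hp : Function.Periodic f 1)
    (h : ∀ n : ℤ, ∫ x in (0 : ℝ)..1, f x * expZ n x = 0) : f = 0 := by
  have : Fact ((0 : ℝ) < 1) := ⟨one_pos⟩
  let F : C(AddCircle (1 : ℝ), ℂ) := ⟨hp.lift, by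
    refine continuous_coinduced_dom.mpr ?_
    exact hf⟩
  have hF : ∀ x : ℝ, F x = f x := fun x => hp.lift_coe x
  have hc : ∀ n, fourierCoeff F n = 0 := by
    intro n
    rw [fourierCoeff_eq_intervalIntegral F n 0]
    have e : ∀ x : ℝ, fourier (-n) (x : AddCircle (1 : ℝ)) • F x = f x * expZ (-n) x := by
      intro x
      rw [hF, fourier_coe_apply, smul_eq_mul, mul_comm, expZ]
      congr 2; push_cast; ring
    simp_rw [e, zero_add, h]
    simp
  have hs := has_pointwise_sum_fourier_series_of_summable (f := F)
    (by rw [show fourierCoeff F = 0 from funext hc]; exact summable_zero)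
  funext x
  have := hs x
  simp only [hc, zero_smul] at this
  rw [← hF]
  exact this.unique hasSum_zero

lemma wave_ne_zero (p z : ℂ) : wave p z ≠ 0 := Complex.exp_ne_zero _

lemma wave_mode (n : ℤ × ℤ) (x y : ℝ) :
    wave (mode n) (x + y * ω) = wave (-1) (x + y * ω) * (expZ n.1 y * expZ (-n.2) x) := by
  have h3 : (√3 : ℝ) * √3 = 3 := Real.mul_self_sqrt (by norm_num)
  simp only [wave, expZ, ← Complex.exp_add, pair_eq]
  congr 1
  simp only [mode, add_re, add_im, mul_re, mul_im, omega_re, omega_im, ofReal_re, ofReal_im,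
    neg_re, neg_im, one_re, one_im, intCast_re, intCast_im]
  have h3' : ((√3 : ℝ) : ℂ) * ((√3 : ℝ) : ℂ) = 3 := by exact_mod_cast h3
  push_cast
  linear_combination (4 * Real.pi / 3 * I * y / 4 * (2 * n.1 - n.2)) * h3'

/-- The Fourier series over the momentum lattice is injective. -/
lemma eq_zero_of_waveSum_mode_eq_zero {a : ℤ × ℤ → ℂ} (ha : Summable fun n => ‖a n‖)
    (h : ∀ z, waveSum mode a z = 0) : a = 0 := by
  have h1 : ∀ x y : ℝ, ∑' n : ℤ × ℤ, a n * (expZ n.1 y * expZ (-n.2) x) = 0 := by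
    intro x y
    have := h (x + y * ω)
    simp only [waveSum, wave_mode] at this
    have e : ∀ n : ℤ × ℤ, a n * (wave (-1) (x + y * ω) * (expZ n.1 y * expZ (-n.2) x)) =
        wave (-1) (x + y * ω) * (a n * (expZ n.1 y * expZ (-n.2) x)) := fun n => by ring
    simp_rw [e] at this
    rw [tsum_mul_left] at this
    refine (mul_eq_zero.mp this).resolve_left ?_
    exact wave_ne_zero _ _
  let e : ℤ × ℤ ≃ ℤ × ℤ := (Equiv.prodComm ℤ ℤ).trans (Equiv.prodCongr (Equiv.refl _) (Equiv.neg _))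
  have he : ∀ q p, e (q, p) = (p, -q) := fun q p => rfl
  have hsum : Summable fun n : ℤ × ℤ => ‖a (e n)‖ := e.summable_iff.mpr ha
  have hrow : ∀ q, Summable fun p => ‖a (p, -q)‖ := fun q => hsum.prod_factor q
  have h2 : ∀ y : ℝ, (fun q : ℤ => ∑' p : ℤ, a (p, -q) * expZ p y) = 0 := by
    intro y
    refine eq_zero_of_tsum_expZ_eq_zero ?_ fun x => ?_
    · refine Summable.of_nonneg_of_le (fun q => norm_nonneg _) (fun q => ?_) hsum.prod
      refine (norm_tsum_le_tsum_norm ?_).trans_eq ?_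
      · simpa [norm_mul, norm_expZ] using hrow q
      · simp [norm_expZ, he]
    · have h3 := h1 x y
      rw [← e.tsum_eq] at h3
      rw [Summable.tsum_prod] at h3
      · rw [← h3]
        refine tsum_congr fun q => ?_
        rw [← tsum_mul_right]
        refine tsum_congr fun p => ?_
        simp only [he, neg_neg]; ring
      · refine Summable.of_norm ?_
        simpa [norm_mul, norm_expZ] using hsum
  funext n
  have h3 : (fun p : ℤ => a (p, - -n.2)) = 0 :=
    eq_zero_of_tsum_expZ_eq_zero (hrow (-n.2)) fun y => congrFun (h2 y) (-n.2)
  simpa using congrFun h3 n.1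

/-! ### Unique continuation -/

lemma waveSum_line_differentiable {a : ℤ × ℤ → ℂ} (ha : RapidDecay a) (z v : ℂ) :
    Differentiable ℂ fun ζ : ℂ => ∑' n, a n * wave (mode n) z *
      Complex.exp (4 * Real.pi / 3 * I * (pair v (mode n) : ℂ) * ζ) := by
  intro ζ₀
  obtain ⟨N, hN⟩ := exists_nat_ge (4 * Real.pi / 3 * ‖v‖ * (‖ζ₀‖ + 1))
  have h := differentiableOn_tsum_of_summable_norm (U := Metric.ball (0 : ℂ) (‖ζ₀‖ + 1))
    (F := fun n ζ => a n * wave (mode n) z *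
      Complex.exp (4 * Real.pi / 3 * I * (pair v (mode n) : ℂ) * ζ))
    (ha.summable_exp N) (fun n => by fun_prop) Metric.isOpen_ball (fun n ζ hζ => ?_)
  · exact h.differentiableAt (Metric.isOpen_ball.mem_nhds (by simp))
  · rw [norm_mul, norm_mul, norm_wave, mul_one, norm_exp]
    refine mul_le_mul_of_nonneg_left (Real.exp_le_exp.mpr ?_) (norm_nonneg _)
    refine (re_le_norm _).trans ?_
    have h1 : |pair v (mode n)| ≤ ‖mode n‖ * ‖v‖ := by
      rw [← pairL_apply, ← Real.norm_eq_abs]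
      exact (ContinuousLinearMap.le_opNorm _ _).trans
        (mul_le_mul_of_nonneg_right (norm_pairL_le _) (norm_nonneg _))
    have h2 : ‖ζ‖ ≤ ‖ζ₀‖ + 1 := (mem_ball_zero_iff.mp hζ).le
    have h3 : ‖(4 * Real.pi / 3 : ℂ)‖ = 4 * Real.pi / 3 := by
      rw [show (4 * Real.pi / 3 : ℂ) = ((4 * Real.pi / 3 : ℝ) : ℂ) by push_cast; ring, norm_real,
        Real.norm_eq_abs, abs_of_pos (by positivity)]
    rw [norm_mul, norm_mul, norm_mul, h3, norm_I, norm_real, Real.norm_eq_abs]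
    calc _ ≤ 4 * Real.pi / 3 * 1 * (‖mode n‖ * ‖v‖) * (‖ζ₀‖ + 1) := by gcongr
      _ = 4 * Real.pi / 3 * ‖v‖ * (‖ζ₀‖ + 1) * ‖mode n‖ := by ring
      _ ≤ _ := by gcongr

/-- If a continuous function annihilates a nontrivial rapidly decaying Fourier series, it
vanishes. -/
lemma eq_zero_of_mul_waveSum_eq_zero {a : ℤ × ℤ → ℂ} (ha : RapidDecay a) (ha0 : a ≠ 0)
    {G : ℂ → ℂ} (hG : Continuous G) (h : ∀ z, G z * waveSum mode a z = 0) : G = 0 := by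
  funext z
  by_contra hz
  refine ha0 (eq_zero_of_waveSum_mode_eq_zero ha.summable fun w => ?_)
  have hnear : ∀ᶠ y in nhds z, waveSum mode a y = 0 := by
    filter_upwards [hG.continuousAt.eventually_ne hz] with y hy
    exact (mul_eq_zero.mp (h y)).resolve_left hy
  set v := w - z
  have hd := waveSum_line_differentiable ha z v
  set F : ℂ → ℂ := fun ζ => ∑' n, a n * wave (mode n) z *
    Complex.exp (4 * Real.pi / 3 * I * (pair v (mode n) : ℂ) * ζ)
  have hF : ∀ t : ℝ, F t = waveSum mode a (z + t * v) := by
    intro t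
    refine tsum_congr fun n => ?_
    rw [wave_add_right, mul_assoc]
    congr 2
    rw [wave]; congr 1
    simp only [pair_eq, re_ofReal_mul, im_ofReal_mul]
    push_cast; ring
  have hev : ∀ᶠ t : ℝ in nhds 0, F t = 0 := by
    have : Filter.Tendsto (fun t : ℝ => z + t * v) (nhds 0) (nhds z) := by
      have hc : Continuous fun t : ℝ => z + t * v := by fun_prop
      simpa using hc.tendsto 0
    filter_upwards [this.eventually hnear] with t ht
    rw [hF, ht]
  have hfreq : ∃ᶠ ζ : ℂ in nhdsWithin 0 {0}ᶜ, F ζ = 0 := by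
    have ht : Filter.Tendsto (fun t : ℝ => (t : ℂ)) (nhdsWithin 0 {0}ᶜ) (nhdsWithin 0 {0}ᶜ) := by
      refine tendsto_nhdsWithin_iff.mpr ⟨?_, ?_⟩
      · exact (by simpa using continuous_ofReal.tendsto (0 : ℝ) :
          Filter.Tendsto (fun t : ℝ => (t : ℂ)) (nhds 0) (nhds 0)).mono_left nhdsWithin_le_nhds
      · filter_upwards [self_mem_nhdsWithin] with t ht
        simpa using ht
    exact ht.frequently (hev.filter_mono nhdsWithin_le_nhds).frequently
  have hA : AnalyticOnNhd ℂ F Set.univ := fun ζ _ => hd.analyticAt ζ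
  have := hA.eqOn_zero_of_preconnected_of_frequently_eq_zero isPreconnected_univ
    (Set.mem_univ 0) hfreq (Set.mem_univ 1)
  have h1 := hF 1
  simp only [ofReal_one, one_mul] at h1
  rw [show z + v = w by simp [v]] at h1
  rw [← h1]; exact this

/-! ### From sequences to kernel elements -/

/-- The Fourier coefficients of elements of the kernel with `k = 4π/3 · κ`. -/
structure IsSol (α κ : ℂ) (a b : ℤ × ℤ → ℂ) : Prop where
  bounded : ∃ C, ∀ n, ‖a n‖ ≤ C ∧ ‖b n‖ ≤ C
  eq_fst : ∀ n, (mode n + κ) * a n = I * α * ∑ l ∈ Finset.range 3, ω ^ l * b (refl l n)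
  eq_snd : ∀ n, (-mode n + κ) * b n = I * α * ∑ l ∈ Finset.range 3, ω ^ l * a (refl l n)

lemma IsSol.norm_le {α κ : ℂ} {a b : ℤ × ℤ → ℂ} (h : IsSol α κ a b) (n : ℤ × ℤ) :
    (‖mode n‖ - ‖κ‖) * (‖a n‖ + ‖b n‖) ≤
      ‖α‖ * ∑ l ∈ Finset.range 3, (‖a (refl l n)‖ + ‖b (refl l n)‖) := by
  have key : ∀ (m : ℂ) (x : ℂ) (f : ℕ → ℂ), ‖m‖ = ‖mode n‖ →
      (m + κ) * x = I * α * ∑ l ∈ Finset.range 3, ω ^ l * f l →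
      (‖mode n‖ - ‖κ‖) * ‖x‖ ≤ ‖α‖ * ∑ l ∈ Finset.range 3, ‖f l‖ := by
    intro m x f hm e
    calc (‖mode n‖ - ‖κ‖) * ‖x‖ ≤ ‖m + κ‖ * ‖x‖ := by
          refine mul_le_mul_of_nonneg_right ?_ (norm_nonneg _)
          rw [← hm]
          simpa using norm_sub_norm_le m (-κ)
      _ = ‖α‖ * ‖∑ l ∈ Finset.range 3, ω ^ l * f l‖ := by
          rw [← norm_mul, e, norm_mul, norm_mul, norm_I, one_mul]
      _ ≤ _ := by
          refine mul_le_mul_of_nonneg_left ((norm_sum_le _ _).trans_eq ?_) (norm_nonneg _)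
          exact Finset.sum_congr rfl fun l _ => by rw [norm_mul, norm_omega_pow, one_mul]
  have h1 := key _ _ _ rfl (h.eq_fst n)
  have h2 := key _ _ _ (norm_neg _) (h.eq_snd n)
  rw [Finset.sum_add_distrib]
  linarith

lemma IsSol.rapidDecay {α κ : ℂ} {a b : ℤ × ℤ → ℂ} (h : IsSol α κ a b) :
    RapidDecay a ∧ RapidDecay b := by
  obtain ⟨B, hB⟩ := h.bounded
  have key := exists_exp_decay (s := fun n => ‖a n‖ + ‖b n‖) (B := B + B) (D := ‖κ‖) (c := ‖α‖)
    (fun n => by positivity) (fun n => add_le_add (hB n).1 (hB n).2) (norm_nonneg _) h.norm_le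
  constructor
  · intro R
    obtain ⟨C, hC⟩ := key R
    exact ⟨C, fun n => le_trans (le_add_of_nonneg_right (norm_nonneg _)) (hC n)⟩
  · intro R
    obtain ⟨C, hC⟩ := key R
    exact ⟨C, fun n => le_trans (le_add_of_nonneg_left (norm_nonneg _)) (hC n)⟩

/-- The function with given Fourier coefficients. -/
def solFun (a b : ℤ × ℤ → ℂ) (z : ℂ) : ℂ × ℂ := (waveSum mode a z, waveSum (fun n => -mode n) b z)

lemma wave_mul_waveSum_neg {l : ℕ} (hl : l < 3) (b : ℤ × ℤ → ℂ) (z : ℂ) :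
    wave (ω ^ l) z * waveSum (fun n => -mode n) b z =
      ∑' n, b (refl l n) * wave (mode n) z := by
  rw [waveSum, ← tsum_mul_left, ← (reflEquiv l).tsum_eq]
  refine tsum_congr fun n => ?_
  show _ * (b (refl l n) * wave (-mode (refl l n)) z) = _
  rw [mul_left_comm, ← wave_add, mode_refl hl]
  congr 2; ring

lemma wave_mul_waveSum {l : ℕ} (hl : l < 3) (a : ℤ × ℤ → ℂ) (z : ℂ) :
    wave (-ω ^ l) z * waveSum mode a z = ∑' n, a (refl l n) * wave (-mode n) z := by
  rw [waveSum, ← tsum_mul_left, ← (reflEquiv l).tsum_eq]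
  refine tsum_congr fun n => ?_
  show _ * (a (refl l n) * wave (mode (refl l n)) z) = _
  rw [mul_left_comm, ← wave_add, mode_refl hl]
  congr 2; ring

lemma UBM_eq (z : ℂ) :
    UBM z = -(4 * Real.pi / 3) * I * ∑ l ∈ Finset.range 3, ω ^ l * wave (ω ^ l) z := rfl

lemma wave_mode_lattice (n : ℤ × ℤ) (p q : ℤ) :
    wave (mode n) (p * ω + q) = wave (-1) (p * ω + q) := by
  have := wave_mode n q p
  have e : ((q : ℝ) : ℂ) + ((p : ℝ) : ℂ) * ω = p * ω + q := by push_cast; ring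
  rw [e] at this
  rw [this]
  have h1 : ∀ m k : ℤ, expZ m k = 1 := by
    intro m k
    rw [expZ, ← Complex.exp_int_mul_two_pi_mul_I (m * k)]; congr 1; push_cast; ring
  rw [h1, h1]; ring

lemma exp_pair_K (γ : ℂ) : Complex.exp (I * (pair γ K : ℂ)) = wave 1 γ := by
  rw [wave]; congr 1
  have : K = ((4 * Real.pi / 3 : ℝ) : ℂ) := by rw [K]; push_cast; ring
  simp only [this, pair_eq, ofReal_re, ofReal_im, one_re, one_im]
  push_cast; ring

lemma exp_neg_pair_K (γ : ℂ) : Complex.exp (-I * (pair γ K : ℂ)) = wave (-1) γ := by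
  rw [neg_mul, Complex.exp_neg, exp_pair_K]
  refine inv_eq_of_mul_eq_one_left ?_
  rw [← wave_add, neg_add_cancel, wave_zero]

lemma IsSol.inKer {α κ : ℂ} {a b : ℤ × ℤ → ℂ} (h : IsSol α κ a b) :
    InKer UBM (fun z => UBM (-z)) α (4 * Real.pi / 3 * κ) (solFun a b) := by
  obtain ⟨ha, hb⟩ := h.rapidDecay
  have hs : ∀ {c : ℤ × ℤ → ℂ}, RapidDecay c → ∀ l : ℕ, Summable fun n => ‖c (refl l n)‖ :=
    fun hc l => (reflEquiv l).summable_iff.mpr hc.summable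
  have hmode : ∀ {p c : ℤ × ℤ → ℂ}, (∀ n, ‖p n‖ = ‖mode n‖) → RapidDecay c → ∀ z,
      Summable fun n => p n * c n * wave (p n) z := by
    intro p c hp hc z
    refine Summable.of_norm ((hc.summable_pow 1).congr fun n => ?_)
    rw [norm_mul, norm_mul, norm_wave, hp]; ring
  refine ⟨(contDiff_waveSum (fun _ => rfl) ha).prodMk (contDiff_waveSum (fun _ => norm_neg _) hb),
    fun z => ?_, fun z => ?_, ?_, ?_⟩
  · show Dbar (waveSum mode a) z + _ * waveSum mode a z +
      α * UBM z * waveSum (fun n => -mode n) b z = 0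
    have e : UBM z * waveSum (fun n => -mode n) b z = -(4 * Real.pi / 3) * I *
        ∑' n, ∑ l ∈ Finset.range 3, ω ^ l * (b (refl l n) * wave (mode n) z) := by
      rw [UBM_eq, mul_assoc, Finset.sum_mul, Summable.tsum_finsetSum]
      · congr 1
        refine Finset.sum_congr rfl fun l hl => ?_
        rw [mul_assoc, wave_mul_waveSum_neg (Finset.mem_range.mp hl), tsum_mul_left]
      · exact fun l _ => (summable_mul_wave (hs hb l) z).mul_left _
    rw [Dbar_waveSum (fun _ => rfl) ha, mul_assoc α, e, waveSum]
    have e2 : ∀ n, mode n * a n * wave (mode n) z + κ * (a n * wave (mode n) z) =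
        I * α * ∑ l ∈ Finset.range 3, ω ^ l * (b (refl l n) * wave (mode n) z) := by
      intro n
      have := h.eq_fst n
      simp_rw [← mul_assoc (ω ^ _), ← Finset.sum_mul]
      linear_combination wave (mode n) z * this
    have e3 := (hmode (fun _ => rfl) ha z).tsum_add
      ((summable_mul_wave (p := mode) ha.summable z).mul_left κ)
    rw [tsum_congr e2, tsum_mul_left, tsum_mul_left] at e3
    linear_combination -(4 * Real.pi / 3) * e3
  · show Dbar (waveSum (fun n => -mode n) b) z + _ * waveSum (fun n => -mode n) b z +
      α * UBM (-z) * waveSum mode a z = 0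
    have e : UBM (-z) * waveSum mode a z = -(4 * Real.pi / 3) * I *
        ∑' n, ∑ l ∈ Finset.range 3, ω ^ l * (a (refl l n) * wave (-mode n) z) := by
      rw [UBM_eq, mul_assoc, Finset.sum_mul, Summable.tsum_finsetSum]
      · congr 1
        refine Finset.sum_congr rfl fun l hl => ?_
        rw [mul_assoc, wave_neg_right, wave_mul_waveSum (Finset.mem_range.mp hl), tsum_mul_left]
      · exact fun l _ => (summable_mul_wave (p := fun n => -mode n) (hs ha l) z).mul_left _
    rw [Dbar_waveSum (fun _ => norm_neg _) hb, mul_assoc α, e, waveSum]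
    have e2 : ∀ n, -mode n * b n * wave (-mode n) z + κ * (b n * wave (-mode n) z) =
        I * α * ∑ l ∈ Finset.range 3, ω ^ l * (a (refl l n) * wave (-mode n) z) := by
      intro n
      have := h.eq_snd n
      simp_rw [← mul_assoc (ω ^ _), ← Finset.sum_mul]
      linear_combination wave (-mode n) z * this
    have e3 := (hmode (p := fun n => -mode n) (fun _ => norm_neg _) hb z).tsum_add
      ((summable_mul_wave (p := fun n => -mode n) hb.summable z).mul_left κ)
    rw [tsum_congr e2, tsum_mul_left, tsum_mul_left] at e3
    linear_combination -(4 * Real.pi / 3) * e3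
  · rintro γ ⟨p, q, rfl⟩ z
    rw [exp_neg_pair_K]
    show waveSum mode a _ = _ * waveSum mode a z
    rw [waveSum, waveSum, ← tsum_mul_left]
    refine tsum_congr fun n => ?_
    rw [wave_add_right, wave_mode_lattice]; ring
  · rintro γ ⟨p, q, rfl⟩ z
    rw [exp_pair_K]
    show waveSum (fun n => -mode n) b _ = _ * waveSum (fun n => -mode n) b z
    rw [waveSum, waveSum, ← tsum_mul_left]
    refine tsum_congr fun n => ?_
    have : wave (-mode n) (p * ω + q) = wave 1 (p * ω + q) := by
      have h1 := wave_mode_lattice n (-p) (-q)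
      have h2 : ((-p : ℤ) : ℂ) * ω + ((-q : ℤ) : ℂ) = -(p * ω + q) := by push_cast; ring
      rw [h2, wave_neg_right, wave_neg_right, neg_neg] at h1
      exact h1
    rw [wave_add_right, this]; ring

lemma solFun_eq_zero {a b : ℤ × ℤ → ℂ} (ha : RapidDecay a) (h : solFun a b = 0) : a = 0 :=
  eq_zero_of_waveSum_mode_eq_zero ha.summable fun z => congrArg Prod.fst (congrFun h z)

/-! ### Multipliers -/

/-- The momentum shift by a lattice index. -/
def site (t : ℤ × ℤ) : ℂ := mode t + 1

lemma mode_sub (n t : ℤ × ℤ) : mode (n - t) = mode n - site t := by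
  simp [mode, site]; ring

lemma mode_add (n t : ℤ × ℤ) : mode (n + t) = mode n + site t := by
  simp [mode, site]; ring

lemma site_add (s t : ℤ × ℤ) : site (s + t) = site s + site t := by
  rw [site, mode_add, site, site]; ring

/-- The characters of order three of the index lattice. -/
def chi (e : ℤ) (t : ℤ × ℤ) : ℂ := ω ^ (e * (t.1 + t.2))

lemma norm_chi (e : ℤ) (t : ℤ × ℤ) : ‖chi e t‖ = 1 := by
  rw [chi, norm_zpow, norm_omega, one_zpow]

lemma chi_ne_zero (e : ℤ) (t : ℤ × ℤ) : chi e t ≠ 0 := zpow_ne_zero _ omega_ne_zero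

lemma chi_add (e : ℤ) (s t : ℤ × ℤ) : chi e (s + t) = chi e s * chi e t := by
  rw [chi, chi, chi, ← zpow_add₀ omega_ne_zero]; congr 1; simp; ring

lemma chi_neg (e : ℤ) (t : ℤ × ℤ) : chi (-e) t = chi e (-t) := by
  rw [chi, chi]; congr 1; simp; ring

lemma omega_zpow_three_mul (k : ℤ) : ω ^ (3 * k) = 1 := by
  rw [zpow_mul, show (ω ^ (3 : ℤ)) = 1 by exact_mod_cast omega_pow_three, one_zpow]

lemma chi_rot (e : ℤ) (t : ℤ × ℤ) : chi e (rot t) = ω ^ e * chi e t := by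
  have : e * ((rot t).1 + (rot t).2) = e + e * (t.1 + t.2) + 3 * (e * (-t.2 - 1)) := by
    simp [rot]; ring
  rw [chi, this, zpow_add₀ omega_ne_zero, zpow_add₀ omega_ne_zero, omega_zpow_three_mul, mul_one,
    chi]

lemma chi_add_period (e : ℤ) (t : ℤ × ℤ) : chi e (t + (3, 0)) = chi e t := by
  rw [chi_add]
  have : chi e (3, 0) = 1 := by
    rw [chi, show e * ((3 : ℤ) + 0) = 3 * e by ring, omega_zpow_three_mul]
  rw [this, mul_one]

lemma tsum_chi_mul_eq_zero {j : ℕ} {e : ℤ} (he : ω ^ e ≠ ω ^ j) {a : ℤ × ℤ → ℂ}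
    (ha : ∀ n, ω ^ j * a (rot n) = a n) : ∑' n, chi e n * a n = 0 := by
  have h1 : ω ^ j * ∑' n, chi e n * a n = ω ^ e * ∑' n, chi e n * a n := by
    conv_lhs => rw [← rotEquiv.tsum_eq]
    rw [← tsum_mul_left, ← tsum_mul_left]
    refine tsum_congr fun n => ?_
    show ω ^ j * (chi e (rot n) * a (rot n)) = _
    rw [chi_rot, ← ha n]; ring
  have h2 : (ω ^ j - ω ^ e) * ∑' n, chi e n * a n = 0 := by rw [sub_mul, h1, sub_self]
  exact (mul_eq_zero.mp h2).resolve_left (sub_ne_zero.mpr he.symm)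

lemma tsum_chi_mul_sub {j : ℕ} {e : ℤ} (he : ω ^ (-e) ≠ ω ^ j) {a : ℤ × ℤ → ℂ}
    (ha : ∀ n, ω ^ j * a (rot n) = a n) (n : ℤ × ℤ) : ∑' t, chi e t * a (n - t) = 0 := by
  rw [← (Equiv.subLeft n).tsum_eq]
  have := tsum_chi_mul_eq_zero he ha
  calc ∑' t, chi e (n - t) * a (n - (n - t)) = ∑' t, chi e n * (chi (-e) t * a t) := by
        refine tsum_congr fun t => ?_
        rw [sub_sub_cancel, sub_eq_add_neg, chi_add, chi_neg, mul_assoc]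
    _ = 0 := by rw [tsum_mul_left, this, mul_zero]

lemma tsum_chi_mul_add {j : ℕ} {e : ℤ} (he : ω ^ e ≠ ω ^ j) {a : ℤ × ℤ → ℂ}
    (ha : ∀ n, ω ^ j * a (rot n) = a n) (n : ℤ × ℤ) : ∑' t, chi e t * a (n + t) = 0 := by
  rw [← (Equiv.subRight n).tsum_eq]
  have := tsum_chi_mul_eq_zero he ha
  calc ∑' t, chi e (t - n) * a (n + (t - n)) = ∑' t, chi e (-n) * (chi e t * a t) := by
        refine tsum_congr fun t => ?_
        rw [add_sub_cancel, sub_eq_add_neg, chi_add]; ring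
    _ = 0 := by rw [tsum_mul_left, this, mul_zero]

/-- The Fourier multipliers producing solutions at the quasimomentum `κ`. -/
def multipliers (e : ℤ) (κ : ℂ) : Submodule ℂ (ℤ × ℤ → ℂ) where
  carrier := {r | (∃ B, ∀ t, ‖r t‖ ≤ B) ∧
    ∃ c₁ c₂ : ℂ, ∀ t, (site t + κ) * r t = c₁ * chi e t + c₂ * chi (-e) t}
  zero_mem' := ⟨⟨0, by simp⟩, 0, 0, by simp⟩
  add_mem' := by
    rintro r s ⟨⟨B, hB⟩, c₁, c₂, h⟩ ⟨⟨B', hB'⟩, c₁', c₂', h'⟩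
    refine ⟨⟨B + B', fun t => (norm_add_le _ _).trans (add_le_add (hB t) (hB' t))⟩,
      c₁ + c₁', c₂ + c₂', fun t => ?_⟩
    rw [Pi.add_apply]
    linear_combination h t + h' t
  smul_mem' := by
    rintro c r ⟨⟨B, hB⟩, c₁, c₂, h⟩
    refine ⟨⟨‖c‖ * B, fun t => ?_⟩, c * c₁, c * c₂, fun t => ?_⟩
    · rw [Pi.smul_apply, norm_smul]
      exact mul_le_mul_of_nonneg_left (hB t) (norm_nonneg _)
    · rw [Pi.smul_apply, smul_eq_mul]
      linear_combination c * h t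

lemma summable_bounded_mul {r a : ℤ × ℤ → ℂ} (hr : ∃ B, ∀ t, ‖r t‖ ≤ B)
    (ha : Summable fun n => ‖a n‖) : Summable fun t => r t * a t := by
  obtain ⟨B, hB⟩ := hr
  refine Summable.of_norm_bounded (ha.mul_left B) fun t => ?_
  rw [norm_mul]
  exact mul_le_mul_of_nonneg_right (hB t) (norm_nonneg _)

lemma norm_tsum_bounded_mul_le {r a : ℤ × ℤ → ℂ} {B : ℝ} (hB : ∀ t, ‖r t‖ ≤ B)
    (ha : Summable fun n => ‖a n‖) : ‖∑' t, r t * a t‖ ≤ B * ∑' t, ‖a t‖ := by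
  rw [← tsum_mul_left]
  refine tsum_of_norm_bounded (ha.mul_left B).hasSum fun t => ?_
  rw [norm_mul]
  exact mul_le_mul_of_nonneg_right (hB t) (norm_nonneg _)

/-- The convolution acting on the first component. -/
def convFst (r a : ℤ × ℤ → ℂ) (n : ℤ × ℤ) : ℂ := ∑' t, r t * a (n - t)

/-- The convolution acting on the second component. -/
def convSnd (r b : ℤ × ℤ → ℂ) (n : ℤ × ℤ) : ℂ := ∑' t, r t * b (n + t)

lemma summable_norm_sub {a : ℤ × ℤ → ℂ} (ha : Summable fun n => ‖a n‖) (n : ℤ × ℤ) :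
    Summable fun t => ‖a (n - t)‖ := (Equiv.subLeft n).summable_iff.mpr ha

lemma summable_norm_add {a : ℤ × ℤ → ℂ} (ha : Summable fun n => ‖a n‖) (n : ℤ × ℤ) :
    Summable fun t => ‖a (n + t)‖ := (Equiv.addLeft n).summable_iff.mpr ha

lemma isSol_conv {α κ : ℂ} {j : ℕ} {e : ℤ} {a b r : ℤ × ℤ → ℂ} (h : IsSol α 0 a b)
    (ha : ∀ n, ω ^ j * a (rot n) = a n) (hb : ∀ n, ω ^ j * b (rot n) = b n)
    (he : ω ^ e ≠ ω ^ j) (he' : ω ^ (-e) ≠ ω ^ j) (hr : r ∈ multipliers e κ) :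
    IsSol α κ (convFst r a) (convSnd r b) := by
  obtain ⟨hB, c₁, c₂, hr⟩ := hr
  obtain ⟨B, hB'⟩ := id hB
  have hsa := h.rapidDecay.1.summable
  have hsb := h.rapidDecay.2.summable
  have hchi : ∀ e, ∃ B, ∀ t, ‖chi e t‖ ≤ B := fun e => ⟨1, fun t => (norm_chi e t).le⟩
  have he'' : ω ^ (-(-e)) ≠ ω ^ j := by rwa [neg_neg]
  constructor
  · refine ⟨B * ∑' t, ‖a t‖ + B * ∑' t, ‖b t‖, fun n => ⟨?_, ?_⟩⟩
    · have := norm_tsum_bounded_mul_le hB' (summable_norm_sub hsa n)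
      have e := (Equiv.subLeft n).tsum_eq (fun t => ‖a t‖)
      simp only [Equiv.subLeft_apply] at e
      rw [e] at this
      refine this.trans (le_add_of_nonneg_right ?_)
      exact mul_nonneg ((norm_nonneg _).trans (hB' 0)) (tsum_nonneg fun _ => norm_nonneg _)
    · have := norm_tsum_bounded_mul_le hB' (summable_norm_add hsb n)
      have e := (Equiv.addLeft n).tsum_eq (fun t => ‖b t‖)
      simp only [Equiv.coe_addLeft] at e
      rw [e] at this
      refine this.trans (le_add_of_nonneg_left ?_)
      exact mul_nonneg ((norm_nonneg _).trans (hB' 0)) (tsum_nonneg fun _ => norm_nonneg _)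
  · intro n
    have hs : ∀ l ∈ Finset.range 3, Summable fun t => ω ^ l * (r t * b (refl l n + t)) :=
      fun l _ => (summable_bounded_mul hB (summable_norm_add hsb _)).mul_left _
    simp only [convFst, convSnd]
    simp_rw [← tsum_mul_left]
    rw [← Summable.tsum_finsetSum hs, ← tsum_mul_left]
    have e1 : ∀ t, (mode n + κ) * (r t * a (n - t)) =
        I * α * ∑ l ∈ Finset.range 3, ω ^ l * (r t * b (refl l n + t)) +
          (c₁ * (chi e t * a (n - t)) + c₂ * (chi (-e) t * a (n - t))) := by
      intro t
      have h1 := h.eq_fst (n - t)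
      simp only [mode_sub, refl_sub] at h1
      have h2 := hr t
      simp_rw [mul_left_comm (ω ^ _) (r t)]
      rw [← Finset.mul_sum]
      linear_combination r t * h1 + a (n - t) * h2
    simp_rw [e1]
    have s1 := (summable_bounded_mul (hchi e) (summable_norm_sub hsa n)).mul_left c₁
    have s2 := (summable_bounded_mul (hchi (-e)) (summable_norm_sub hsa n)).mul_left c₂
    rw [Summable.tsum_add ((summable_sum hs).mul_left _) (s1.add s2), s1.tsum_add s2,
      tsum_mul_left (a := c₁), tsum_mul_left (a := c₂), tsum_chi_mul_sub he' ha,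
      tsum_chi_mul_sub he'' ha]
    ring
  · intro n
    have hs : ∀ l ∈ Finset.range 3, Summable fun t => ω ^ l * (r t * a (refl l n - t)) :=
      fun l _ => (summable_bounded_mul hB (summable_norm_sub hsa _)).mul_left _
    simp only [convFst, convSnd]
    simp_rw [← tsum_mul_left]
    rw [← Summable.tsum_finsetSum hs, ← tsum_mul_left]
    have e1 : ∀ t, (-mode n + κ) * (r t * b (n + t)) =
        I * α * ∑ l ∈ Finset.range 3, ω ^ l * (r t * a (refl l n - t)) +
          (c₁ * (chi e t * b (n + t)) + c₂ * (chi (-e) t * b (n + t))) := by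
      intro t
      have h1 := h.eq_snd (n + t)
      simp only [mode_add, refl_add] at h1
      have h2 := hr t
      simp_rw [mul_left_comm (ω ^ _) (r t)]
      rw [← Finset.mul_sum]
      linear_combination r t * h1 + b (n + t) * h2
    simp_rw [e1]
    have s1 := (summable_bounded_mul (hchi e) (summable_norm_add hsb n)).mul_left c₁
    have s2 := (summable_bounded_mul (hchi (-e)) (summable_norm_add hsb n)).mul_left c₂
    rw [Summable.tsum_add ((summable_sum hs).mul_left _) (s1.add s2), s1.tsum_add s2,
      tsum_mul_left (a := c₁), tsum_mul_left (a := c₂), tsum_chi_mul_add he hb,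
      tsum_chi_mul_add he' hb]
    ring

/-! ### Injectivity of convolution -/

lemma site_sub (s t : ℤ × ℤ) : site (s - t) = site s - site t := by
  rw [eq_sub_iff_add_eq, ← site_add, sub_add_cancel]

lemma site_zero : site 0 = 0 := by simp [site, mode]

lemma site_injective : Function.Injective site := fun s t h => mode_injective (by
  simpa [site] using h)

lemma site_ne_zero {t : ℤ × ℤ} (ht : t ≠ 0) : site t ≠ 0 := by
  rw [← site_zero]
  exact site_injective.ne ht

lemma waveSum_mul_waveSum {c a : ℤ × ℤ → ℂ} (hc : Summable fun n => ‖c n‖)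
    (ha : Summable fun n => ‖a n‖) (h : ∀ n, convFst c a n = 0) (z : ℂ) :
    waveSum mode c z * waveSum mode a z = 0 := by
  have hn : ∀ {f : ℤ × ℤ → ℂ}, (Summable fun n => ‖f n‖) →
      Summable fun n => ‖f n * wave (mode n) z‖ := by
    intro f hf
    simpa [norm_wave] using hf
  have hs := summable_mul_of_summable_norm (hn hc) (hn ha)
  let E : (ℤ × ℤ) × (ℤ × ℤ) ≃ (ℤ × ℤ) × (ℤ × ℤ) :=
    Equiv.prodShear (Equiv.refl _) fun t => Equiv.subRight t
  have hs' := E.summable_iff.mpr hs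
  have e1 : ∀ x : (ℤ × ℤ) × (ℤ × ℤ), c (E x).1 * wave (mode (E x).1) z *
      (a (E x).2 * wave (mode (E x).2) z) =
      c x.1 * a (x.2 - x.1) * wave (mode x.2 - 1) z := by
    rintro ⟨t, n⟩
    show c t * wave (mode t) z * (a (n - t) * wave (mode (n - t)) z) = _
    rw [mul_mul_mul_comm, ← wave_add, mode_sub, site]
    congr 2; ring
  rw [waveSum, waveSum, tsum_mul_tsum_of_summable_norm (hn hc) (hn ha), ← E.tsum_eq]
  simp only [e1]
  simp only [Function.comp_def, e1] at hs'
  rw [hs'.tsum_prod]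
  simp only
  rw [← Summable.tsum_comm (f := fun t n => c t * a (n - t) * wave (mode n - 1) z) hs']
  refine (tsum_congr fun n => ?_).trans tsum_zero
  rw [tsum_mul_right]
  have := h n
  rw [convFst] at this
  rw [this, zero_mul]

lemma summable_second_difference {r ρ : ℤ × ℤ → ℂ} {B P : ℝ} {κ : ℂ} {h : ℤ × ℤ}
    (hB : ∀ t, ‖r t‖ ≤ B) (hP : ∀ t, ‖ρ t‖ ≤ P) (hρ : ∀ t, ρ (t - h) = ρ t)
    (hr : ∀ t, (site t + κ) * r t = ρ t) :
    Summable fun t => ‖r t - 2 * r (t - h) + r (t - h - h)‖ := by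
  set d := site h with hd
  set R : ℝ := 2 * (1 + ‖κ‖ + 2 * ‖d‖) with hR
  have hR0 : 0 ≤ R := by positivity
  have hB0 : 0 ≤ B := (norm_nonneg _).trans (hB 0)
  have hP0 : 0 ≤ P := (norm_nonneg _).trans (hP 0)
  refine Summable.of_nonneg_of_le (fun _ => norm_nonneg _) (fun t => ?_)
    ((summable_norm_mode_inv_pow le_rfl).mul_left (16 * ‖d‖ ^ 2 * P + 4 * B * R ^ 3))
  have hm := norm_mode_pos t
  rw [← div_eq_mul_inv, le_div_iff₀ (by positivity)]
  set c := r t - 2 * r (t - h) + r (t - h - h) with hc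
  rcases lt_or_ge ‖mode t‖ R with hlt | hge
  · have h1 : ‖c‖ ≤ 4 * B := by
      have := norm_add_le (r t - 2 * r (t - h)) (r (t - h - h))
      have h2 := norm_sub_le (r t) (2 * r (t - h))
      rw [norm_mul, Complex.norm_ofNat] at h2
      linarith [hB t, hB (t - h), hB (t - h - h)]
    calc ‖c‖ * ‖mode t‖ ^ 3 ≤ 4 * B * R ^ 3 := by gcongr
      _ ≤ _ := le_add_of_nonneg_left (by positivity)
  · have h0 := hr t
    have h1 := hr (t - h)
    have h2 := hr (t - h - h)
    rw [hρ, site_sub] at h1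
    rw [hρ, hρ, site_sub, site_sub] at h2
    rw [← hd] at h1 h2
    set X := site t + κ with hX
    have key : X * (X - d) * (X - 2 * d) * c = 2 * d ^ 2 * ρ t := by
      rw [hc]
      linear_combination (X - d) * (X - 2 * d) * h0 - 2 * X * (X - 2 * d) * h1 +
        X * (X - d) * h2
    have hge' : ∀ y : ℂ, ‖y‖ ≤ 2 * ‖d‖ → ‖mode t‖ / 2 ≤ ‖X - y‖ := by
      intro y hy
      have e : mode t = (X - y) + (y - 1 - κ) := by rw [hX, site]; ring
      have i1 := norm_add_le (X - y) (y - 1 - κ)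
      rw [← e] at i1
      have i2 := norm_sub_le (y - 1) κ
      have i3 := norm_sub_le y 1
      rw [norm_one] at i3
      linarith
    have hd0 := norm_nonneg d
    have j0 := hge' 0 (by simp)
    have j1 := hge' d (by linarith)
    have j2 := hge' (2 * d) (by rw [norm_mul, Complex.norm_ofNat])
    rw [sub_zero] at j0
    have key' := congrArg norm key
    rw [norm_mul, norm_mul, norm_mul, norm_mul, norm_mul, norm_pow, Complex.norm_ofNat] at key'
    have : ‖mode t‖ / 2 * (‖mode t‖ / 2) * (‖mode t‖ / 2) * ‖c‖ ≤ 2 * ‖d‖ ^ 2 * P := by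
      calc _ ≤ ‖X‖ * ‖X - d‖ * ‖X - 2 * d‖ * ‖c‖ := by gcongr
        _ = 2 * ‖d‖ ^ 2 * ‖ρ t‖ := key'
        _ ≤ _ := by gcongr; exact hP t
    have h4 : 0 ≤ 4 * B * R ^ 3 := by positivity
    nlinarith

lemma eq_of_second_difference_eq_zero {r : ℤ × ℤ → ℂ} {B : ℝ} {h : ℤ × ℤ}
    (hB : ∀ t, ‖r t‖ ≤ B) (h2 : ∀ t, r t - 2 * r (t - h) + r (t - h - h) = 0) (t : ℤ × ℤ) :
    r (t - h) = r t := by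
  have claim : ∀ (k : ℕ) (t : ℤ × ℤ), r (t - k • h) = r t - k * (r t - r (t - h)) := by
    intro k
    induction k with
    | zero => simp
    | succ k ih =>
      intro t
      have : t - (k + 1) • h = t - h - k • h := by rw [succ_nsmul]; abel
      rw [this, ih]
      push_cast
      linear_combination (k : ℂ) * h2 t
  by_contra hne
  have hpos : 0 < ‖r t - r (t - h)‖ := norm_pos_iff.mpr (sub_ne_zero.mpr (Ne.symm hne))
  obtain ⟨k, hk⟩ := exists_nat_gt (2 * B / ‖r t - r (t - h)‖)
  rw [div_lt_iff₀ hpos] at hk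
  have e : (k : ℂ) * (r t - r (t - h)) = r t - r (t - k • h) := by rw [claim]; ring
  have := congrArg norm e
  rw [norm_mul, Complex.norm_natCast] at this
  have := norm_sub_le (r t) (r (t - k • h))
  linarith [hB t, hB (t - k • h)]

lemma eq_zero_of_convFst_eq_zero {e : ℤ} {κ : ℂ} {r a : ℤ × ℤ → ℂ} (hr : r ∈ multipliers e κ)
    (ha : RapidDecay a) (ha0 : a ≠ 0) (h : convFst r a = 0) : r = 0 := by
  obtain ⟨⟨B, hB⟩, c₁, c₂, hr⟩ := hr
  set p : ℤ × ℤ := (3, 0) with hp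
  set ρ : ℤ × ℤ → ℂ := fun t => c₁ * chi e t + c₂ * chi (-e) t with hρ
  have hper : ∀ t, ρ (t - p) = ρ t := by
    intro t
    have h1 := chi_add_period e (t - p)
    have h2 := chi_add_period (-e) (t - p)
    rw [sub_add_cancel] at h1 h2
    simp only [hρ, h1, h2]
  have hP : ∀ t, ‖ρ t‖ ≤ ‖c₁‖ + ‖c₂‖ := by
    intro t
    refine (norm_add_le _ _).trans ?_
    rw [norm_mul, norm_mul, norm_chi, norm_chi, mul_one, mul_one]
  have hs := summable_second_difference hB hP hper hr
  set c : ℤ × ℤ → ℂ := fun t => r t - 2 * r (t - p) + r (t - p - p) with hc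
  have hconv : ∀ q n : ℤ × ℤ, ∑' t, r (t - q) * a (n - t) = 0 := by
    intro q n
    rw [← (Equiv.addRight q).tsum_eq]
    have := congrFun h (n - q)
    rw [convFst, Pi.zero_apply] at this
    rw [← this]
    refine tsum_congr fun t => ?_
    simp only [Equiv.coe_addRight, add_sub_cancel_right]
    congr 2; abel
  have hsum : ∀ q n : ℤ × ℤ, Summable fun t => r (t - q) * a (n - t) := fun q n =>
    summable_bounded_mul (r := fun t => r (t - q)) ⟨B, fun t => hB _⟩
      (summable_norm_sub ha.summable n)
  have hca : ∀ n, convFst c a n = 0 := by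
    intro n
    have e1 : ∀ t, c t * a (n - t) = r (t - 0) * a (n - t) - 2 * (r (t - p) * a (n - t)) +
        r (t - (p + p)) * a (n - t) := by
      intro t
      rw [hc, sub_zero, ← sub_sub]; ring
    rw [convFst, tsum_congr e1, Summable.tsum_add (((hsum 0 n).sub ((hsum p n).mul_left 2)))
      (hsum _ n), Summable.tsum_sub (hsum 0 n) ((hsum p n).mul_left 2), tsum_mul_left, hconv,
      hconv, hconv]
    simp
  have hc0 : c = 0 := by
    refine eq_zero_of_waveSum_mode_eq_zero hs fun z => ?_
    have hcont : Continuous (waveSum mode c) := by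
      refine continuous_tsum (fun n => continuous_const.mul (contDiff_wave _).continuous) hs
        fun n z => ?_
      rw [norm_mul, norm_wave, mul_one]
    exact congrFun (eq_zero_of_mul_waveSum_eq_zero ha ha0 hcont
      (waveSum_mul_waveSum hs ha.summable hca)) z
  have hper' := eq_of_second_difference_eq_zero (h := p) hB (fun t => congrFun hc0 t)
  funext t
  have h1 := hr t
  have h2 := hr (t - p)
  have h3 := hper t
  simp only [hρ] at h3
  rw [hper', site_sub, h3, ← h1] at h2
  have h4 : site p * r t = 0 := by linear_combination -h2
  exact (mul_eq_zero.mp h4).resolve_left (site_ne_zero (by simp [hp]))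

/-! ### Existence of multipliers -/

lemma finite_norm_mode_le (R : ℝ) : {n | ‖mode n‖ ≤ R}.Finite := by
  refine (Metric.finite_isBounded_inter_isClosed (s := Set.univ) ?_
    (Metric.isBounded_closedBall (x := (0 : ℤ × ℤ)) (r := 4 / 3 * R)) isClosed_univ).subset ?_
  · exact isDiscrete_univ_iff.mpr inferInstance
  · intro n hn
    refine ⟨?_, trivial⟩
    rw [mem_closedBall_zero_iff]
    exact (norm_index_le n).trans (mul_le_mul_of_nonneg_left hn (by norm_num))

lemma exists_norm_inv_site_add_le (κ : ℂ) : ∃ C, ∀ t, ‖(site t + κ)⁻¹‖ ≤ C := by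
  have hf := finite_norm_mode_le (2 + ‖κ‖)
  refine ⟨1 + ∑ t ∈ hf.toFinset, ‖(site t + κ)⁻¹‖, fun t => ?_⟩
  by_cases ht : t ∈ hf.toFinset
  · refine (Finset.single_le_sum (f := fun t => ‖(site t + κ)⁻¹‖)
      (fun _ _ => norm_nonneg _) ht).trans (le_add_of_nonneg_left zero_le_one)
  · simp only [Set.Finite.mem_toFinset, Set.mem_ofPred_eq, not_le] at ht
    refine le_add_of_le_of_nonneg ?_ (Finset.sum_nonneg fun _ _ => norm_nonneg _)
    rw [norm_inv]
    refine inv_le_one_of_one_le₀ ?_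
    have e : mode t = (site t + κ) - 1 - κ := by rw [site]; ring
    have h1 := norm_sub_le ((site t + κ) - 1) κ
    have h2 := norm_sub_le (site t + κ) 1
    rw [← e] at h1
    rw [norm_one] at h2
    linarith

lemma single_mem_multipliers {e : ℤ} {κ : ℂ} {t : ℤ × ℤ} (ht : site t + κ = 0) :
    Pi.single t 1 ∈ multipliers e κ := by
  refine ⟨⟨1, fun s => ?_⟩, 0, 0, fun s => ?_⟩
  · by_cases h : s = t
    · subst h; simp
    · simp [h]
  · by_cases h : s = t
    · subst h; simp [ht]
    · simp [h]

/-- Dividing a combination of characters vanishing at the singular site. -/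
lemma div_mem_multipliers {e : ℤ} {κ c₁ c₂ : ℂ}
    (h : ∀ t, site t + κ = 0 → c₁ * chi e t + c₂ * chi (-e) t = 0) :
    (fun t => (c₁ * chi e t + c₂ * chi (-e) t) * (site t + κ)⁻¹) ∈ multipliers e κ := by
  obtain ⟨C, hC⟩ := exists_norm_inv_site_add_le κ
  refine ⟨⟨(‖c₁‖ + ‖c₂‖) * C, fun t => ?_⟩, c₁, c₂, fun t => ?_⟩
  · rw [norm_mul]
    refine mul_le_mul ?_ (hC t) (norm_nonneg _) (by positivity)
    refine (norm_add_le _ _).trans ?_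
    rw [norm_mul, norm_mul, norm_chi, norm_chi, mul_one, mul_one]
  · by_cases ht : site t + κ = 0
    · rw [h t ht, ht, zero_mul]
    · field_simp

lemma exists_multiplier_ne_zero (e : ℤ) (κ : ℂ) : ∃ r ∈ multipliers e κ, r ≠ 0 := by
  by_cases h : ∃ t, site t + κ = 0
  · obtain ⟨t, ht⟩ := h
    exact ⟨_, single_mem_multipliers ht, by simp⟩
  · push Not at h
    refine ⟨_, div_mem_multipliers (c₁ := 1) (c₂ := 0) fun t ht => (h t ht).elim, fun h0 => ?_⟩
    have := congrFun h0 0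
    simp [chi_ne_zero, h] at this

lemma chi_one_zero_one : chi 1 (1, 0) = ω := by simp [chi]

lemma chi_neg_one_zero_one : chi (-1) (1, 0) = ω⁻¹ := by simp [chi]

lemma omega_sub_inv_ne_zero : ω - ω⁻¹ ≠ 0 := by
  intro h
  have h2 : ω ^ 2 = 1 := by
    field_simp [omega_ne_zero] at h
    linear_combination h
  exact omega_primitive.pow_ne_one_of_pos_of_lt (by norm_num) (by norm_num) h2

lemma exists_multiplier_pair (κ : ℂ) : ∃ r₁ ∈ multipliers 1 κ, ∃ r₂ ∈ multipliers 1 κ,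
    LinearIndependent ℂ ![r₁, r₂] := by
  have hω := omega_sub_inv_ne_zero
  by_cases h : ∃ t, site t + κ = 0
  · obtain ⟨t, ht⟩ := h
    refine ⟨_, single_mem_multipliers ht, _,
      div_mem_multipliers (c₁ := chi (-1) t) (c₂ := -chi 1 t) fun s hs => ?_, ?_⟩
    · have : s = t := site_injective (by linear_combination hs - ht)
      rw [this]; ring
    · rw [LinearIndependent.pair_iff]
      intro x y hxy
      have h1 := congrFun hxy (t + (1, 0))
      have h2 := congrFun hxy t
      have hne : t + (1, 0) ≠ t := by simp
      have hs : site (t + (1, 0)) + κ ≠ 0 := fun h0 => hne (site_injective (by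
        linear_combination h0 - ht))
      simp only [Pi.add_apply, Pi.smul_apply, smul_eq_mul, Pi.single_eq_of_ne hne, chi_add,
        chi_one_zero_one, chi_neg_one_zero_one, Pi.zero_apply] at h1
      have hy : y = 0 := by
        have e : y * (chi 1 t * chi (-1) t * (ω - ω⁻¹) * (site (t + (1, 0)) + κ)⁻¹) = 0 := by
          linear_combination h1
        refine (mul_eq_zero.mp e).resolve_right ?_
        exact mul_ne_zero (mul_ne_zero (mul_ne_zero (chi_ne_zero _ _) (chi_ne_zero _ _)) hω)
          (inv_ne_zero hs)
      refine ⟨?_, hy⟩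
      simpa [hy] using h2
  · push Not at h
    refine ⟨_, div_mem_multipliers (c₁ := 1) (c₂ := 0) fun t ht => (h t ht).elim, _,
      div_mem_multipliers (c₁ := 0) (c₂ := 1) fun t ht => (h t ht).elim, ?_⟩
    rw [LinearIndependent.pair_iff]
    intro x y hxy
    have e0 := congrFun hxy 0
    have e1 := congrFun hxy (1, 0)
    simp only [Pi.add_apply, Pi.smul_apply, smul_eq_mul, chi_one_zero_one, chi_neg_one_zero_one,
      Pi.zero_apply] at e0 e1
    have c0 : ∀ e, chi e 0 = 1 := by simp [chi]
    rw [c0, c0] at e0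
    have f0 : x + y = 0 := by
      have : (x + y) * (site 0 + κ)⁻¹ = 0 := by linear_combination e0
      exact (mul_eq_zero.mp this).resolve_right (inv_ne_zero (h 0))
    have f1 : x * ω + y * ω⁻¹ = 0 := by
      have : (x * ω + y * ω⁻¹) * (site (1, 0) + κ)⁻¹ = 0 := by linear_combination e1
      exact (mul_eq_zero.mp this).resolve_right (inv_ne_zero (h (1, 0)))
    have hx : x = 0 := by
      have : x * (ω - ω⁻¹) = 0 := by linear_combination f1 - ω⁻¹ * f0
      exact (mul_eq_zero.mp this).resolve_right hω
    exact ⟨hx, by simpa [hx] using f0⟩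

/-! ### Solutions from eigenvectors -/

lemma isSol_of_eigenvector {d : ℂ} (hd : d ≠ 0) {a : ℤ × ℤ → ℂ} (hB : ∀ n, ‖a n‖ ≤ 1)
    (h : d • a = Bop a) : IsSol d⁻¹ 0 a (-I • a) := by
  have key : ∀ n, mode n * a n = d⁻¹ * ∑ l ∈ Finset.range 3, ω ^ l * a (refl l n) := by
    intro n
    have h1 := congrFun h n
    rw [Bop_apply, Pi.smul_apply, smul_eq_mul] at h1
    have := mode_ne_zero n
    field_simp at h1 ⊢
    linear_combination h1
  refine ⟨⟨1, fun n => ⟨hB n, by simpa [norm_smul] using hB n⟩⟩, fun n => ?_, fun n => ?_⟩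
  · simp only [Pi.smul_apply, smul_eq_mul, mul_left_comm _ (-I), ← Finset.mul_sum]
    linear_combination key n + (d⁻¹ * ∑ l ∈ Finset.range 3, ω ^ l * a (refl l n)) * I_mul_I
  · simp only [Pi.smul_apply, smul_eq_mul]
    linear_combination I * key n

lemma wave_omega_mul (p z : ℂ) : wave (ω * p) (ω * z) = wave p z := by
  rw [wave, wave, pair, pair, map_mul, mul_mul_mul_comm, mul_conj, normSq_eq_norm_sq, norm_omega]
  simp

lemma waveSum_omega_mul {p a : ℤ × ℤ → ℂ} {j : ℕ} (hp : ∀ n, p (rot n) = ω * p n)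
    (ha : ∀ n, ω ^ j * a (rot n) = a n) (z : ℂ) :
    waveSum p a (ω * z) = ω ^ (-(j : ℤ)) * waveSum p a z := by
  rw [waveSum, waveSum, ← tsum_mul_left, ← rotEquiv.tsum_eq]
  refine tsum_congr fun n => ?_
  show a (rot n) * wave (p (rot n)) (ω * z) = _
  have hj : ω ^ j ≠ 0 := pow_ne_zero _ omega_ne_zero
  rw [hp, wave_omega_mul, ← ha n, zpow_neg, zpow_natCast]
  field_simp

lemma solFun_mem_kerPSet {α : ℂ} {j : ℕ} {a b : ℤ × ℤ → ℂ} (h : IsSol α 0 a b)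
    (ha : ∀ n, ω ^ j * a (rot n) = a n) (hb : ∀ n, ω ^ j * b (rot n) = b n) :
    solFun a b ∈ kerPSet UBM (fun z => UBM (-z)) α j := by
  refine ⟨?_, fun z => ?_⟩
  · have := h.inKer
    rwa [mul_zero] at this
  · simp only [solFun, Prod.smul_mk, smul_eq_mul]
    rw [waveSum_omega_mul mode_rot ha, waveSum_omega_mul (fun n => by rw [mode_rot, mul_neg]) hb]

/-- The solution obtained by convolving with a multiplier. -/
def convSol (a b : ℤ × ℤ → ℂ) (r : ℤ × ℤ → ℂ) : ℂ → ℂ × ℂ := solFun (convFst r a) (convSnd r b)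

lemma convSol_mem_kerSet {α : ℂ} {j : ℕ} {e : ℤ} {a b r : ℤ × ℤ → ℂ} (h : IsSol α 0 a b)
    (ha : ∀ n, ω ^ j * a (rot n) = a n) (hb : ∀ n, ω ^ j * b (rot n) = b n)
    (he : ω ^ e ≠ ω ^ j) (he' : ω ^ (-e) ≠ ω ^ j) {k : ℂ}
    (hr : r ∈ multipliers e (k / (4 * Real.pi / 3))) :
    convSol a b r ∈ kerSet UBM (fun z => UBM (-z)) α k := by
  have := (isSol_conv h ha hb he he' hr).inKer
  rwa [mul_div_cancel₀ _ (by simp [Real.pi_ne_zero])] at this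

lemma eq_zero_of_convSol_eq_zero {α : ℂ} {j : ℕ} {e : ℤ} {κ : ℂ} {a b r : ℤ × ℤ → ℂ}
    (h : IsSol α 0 a b) (ha0 : a ≠ 0)
    (ha : ∀ n, ω ^ j * a (rot n) = a n) (hb : ∀ n, ω ^ j * b (rot n) = b n)
    (he : ω ^ e ≠ ω ^ j) (he' : ω ^ (-e) ≠ ω ^ j) (hr : r ∈ multipliers e κ)
    (h0 : convSol a b r = 0) : r = 0 :=
  eq_zero_of_convFst_eq_zero hr h.rapidDecay.1 ha0
    (solFun_eq_zero (isSol_conv h ha hb he he' hr).rapidDecay.1 h0)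

/-! ### Fourier coefficients over the unit cell -/

/-- Integration over the unit cell of the lattice. -/
def cell (f : ℂ → ℂ) : ℂ := ∫ y in (0 : ℝ)..1, ∫ x in (0 : ℝ)..1, f (x + y * ω)

lemma continuous_cell_line {f : ℂ → ℂ} (hf : Continuous f) (y : ℝ) :
    Continuous fun x : ℝ => f (x + y * ω) := by fun_prop

lemma continuous_cell_inner {f : ℂ → ℂ} (hf : Continuous f) :
    Continuous fun y : ℝ => ∫ x in (0 : ℝ)..1, f (x + y * ω) :=
  intervalIntegral.continuous_parametric_intervalIntegral_of_continuous' (by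
    unfold Function.uncurry; fun_prop) _ _

lemma cell_add {f g : ℂ → ℂ} (hf : Continuous f) (hg : Continuous g) :
    cell (fun z => f z + g z) = cell f + cell g := by
  rw [cell, cell, cell, ← intervalIntegral.integral_add
    ((continuous_cell_inner hf).intervalIntegrable _ _)
    ((continuous_cell_inner hg).intervalIntegrable _ _)]
  congr 1; funext y
  exact intervalIntegral.integral_add ((continuous_cell_line hf y).intervalIntegrable _ _)
    ((continuous_cell_line hg y).intervalIntegrable _ _)

lemma cell_const_mul (c : ℂ) (f : ℂ → ℂ) : cell (fun z => c * f z) = c * cell f := by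
  simp [cell, intervalIntegral.integral_const_mul]

lemma cell_sum {ι : Type*} (s : Finset ι) {f : ι → ℂ → ℂ} (hf : ∀ i ∈ s, Continuous (f i)) :
    cell (fun z => ∑ i ∈ s, f i z) = ∑ i ∈ s, cell (f i) := by
  classical
  induction s using Finset.induction_on with
  | empty => simp [cell]
  | insert i s hi ih =>
    have h1 : ∀ i ∈ s, Continuous (f i) := fun j hj => hf j (Finset.mem_insert_of_mem hj)
    simp only [Finset.sum_insert hi]
    rw [cell_add (hf i (Finset.mem_insert_self i s)) (continuous_finsetSum s h1), ih h1]

lemma norm_cell_le {f : ℂ → ℂ} {C : ℝ}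
    (h : ∀ x ∈ Set.Icc (0 : ℝ) 1, ∀ y ∈ Set.Icc (0 : ℝ) 1, ‖f (x + y * ω)‖ ≤ C) :
    ‖cell f‖ ≤ C := by
  have h01 : Set.uIoc (0 : ℝ) 1 ⊆ Set.Icc 0 1 := by
    rw [Set.uIoc_of_le zero_le_one]; exact Set.Ioc_subset_Icc_self
  have := intervalIntegral.norm_integral_le_of_norm_le_const (a := 0) (b := 1) (C := C)
    (f := fun y : ℝ => ∫ x in (0 : ℝ)..1, f (x + y * ω)) fun y hy => by
      have := intervalIntegral.norm_integral_le_of_norm_le_const (a := 0) (b := 1) (C := C)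
        (f := fun x : ℝ => f (x + y * ω)) fun x hx => h x (h01 hx) y (h01 hy)
      simpa using this
  simpa [cell] using this

/-- Periodicity with respect to the lattice generators. -/
def LatticePeriodic (g : ℂ → ℂ) : Prop := ∀ z, g (z + 1) = g z ∧ g (z + ω) = g z

lemma cell_fderiv_one {g : ℂ → ℂ} (hg : ContDiff ℝ (⊤ : ℕ∞) g) (hp : LatticePeriodic g) :
    cell (fun z => fderiv ℝ g z 1) = 0 := by
  have hc : Continuous fun z => fderiv ℝ g z 1 :=
    (hg.continuous_fderiv (by simp)).clm_apply continuous_const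
  refine (intervalIntegral.integral_congr fun y _ => ?_).trans intervalIntegral.integral_zero
  have hd : ∀ x ∈ Set.uIcc (0 : ℝ) 1,
      HasDerivAt (fun x : ℝ => g (x + y * ω)) (fderiv ℝ g (x + y * ω) 1) x := by
    intro x _
    have h1 : HasDerivAt (fun x : ℝ => (x : ℂ) + y * ω) 1 x :=
      (hasDerivAt_id x).ofReal_comp.add_const _
    exact ((hg.differentiable (by simp)) _).hasFDerivAt.comp_hasDerivAt x h1
  simp only
  rw [intervalIntegral.integral_eq_sub_of_hasDerivAt hd
    ((continuous_cell_line hc y).intervalIntegrable _ _), sub_eq_zero]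
  have := (hp (y * ω)).1
  simpa [add_comm] using this

lemma cell_fderiv_omega {g : ℂ → ℂ} (hg : ContDiff ℝ (⊤ : ℕ∞) g) (hp : LatticePeriodic g) :
    cell (fun z => fderiv ℝ g z ω) = 0 := by
  have hc : Continuous fun z => fderiv ℝ g z ω :=
    (hg.continuous_fderiv (by simp)).clm_apply continuous_const
  rw [cell, intervalIntegral_intervalIntegral_swap]
  swap
  · have : Continuous (Function.uncurry fun y x : ℝ => fderiv ℝ g (x + y * ω) ω) := by
      have h2 : Continuous fun p : ℝ × ℝ => (p.2 : ℂ) + p.1 * ω := by fun_prop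
      exact hc.comp h2
    refine (this.continuousOn.integrableOn_compact
      (isCompact_uIcc.prod isCompact_uIcc)).mono_set (Set.prod_mono Set.uIoc_subset_uIcc
        Set.uIoc_subset_uIcc)
  refine (intervalIntegral.integral_congr fun x _ => ?_).trans intervalIntegral.integral_zero
  have hd : ∀ y ∈ Set.uIcc (0 : ℝ) 1,
      HasDerivAt (fun y : ℝ => g (x + y * ω)) (fderiv ℝ g (x + y * ω) ω) y := by
    intro y _
    have h1 : HasDerivAt (fun y : ℝ => (x : ℂ) + y * ω) ω y := by
      simpa using ((hasDerivAt_id y).ofReal_comp.mul_const ω).const_add (x : ℂ)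
    exact ((hg.differentiable (by simp)) _).hasFDerivAt.comp_hasDerivAt y h1
  have hcy : Continuous fun y : ℝ => fderiv ℝ g (x + y * ω) ω := by
    have h2 : Continuous fun y : ℝ => (x : ℂ) + y * ω := by fun_prop
    exact hc.comp h2
  rw [intervalIntegral.integral_eq_sub_of_hasDerivAt hd (hcy.intervalIntegrable _ _), sub_eq_zero]
  have := (hp x).2
  simpa using this

lemma cell_Dbar {g : ℂ → ℂ} (hg : ContDiff ℝ (⊤ : ℕ∞) g) (hp : LatticePeriodic g) :
    cell (Dbar g) = 0 := by
  have hc : ∀ v, Continuous fun z => fderiv ℝ g z v := fun v =>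
    (hg.continuous_fderiv (by simp)).clm_apply continuous_const
  have h3 : ((√3 : ℝ) : ℂ) ≠ 0 := by simp
  have hω : ω = (-1 / 2 : ℝ) • (1 : ℂ) + (√3 / 2 : ℝ) • I := by
    apply Complex.ext <;> simp [omega_re, omega_im]
  have e : Dbar g = fun z => (-I + 1 / √3) * fderiv ℝ g z 1 + 2 / √3 * fderiv ℝ g z ω := by
    funext z
    have : fderiv ℝ g z ω = (-1 / 2 : ℝ) • fderiv ℝ g z 1 + (√3 / 2 : ℝ) • fderiv ℝ g z I := by
      conv_lhs => rw [hω]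
      simp only [map_add, map_smul]
    rw [Dbar, this]
    simp only [real_smul]
    push_cast
    have hI : (1 : ℂ) / I = -I := by simp
    rw [hI]
    field_simp
    linear_combination (-√3 * fderiv ℝ g z I) * I_sq
  rw [e, cell_add
    (show Continuous fun z => (-I + 1 / √3) * fderiv ℝ g z 1 from continuous_const.mul (hc _))
    (show Continuous fun z => 2 / √3 * fderiv ℝ g z ω from continuous_const.mul (hc _)),
    cell_const_mul,
    cell_const_mul, cell_fderiv_one hg hp, cell_fderiv_omega hg hp]
  simp

lemma continuous_Dbar {f : ℂ → ℂ} (hf : ContDiff ℝ (⊤ : ℕ∞) f) : Continuous (Dbar f) := by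
  have hc : ∀ v, Continuous fun z => fderiv ℝ f z v := fun v =>
    (hf.continuous_fderiv (by simp)).clm_apply continuous_const
  exact continuous_const.mul ((hc _).add (continuous_const.mul (hc _)))

lemma cell_Dbar_mul_wave {f : ℂ → ℂ} {p : ℂ} (hf : ContDiff ℝ (⊤ : ℕ∞) f)
    (hp : LatticePeriodic fun z => f z * wave p z) :
    cell (fun z => Dbar f z * wave p z) = -(4 * Real.pi / 3 * p) * cell (fun z => f z * wave p z) := by
  have h := cell_Dbar (hf.mul (contDiff_wave p)) hp
  have e : Dbar (fun z => f z * wave p z) = fun z =>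
      Dbar f z * wave p z + (4 * Real.pi / 3 * p) * (f z * wave p z) := by
    funext z
    have hd := fderiv_fun_mul (hf.differentiable (by simp) z)
      ((contDiff_wave p).differentiable (by simp) z)
    have hw := Dbar_wave p z
    rw [Dbar] at hw
    rw [Dbar, hd, Dbar]
    simp only [add_apply, smul_apply, smul_eq_mul]
    linear_combination f z * hw
  have hw := (contDiff_wave p).continuous
  rw [e, cell_add (show Continuous fun z => Dbar f z * wave p z from (continuous_Dbar hf).mul hw)
    (show Continuous fun z => 4 * Real.pi / 3 * p * (f z * wave p z) from
      continuous_const.mul (hf.continuous.mul hw)),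
    cell_const_mul] at h
  linear_combination h

lemma eq_zero_of_cell_eq_zero {h : ℂ → ℂ} (hc : Continuous h) (hp : LatticePeriodic h)
    (h0 : ∀ m n : ℤ, ∫ y in (0 : ℝ)..1, (∫ x in (0 : ℝ)..1, h (x + y * ω) * expZ n x) * expZ m y = 0) :
    h = 0 := by
  have key : ∀ x y : ℝ, h (x + y * ω) = 0 := by
    have h1 : ∀ n : ℤ, (fun y : ℝ => ∫ x in (0 : ℝ)..1, h (x + y * ω) * expZ n x) = 0 := by
      intro n
      refine eq_zero_of_integral_expZ_eq_zero ?_ (fun y => ?_) fun m => h0 m n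
      · refine intervalIntegral.continuous_parametric_intervalIntegral_of_continuous' ?_ _ _
        unfold Function.uncurry
        have := continuous_expZ n
        fun_prop
      · congr 1; funext x
        have := (hp (x + y * ω)).2
        rw [← this]; push_cast; ring_nf
    intro x y
    have h2 : (fun x : ℝ => h (x + y * ω)) = 0 :=
      eq_zero_of_integral_expZ_eq_zero (continuous_cell_line hc y) (fun x => by
        have := (hp (x + y * ω)).1
        rw [← this]; push_cast; ring_nf) fun n => congrFun (h1 n) y
    exact congrFun h2 x
  funext z
  have h3 : (√3 : ℝ) ≠ 0 := by simp
  have hz : z = ((z.re + z.im / √3 : ℝ) : ℂ) + ((2 * z.im / √3 : ℝ) : ℂ) * ω := by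
    apply Complex.ext
    · simp only [add_re, ofReal_re, mul_re, omega_re, ofReal_im, zero_mul, sub_zero]
      ring
    · simp only [add_im, ofReal_im, mul_im, omega_im, ofReal_re, zero_mul, add_zero, zero_add]
      field_simp
  rw [hz, key]; rfl

/-! ### Finite dimensionality of the kernel -/

/-- Fourier coefficients of the first component. -/
def coefFst (u : ℂ → ℂ × ℂ) (n : ℤ × ℤ) : ℂ := cell fun z => (u z).1 * wave (-mode n) z

/-- Fourier coefficients of the second component. -/
def coefSnd (u : ℂ → ℂ × ℂ) (n : ℤ × ℤ) : ℂ := cell fun z => (u z).2 * wave (mode n) z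

lemma one_mem_lattice : (1 : ℂ) ∈ Λ := ⟨0, 1, by simp⟩

lemma omega_mem_lattice : ω ∈ Λ := ⟨1, 0, by simp⟩

lemma wave_mode_of_mem (n : ℤ × ℤ) {γ : ℂ} (hγ : γ ∈ Λ) : wave (mode n) γ = wave (-1) γ := by
  obtain ⟨p, q, rfl⟩ := hγ
  exact wave_mode_lattice n p q

lemma latticePeriodic_of_forall {g : ℂ → ℂ} (h : ∀ γ ∈ Λ, ∀ z, g (z + γ) = g z) :
    LatticePeriodic g :=
  fun z => ⟨h _ one_mem_lattice z, h _ omega_mem_lattice z⟩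

lemma wave_mul_wave_neg (p z : ℂ) : wave p z * wave (-p) z = 1 := by
  rw [← wave_add, add_neg_cancel, wave_zero]

lemma latticePeriodic_fst {Up Um : ℂ → ℂ} {α k : ℂ} {u : ℂ → ℂ × ℂ} (h : InKer Up Um α k u)
    (n : ℤ × ℤ) : LatticePeriodic fun z => (u z).1 * wave (-mode n) z := by
  refine latticePeriodic_of_forall fun γ hγ z => ?_
  rw [h.2.2.2.1 γ hγ z, exp_neg_pair_K, wave_add_right, ← wave_mode_of_mem n hγ]
  linear_combination (u z).1 * wave (-mode n) z * wave_mul_wave_neg (mode n) γ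

lemma latticePeriodic_snd {Up Um : ℂ → ℂ} {α k : ℂ} {u : ℂ → ℂ × ℂ} (h : InKer Up Um α k u)
    (n : ℤ × ℤ) : LatticePeriodic fun z => (u z).2 * wave (mode n) z := by
  refine latticePeriodic_of_forall fun γ hγ z => ?_
  rw [h.2.2.2.2 γ hγ z, exp_pair_K, wave_add_right, wave_mode_of_mem n hγ]
  linear_combination (u z).2 * wave (mode n) z * wave_mul_wave_neg 1 γ

lemma exists_norm_cell_mul_wave_le {f : ℂ → ℂ} (hf : Continuous f) :
    ∃ C, ∀ p, ‖cell fun z => f z * wave p z‖ ≤ C := by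
  have hc : Continuous fun x : ℝ × ℝ => f (x.1 + x.2 * ω) := by fun_prop
  obtain ⟨C, hC⟩ := (isCompact_Icc.prod isCompact_Icc).exists_bound_of_continuousOn
    (hc.continuousOn (s := Set.Icc (0 : ℝ) 1 ×ˢ Set.Icc (0 : ℝ) 1))
  refine ⟨C, fun p => norm_cell_le fun x hx y hy => ?_⟩
  rw [norm_mul, norm_wave, mul_one]
  exact hC (x, y) ⟨hx, hy⟩

lemma cell_UBM_mul {f : ℂ → ℂ} (hf : Continuous f) (s p : ℂ) :
    cell (fun z => UBM (s * z) * f z * wave p z) = -(4 * Real.pi / 3) * I *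
      ∑ l ∈ Finset.range 3, ω ^ l * cell (fun z => f z * (wave (ω ^ l) (s * z) * wave p z)) := by
  have hw : ∀ p, Continuous (wave p) := fun p => (contDiff_wave p).continuous
  have e : (fun z => UBM (s * z) * f z * wave p z) = fun z => -(4 * Real.pi / 3) * I *
      ∑ l ∈ Finset.range 3, ω ^ l * (f z * (wave (ω ^ l) (s * z) * wave p z)) := by
    funext z
    rw [UBM_eq, mul_assoc, mul_assoc, Finset.sum_mul]
    congr 1
    exact Finset.sum_congr rfl fun l _ => by ring
  have hc : ∀ l ∈ Finset.range 3,
      Continuous fun z => ω ^ l * (f z * (wave (ω ^ l) (s * z) * wave p z)) := fun l _ =>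
    continuous_const.mul (hf.mul (((hw _).comp (continuous_const.mul continuous_id)).mul (hw p)))
  rw [e, cell_const_mul, cell_sum _ hc]
  simp only [cell_const_mul]

lemma isSol_coef {α κ : ℂ} {u : ℂ → ℂ × ℂ}
    (h : InKer UBM (fun z => UBM (-z)) α (4 * Real.pi / 3 * κ) u) :
    IsSol α κ (coefFst u) (coefSnd u) := by
  have hf1 : ContDiff ℝ (⊤ : ℕ∞) fun z => (u z).1 := contDiff_fst.comp h.1
  have hf2 : ContDiff ℝ (⊤ : ℕ∞) fun z => (u z).2 := contDiff_snd.comp h.1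
  have hw : ∀ p, Continuous (wave p) := fun p => (contDiff_wave p).continuous
  have hU : Continuous UBM := by
    have : UBM = fun z => -(4 * Real.pi / 3) * I *
      ∑ l ∈ Finset.range 3, ω ^ l * wave (ω ^ l) z := funext UBM_eq
    rw [this]
    exact continuous_const.mul (continuous_finsetSum _ fun l _ => continuous_const.mul (hw _))
  have hpi : (4 * Real.pi / 3 : ℂ) ≠ 0 := by simp [Real.pi_ne_zero]
  have key : ∀ {f g : ℂ → ℂ} (s p : ℂ), ContDiff ℝ (⊤ : ℕ∞) f → Continuous g →
      LatticePeriodic (fun z => f z * wave p z) →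
      (∀ z, Dbar f z + 4 * Real.pi / 3 * κ * f z + α * UBM (s * z) * g z = 0) →
      (-p + κ) * cell (fun z => f z * wave p z) = I * α * ∑ l ∈ Finset.range 3,
        ω ^ l * cell (fun z => g z * (wave (ω ^ l) (s * z) * wave p z)) := by
    intro f g s p hf hg hp heq
    have h1 := cell_Dbar_mul_wave hf hp
    have h2 := cell_UBM_mul hg s p
    have hUs : Continuous fun z => UBM (s * z) := hU.comp (continuous_const.mul continuous_id)
    have h3 : cell (fun z => Dbar f z * wave p z + (4 * Real.pi / 3 * κ * (f z * wave p z) +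
        α * (UBM (s * z) * g z * wave p z))) = 0 := by
      have : (fun z => Dbar f z * wave p z + (4 * Real.pi / 3 * κ * (f z * wave p z) +
          α * (UBM (s * z) * g z * wave p z))) = fun z => 0 * (0 : ℂ) := by
        funext z
        linear_combination wave p z * heq z
      rw [this, cell_const_mul, zero_mul]
    have c1 : Continuous fun z => Dbar f z * wave p z := (continuous_Dbar hf).mul (hw p)
    have c2 : Continuous fun z => 4 * Real.pi / 3 * κ * (f z * wave p z) :=
      continuous_const.mul (hf.continuous.mul (hw p))
    have c3 : Continuous fun z => α * (UBM (s * z) * g z * wave p z) :=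
      continuous_const.mul ((hUs.mul hg).mul (hw p))
    rw [cell_add c1 (show Continuous fun z => 4 * Real.pi / 3 * κ * (f z * wave p z) +
      α * (UBM (s * z) * g z * wave p z) from c2.add c3), cell_add c2 c3, cell_const_mul, cell_const_mul, h1, h2] at h3
    refine mul_left_cancel₀ hpi ?_
    linear_combination h3
  obtain ⟨C, hC⟩ := exists_norm_cell_mul_wave_le hf1.continuous
  obtain ⟨C', hC'⟩ := exists_norm_cell_mul_wave_le hf2.continuous
  refine ⟨⟨max C C', fun n => ⟨(hC _).trans (le_max_left _ _), (hC' _).trans (le_max_right _ _)⟩⟩,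
    fun n => ?_, fun n => ?_⟩
  · have := key 1 (-mode n) hf1 hf2.continuous (latticePeriodic_fst h n) fun z => by
      simpa using h.2.1 z
    rw [neg_neg] at this
    rw [coefFst, this]
    congr 1
    refine Finset.sum_congr rfl fun l hl => ?_
    rw [coefSnd, mode_refl (Finset.mem_range.mp hl)]
    congr 2; funext z
    rw [one_mul, ← wave_add, sub_eq_add_neg]
  · have := key (-1) (mode n) hf2 hf1.continuous (latticePeriodic_snd h n) fun z => by
      simpa using h.2.2.1 z
    rw [coefSnd, this]
    congr 1
    refine Finset.sum_congr rfl fun l hl => ?_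
    rw [coefFst, mode_refl (Finset.mem_range.mp hl)]
    congr 2; funext z
    rw [neg_one_mul, wave_neg_right, ← wave_add]
    congr 2; ring

lemma eq_zero_of_coef_eq_zero {Up Um : ℂ → ℂ} {α k : ℂ} {u : ℂ → ℂ × ℂ} (h : InKer Up Um α k u)
    (h1 : coefFst u = 0) (h2 : coefSnd u = 0) : u = 0 := by
  have hw : ∀ p, Continuous (wave p) := fun p => (contDiff_wave p).continuous
  have p1 : LatticePeriodic fun z => (u z).1 * wave 1 z := by
    have := latticePeriodic_fst h 0
    simpa [mode] using this
  have p2 : LatticePeriodic fun z => (u z).2 * wave (-1) z := by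
    have := latticePeriodic_snd h 0
    simpa [mode] using this
  have key : ∀ {f : ℂ → ℂ}, Continuous f → LatticePeriodic f →
      (∀ n, cell (fun z => f z * (wave 1 z * wave (mode n) z)) = 0) → f = 0 := by
    intro f hf hp hn
    refine eq_zero_of_cell_eq_zero hf hp fun m n => ?_
    rw [← hn (m, -n), cell]
    congr 1; funext y
    rw [← intervalIntegral.integral_mul_const]
    congr 1; funext x
    rw [wave_mode]
    simp only [neg_neg]
    linear_combination -f (x + y * ω) * expZ n x * expZ m y * wave_mul_wave_neg 1 (x + y * ω)
  have z1 := key ((continuous_fst.comp h.1.continuous).mul (hw 1)) p1 fun n => by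
    have := congrFun h1 (-n)
    rw [coefFst] at this
    rw [← this.trans (Pi.zero_apply _)]
    congr 1; funext z
    have e : -mode (-n) = 1 + (1 + mode n) := by simp [mode]; ring
    rw [e, wave_add, wave_add, Pi.mul_apply, Function.comp_apply]; ring
  have z2 := key ((continuous_snd.comp h.1.continuous).mul (hw (-1))) p2 fun n => by
    have := congrFun h2 n
    rw [coefSnd] at this
    rw [← this.trans (Pi.zero_apply _)]
    congr 1; funext z
    rw [Pi.mul_apply, Function.comp_apply]
    linear_combination (u z).2 * wave (mode n) z * wave_mul_wave_neg 1 z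
  funext z
  exact Prod.ext ((mul_eq_zero.mp (congrFun z1 z)).resolve_right (wave_ne_zero _ _))
    ((mul_eq_zero.mp (congrFun z2 z)).resolve_right (wave_ne_zero _ _))

lemma IsSol.eq_zero {α κ : ℂ} {a b : ℤ × ℤ → ℂ} (h : IsSol α κ a b)
    (h0 : ∀ n, ‖mode n‖ ≤ ‖κ‖ + 6 * ‖α‖ + 1 → a n = 0 ∧ b n = 0) : a = 0 ∧ b = 0 := by
  obtain ⟨B, hB⟩ := h.bounded
  set s : ℤ × ℤ → ℝ := fun n => ‖a n‖ + ‖b n‖ with hs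
  have hbdd : BddAbove (Set.range s) :=
    ⟨B + B, by rintro _ ⟨n, rfl⟩; exact add_le_add (hB n).1 (hB n).2⟩
  have hle : ∀ n, s n ≤ ⨆ n, s n := le_ciSup hbdd
  have hs0 : ∀ n, 0 ≤ s n := fun n => by positivity
  set S := ⨆ n, s n
  have hS0 : 0 ≤ S := (hs0 0).trans (hle 0)
  have hhalf : S ≤ S / 2 := by
    refine ciSup_le fun n => ?_
    rcases le_or_gt ‖mode n‖ (‖κ‖ + 6 * ‖α‖ + 1) with hn | hn
    · simp only [hs, (h0 n hn).1, (h0 n hn).2, norm_zero, add_zero]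
      positivity
    · have h1 := h.norm_le n
      have h2 := Finset.sum_le_card_nsmul (Finset.range 3) (fun l => s (refl l n)) S
        fun l _ => hle _
      rw [Finset.card_range, nsmul_eq_mul] at h2
      have h3 := h1.trans (mul_le_mul_of_nonneg_left h2 (norm_nonneg α))
      have h4 : (6 * ‖α‖ + 1) * s n ≤ (‖mode n‖ - ‖κ‖) * s n :=
        mul_le_mul_of_nonneg_right (by linarith) (hs0 n)
      have h5 := h4.trans h3
      push_cast at h5
      have h6 : 0 < 6 * ‖α‖ + 1 := by positivity
      refine le_of_mul_le_mul_left (h5.trans ?_) h6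
      linarith
  have hS : S = 0 := by linarith
  have hz : ∀ n, s n = 0 := fun n => le_antisymm ((hle n).trans hS.le) (hs0 n)
  constructor <;> funext n <;> have := hz n
  · exact norm_eq_zero.mp (by linarith [norm_nonneg (a n), norm_nonneg (b n)])
  · exact norm_eq_zero.mp (by linarith [norm_nonneg (a n), norm_nonneg (b n)])

lemma Dbar_add {f g : ℂ → ℂ} (hf : ContDiff ℝ (⊤ : ℕ∞) f) (hg : ContDiff ℝ (⊤ : ℕ∞) g) (z : ℂ) :
    Dbar (fun w => f w + g w) z = Dbar f z + Dbar g z := by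
  rw [Dbar, Dbar, Dbar, fderiv_fun_add (hf.differentiable (by simp) z)
    (hg.differentiable (by simp) z)]
  simp only [add_apply]
  ring

lemma Dbar_const_mul {f : ℂ → ℂ} (hf : ContDiff ℝ (⊤ : ℕ∞) f) (c z : ℂ) :
    Dbar (fun w => c * f w) z = c * Dbar f z := by
  rw [Dbar, Dbar, fderiv_const_mul (hf.differentiable (by simp) z)]
  simp only [smul_apply, smul_eq_mul]
  ring

/-- The kernel as a linear subspace. -/
def kerSubmodule (Up Um : ℂ → ℂ) (α k : ℂ) : Submodule ℂ (ℂ → ℂ × ℂ) where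
  carrier := kerSet Up Um α k
  zero_mem' := by
    refine ⟨contDiff_const, ?_, ?_, ?_, ?_⟩ <;> simp [Dbar]
  add_mem' := by
    rintro u v ⟨hu, hu1, hu2, hu3, hu4⟩ ⟨hv, hv1, hv2, hv3, hv4⟩
    refine ⟨hu.add hv, fun z => ?_, fun z => ?_, fun γ hγ z => ?_, fun γ hγ z => ?_⟩
    · have := Dbar_add (contDiff_fst.comp hu) (contDiff_fst.comp hv) z
      simp only [Function.comp_def] at this
      simp only [Pi.add_apply, Prod.fst_add, Prod.snd_add, this]
      linear_combination hu1 z + hv1 z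
    · have := Dbar_add (contDiff_snd.comp hu) (contDiff_snd.comp hv) z
      simp only [Function.comp_def] at this
      simp only [Pi.add_apply, Prod.fst_add, Prod.snd_add, this]
      linear_combination hu2 z + hv2 z
    · simp only [Pi.add_apply, Prod.fst_add, hu3 γ hγ, hv3 γ hγ, mul_add]
    · simp only [Pi.add_apply, Prod.snd_add, hu4 γ hγ, hv4 γ hγ, mul_add]
  smul_mem' := by
    rintro c u ⟨hu, hu1, hu2, hu3, hu4⟩
    refine ⟨contDiff_const.smul hu, fun z => ?_, fun z => ?_, fun γ hγ z => ?_, fun γ hγ z => ?_⟩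
    · have := Dbar_const_mul (contDiff_fst.comp hu) c z
      simp only [Function.comp_def] at this
      simp only [Pi.smul_apply, Prod.smul_fst, Prod.smul_snd, smul_eq_mul, this]
      linear_combination c * hu1 z
    · have := Dbar_const_mul (contDiff_snd.comp hu) c z
      simp only [Function.comp_def] at this
      simp only [Pi.smul_apply, Prod.smul_fst, Prod.smul_snd, smul_eq_mul, this]
      linear_combination c * hu2 z
    · simp only [Pi.smul_apply, Prod.smul_fst, smul_eq_mul, hu3 γ hγ, mul_left_comm]
    · simp only [Pi.smul_apply, Prod.smul_snd, smul_eq_mul, hu4 γ hγ, mul_left_comm]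

lemma finiteDimensional_ker (α κ : ℂ) :
    FiniteDimensional ℂ (kerSubmodule UBM (fun z => UBM (-z)) α (4 * Real.pi / 3 * κ)) := by
  set V := kerSubmodule UBM (fun z => UBM (-z)) α (4 * Real.pi / 3 * κ)
  have hfin := finite_norm_mode_le (‖κ‖ + 6 * ‖α‖ + 1)
  let F := {n | ‖mode n‖ ≤ ‖κ‖ + 6 * ‖α‖ + 1}
  have : Finite F := hfin
  have hw : ∀ p, Continuous (wave p) := fun p => (contDiff_wave p).continuous
  let Φ : V →ₗ[ℂ] (F → ℂ × ℂ) :=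
    { toFun := fun u n => (coefFst u.1 n.1, coefSnd u.1 n.1)
      map_add' := by
        rintro ⟨u, hu⟩ ⟨v, hv⟩
        funext n
        have hu := hu.1.continuous
        have hv := hv.1.continuous
        refine Prod.ext ?_ ?_
        · simp only [coefFst, Pi.add_apply, Prod.fst_add, add_mul, Prod.mk_add_mk, Submodule.coe_add]
          exact cell_add ((continuous_fst.comp hu).mul (hw _)) ((continuous_fst.comp hv).mul (hw _))
        · simp only [coefSnd, Pi.add_apply, Prod.snd_add, add_mul, Prod.mk_add_mk, Submodule.coe_add]
          exact cell_add ((continuous_snd.comp hu).mul (hw _)) ((continuous_snd.comp hv).mul (hw _))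
      map_smul' := by
        rintro c ⟨u, hu⟩
        funext n
        refine Prod.ext ?_ ?_ <;>
          simp [coefFst, coefSnd, mul_assoc, cell_const_mul] }
  refine FiniteDimensional.of_injective Φ ((injective_iff_map_eq_zero Φ).mpr ?_)
  rintro ⟨u, hu⟩ h0
  obtain ⟨h1, h2⟩ := (isSol_coef hu).eq_zero fun n hn => Prod.ext_iff.mp (congrFun h0 ⟨n, hn⟩)
  exact Subtype.ext (eq_zero_of_coef_eq_zero hu h1 h2)

lemma two_le_kerDim {α k : ℂ} {u v : ℂ → ℂ × ℂ} (hu : u ∈ kerSet UBM (fun z => UBM (-z)) α k)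
    (hv : v ∈ kerSet UBM (fun z => UBM (-z)) α k) (huv : LinearIndependent ℂ ![u, v]) :
    2 ≤ kerDim UBM (fun z => UBM (-z)) α k := by
  set V := kerSubmodule UBM (fun z => UBM (-z)) α k
  have e : Submodule.span ℂ (kerSet UBM (fun z => UBM (-z)) α k) = V := Submodule.span_eq V
  have hfd := finiteDimensional_ker α (k / (4 * Real.pi / 3))
  rw [mul_div_cancel₀ _ (by simp [Real.pi_ne_zero])] at hfd
  rw [kerDim, e]
  have hli : LinearIndependent ℂ ![(⟨u, hu⟩ : V), ⟨v, hv⟩] := by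
    rw [LinearIndependent.pair_iff] at huv ⊢
    intro x y hxy
    exact huv x y (congrArg Subtype.val hxy)
  simpa using hli.fintype_card_le_finrank

/-! ### Conclusion -/

lemma waveSum_add {p a b : ℤ × ℤ → ℂ} (ha : Summable fun n => ‖a n‖)
    (hb : Summable fun n => ‖b n‖) (z : ℂ) :
    waveSum p (a + b) z = waveSum p a z + waveSum p b z := by
  simp only [waveSum, Pi.add_apply, add_mul]
  exact (summable_mul_wave ha z).tsum_add (summable_mul_wave hb z)

lemma waveSum_smul (c : ℂ) (p a : ℤ × ℤ → ℂ) (z : ℂ) :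
    waveSum p (c • a) z = c * waveSum p a z := by
  simp only [waveSum, Pi.smul_apply, smul_eq_mul, mul_assoc, tsum_mul_left]

lemma convFst_add {e : ℤ} {κ : ℂ} {r s a : ℤ × ℤ → ℂ} (hr : r ∈ multipliers e κ)
    (hs : s ∈ multipliers e κ) (ha : Summable fun n => ‖a n‖) :
    convFst (r + s) a = convFst r a + convFst s a := by
  funext n
  simp only [convFst, Pi.add_apply, add_mul]
  exact (summable_bounded_mul hr.1 (summable_norm_sub ha n)).tsum_add
    (summable_bounded_mul hs.1 (summable_norm_sub ha n))

lemma convFst_smul (c : ℂ) (r a : ℤ × ℤ → ℂ) : convFst (c • r) a = c • convFst r a := by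
  funext n
  simp only [convFst, Pi.smul_apply, smul_eq_mul, mul_assoc, tsum_mul_left]

lemma linearIndependent_convSol {α : ℂ} {j : ℕ} {e : ℤ} {κ : ℂ} {a b r s : ℤ × ℤ → ℂ}
    (h : IsSol α 0 a b) (ha0 : a ≠ 0)
    (ha : ∀ n, ω ^ j * a (rot n) = a n) (hb : ∀ n, ω ^ j * b (rot n) = b n)
    (he : ω ^ e ≠ ω ^ j) (he' : ω ^ (-e) ≠ ω ^ j) (hr : r ∈ multipliers e κ)
    (hs : s ∈ multipliers e κ) (hrs : LinearIndependent ℂ ![r, s]) :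
    LinearIndependent ℂ ![convSol a b r, convSol a b s] := by
  rw [LinearIndependent.pair_iff] at hrs ⊢
  intro x y hxy
  have hsa := h.rapidDecay.1
  have hx := (multipliers e κ).smul_mem x hr
  have hy := (multipliers e κ).smul_mem y hs
  have hxs := (isSol_conv h ha hb he he' hx).rapidDecay.1.summable
  have hys := (isSol_conv h ha hb he he' hy).rapidDecay.1.summable
  have hxys := (isSol_conv h ha hb he he' (add_mem hx hy)).rapidDecay.1.summable
  refine hrs x y (eq_zero_of_convFst_eq_zero (add_mem hx hy) hsa ha0 ?_)
  refine eq_zero_of_waveSum_mode_eq_zero hxys fun z => ?_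
  rw [convFst_add hx hy hsa.summable, waveSum_add hxs hys, convFst_smul, convFst_smul,
    waveSum_smul, waveSum_smul]
  exact congrArg Prod.fst (congrFun hxy z)

lemma isMagic_of_isSol {α : ℂ} {j : ℕ} {e : ℤ} {a b : ℤ × ℤ → ℂ} (h : IsSol α 0 a b)
    (ha0 : a ≠ 0) (ha : ∀ n, ω ^ j * a (rot n) = a n) (hb : ∀ n, ω ^ j * b (rot n) = b n)
    (he : ω ^ e ≠ ω ^ j) (he' : ω ^ (-e) ≠ ω ^ j) : IsMagic UBM (fun z => UBM (-z)) α := by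
  intro k
  obtain ⟨r, hr, hr0⟩ := exists_multiplier_ne_zero e (k / (4 * Real.pi / 3))
  exact ⟨_, convSol_mem_kerSet h ha hb he he' hr,
    fun h0 => hr0 (eq_zero_of_convSol_eq_zero h ha0 ha hb he he' hr h0)⟩

lemma exists_nonreal_isSol {j : ℕ} (hj : j < 3) : ∃ (α : ℂ) (a b : ℤ × ℤ → ℂ), α.im ≠ 0 ∧
    IsSol α 0 a b ∧ a ≠ 0 ∧ (∀ n, ω ^ j * a (rot n) = a n) ∧ ∀ n, ω ^ j * b (rot n) = b n := by
  obtain ⟨d, a, hd, hB, ha0, hda, ha⟩ := exists_nonreal_eigenvalue_sector hj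
  have hd0 : d ≠ 0 := fun h => hd (by rw [h, zero_im])
  refine ⟨d⁻¹, a, -I • a, ?_, isSol_of_eigenvector hd0 hB hda, ha0, ha, fun n => ?_⟩
  · rw [inv_im]
    exact div_ne_zero (neg_ne_zero.mpr hd) (normSq_eq_zero.not.mpr hd0)
  · simp only [Pi.smul_apply, smul_eq_mul]
    rw [mul_left_comm, ha]

lemma omega_ne_one : ω ≠ 1 := omega_primitive.ne_one (by norm_num)

lemma exists_character {j : ℕ} (hj : j < 3) : ∃ e : ℤ, ω ^ e ≠ ω ^ j ∧ ω ^ (-e) ≠ ω ^ j := by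
  rcases Nat.eq_zero_or_pos j with rfl | hpos
  · exact ⟨1, by simpa using omega_ne_one, by simpa using omega_ne_one⟩
  · have := omega_primitive.pow_ne_one_of_pos_of_lt hpos.ne' hj
    exact ⟨0, by simpa using this.symm, by simpa using this.symm⟩

/-- **Statement 10: non-real magic angles in every rotational representation for the
BM potential, and existence of a non-real non-simple magic parameter.** -/
theorem nonreal_magic_in_each_representation_BM :
    (∀ j : ℕ, j < 3 → ∃ α : ℂ, α.im ≠ 0 ∧ IsMagic UBM (fun z => UBM (-z)) α ∧
      ∃ u ∈ kerPSet UBM (fun z => UBM (-z)) α j, u ≠ 0) ∧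
    ∃ α : ℂ, α.im ≠ 0 ∧ IsMagic UBM (fun z => UBM (-z)) α ∧
      ∀ k : ℂ, 2 ≤ kerDim UBM (fun z => UBM (-z)) α k := by
  constructor
  · intro j hj
    obtain ⟨α, a, b, hα, h, ha0, ha, hb⟩ := exists_nonreal_isSol hj
    obtain ⟨e, he, he'⟩ := exists_character hj
    exact ⟨α, hα, isMagic_of_isSol h ha0 ha hb he he', _, solFun_mem_kerPSet h ha hb,
      fun h0 => ha0 (solFun_eq_zero h.rapidDecay.1 h0)⟩
  · obtain ⟨α, a, b, hα, h, ha0, ha, hb⟩ := exists_nonreal_isSol (j := 0) (by norm_num)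
    have he : ω ^ (1 : ℤ) ≠ ω ^ 0 := by simpa using omega_ne_one
    have he' : ω ^ (-1 : ℤ) ≠ ω ^ 0 := by simpa using omega_ne_one
    refine ⟨α, hα, isMagic_of_isSol h ha0 ha hb he he', fun k => ?_⟩
    obtain ⟨r, hr, s, hs, hrs⟩ := exists_multiplier_pair (k / (4 * Real.pi / 3))
    exact two_le_kerDim (convSol_mem_kerSet h ha hb he he' hr)
      (convSol_mem_kerSet h ha hb he he' hs)
      (linearIndependent_convSol h ha0 ha hb he he' hr hs hrs)

end TBG
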